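/- Every minimal (bihomogeneous) generating set of the algebra C_{5,2} has cardinality 173; in particular, C_{5,2} has a minimal generating set consisting of 173 bihomogeneous polynomials. -/

import Mathlib

open MvPolynomial Matrix

noncomputable section

/-- Index type for the entries of a pair of generic `n × n` matrices:
`Sum.inl (i,j)` indexes the `(i,j)` entry of `x`, `Sum.inr (i,j)` that of `y`. -/
abbrev MatVar (n : ℕ) := (Fin n × Fin n) ⊕ (Fin n × Fin n)

/-- The substitution sending the variables to the entries of the pair `(A, B)`. -/
def pairSub {K : Type*} [CommSemiring K] {n : ℕ} (A B : Matrix (Fin n) (Fin n) K) :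
    MatVar n → K
  | Sum.inl ij => A ij.1 ij.2
  | Sum.inr ij => B ij.1 ij.2

/-- A polynomial function on pairs of `n × n` matrices is `GLₙ`-invariant (for the action
by simultaneous conjugation). -/
def IsMatInvariant {K : Type*} [Field K] {n : ℕ} (f : MvPolynomial (MatVar n) K) : Prop :=
  ∀ (a : GL (Fin n) K) (A B : Matrix (Fin n) (Fin n) K),
    MvPolynomial.eval
        (pairSub ((a : Matrix (Fin n) (Fin n) K) * A * ((a⁻¹ : GL (Fin n) K) : Matrix (Fin n) (Fin n) K))
          ((a : Matrix (Fin n) (Fin n) K) * B * ((a⁻¹ : GL (Fin n) K) : Matrix (Fin n) (Fin n) K))) f =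
      MvPolynomial.eval (pairSub A B) f

/-- The weight giving the bidegree: entries of `x` have weight `(1,0)`,
those of `y` have weight `(0,1)`. -/
def bideg (n : ℕ) : MatVar n → ℕ × ℕ
  | Sum.inl _ => (1, 0)
  | Sum.inr _ => (0, 1)

/-- The bigraded component of bidegree `(p, q)` of the pure trace algebra `C_{n,2}`. -/
def pureComponent (K : Type*) [Field K] (n p q : ℕ) : Set (MvPolynomial (MatVar n) K) :=
  {f | IsMatInvariant f ∧ f.IsWeightedHomogeneous (bideg n) (p, q)}

/-- `dim_K C_{n,2}^{(p,q)}`. -/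
def pureDim (K : Type*) [Field K] (n p q : ℕ) : ℕ :=
  Set.finrank K (pureComponent K n p q)

/-- The bigraded Poincaré series `P(C_{n,2}; s, t)`, with `s` the variable `X 0` and
`t` the variable `X 1`. -/
def purePS2 (K : Type*) [Field K] (n : ℕ) : MvPowerSeries (Fin 2) ℚ :=
  fun d => (pureDim K n (d 0) (d 1) : ℚ)

/-- abbreviation for the power series variable `s`. -/
def ps : MvPowerSeries (Fin 2) ℚ := MvPowerSeries.X 0

/-- abbreviation for the power series variable `t`. -/
def pt : MvPowerSeries (Fin 2) ℚ := MvPowerSeries.X 1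


/-- The pure trace algebra `C_{n,2}`: the subalgebra of `GLₙ`-invariant polynomial
functions on pairs of `n × n` matrices. -/
def pureAlg (K : Type*) [Field K] (n : ℕ) : Subalgebra K (MvPolynomial (MatVar n) K) where
  carrier := {f | IsMatInvariant f}
  mul_mem' := fun hf hg a A B => by
    simp only [_root_.map_mul]
    rw [hf a A B, hg a A B]
  add_mem' := fun hf hg a A B => by
    simp only [_root_.map_add]
    rw [hf a A B, hg a A B]
  algebraMap_mem' := fun c a A B => by
    simp [MvPolynomial.algebraMap_eq]

local notation "nZ" => nat_lit 0
local notation "nT" => nat_lit 2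
local notation "nQ" => nat_lit 64
local notation "nE" => nat_lit 8
local notation "nU" => nat_lit 1
local notation "nX" => nat_lit 60
local notation "nS" => nat_lit 7
local notation "nW" => nat_lit 20
local notation "nH" => nat_lit 16
local notation "nR" => nat_lit 32
local notation "LB" => List Bool
local notation:max "SqM" a:max => Matrix a a
local notation:max "Sy" n:max => Equiv.Perm (Fin n)
local notation:max "LR" t:max => List.rec (motive := fun _ => t)
section
def TT {ι κ R : Type*} [Fintype ι] [DecidableEq ι] [Fintype κ] [CommSemiring R]
    (σ : Equiv.Perm ι) (M : ι → Matrix κ κ R) : R :=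
  ∑ a : ι → κ, ∏ k, M k (a k) (a (σ k))
theorem coe_finRot_lt {n : ℕ} {i : Fin (n+1)} (h : i.val < n) :
    (finRotate (n+1) i : ℕ) = i + 1 :=
  coe_finRotate_of_ne_last (fun hh => by rw [hh] at h; simp at h)
section TT
variable {ι ι' α β κ R : Type*} [Fintype ι] [DecidableEq ι] [Fintype ι'] [DecidableEq ι']
  [Fintype α] [DecidableEq α] [Fintype β] [DecidableEq β] [Fintype κ] [CommSemiring R]
theorem TT_reindex (σ : Equiv.Perm ι) (σ' : Equiv.Perm ι') (e : ι' ≃ ι)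
    (h : ∀ i, σ (e i) = e (σ' i)) (M : ι → Matrix κ κ R) :
    TT σ M = TT σ' (M ∘ e) := by
  unfold TT
  refine Fintype.sum_equiv (Equiv.arrowCongr e.symm (Equiv.refl κ)) _ _ (fun a => ?_)
  rw [← e.prod_comp]
  simp [h]
theorem TT_sum (σ : Equiv.Perm α) (τ : Equiv.Perm β) (M : α ⊕ β → Matrix κ κ R) :
    TT (Equiv.sumCongr σ τ) M = TT σ (M ∘ Sum.inl) * TT τ (M ∘ Sum.inr) := by
  unfold TT
  rw [Finset.sum_mul_sum, ← Fintype.sum_prod_type']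
  refine Fintype.sum_equiv (Equiv.sumArrowEquivProdArrow α β κ) _ _ (fun a => ?_)
  rw [Fintype.prod_sum_type]
  simp
theorem TT_split (σ : Equiv.Perm ι) (p : ι → Prop) [DecidablePred p] (h : ∀ x, p (σ x) ↔ p x)
    (M : ι → Matrix κ κ R) :
    TT σ M = TT (σ.subtypePerm h) (fun x : {x // p x} => M x.1) *
      TT (σ.subtypePerm (p := fun x => ¬ p x) (fun x => not_congr (h x)))
        (fun x : {x // ¬ p x} => M x.1) := by
  rw [TT_reindex σ (Equiv.sumCongr (σ.subtypePerm h)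
    (σ.subtypePerm (p := fun x => ¬ p x) (fun x => not_congr (h x)))) (Equiv.sumCompl p), TT_sum]
  · rfl
  · rintro (i | i) <;> simp
theorem TT_contract (σ : Equiv.Perm (Option ι)) (σ' : Equiv.Perm ι) (p : ι)
    (h1 : σ (some p) = none) (h2 : σ none = some (σ' p))
    (h3 : ∀ k, k ≠ p → σ (some k) = some (σ' k)) (M : Option ι → Matrix κ κ R) :
    TT σ M = TT σ' (Function.update (M ∘ some) p (M (some p) * M none)) := by
  unfold TT
  rw [← (Equiv.piOptionEquivProd (β := fun _ => κ)).symm.sum_comp, Fintype.sum_prod_type_right]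
  refine Finset.sum_congr rfl (fun a _ => ?_)
  have e1 : ∀ (f : Option ι → R), ∏ k, f k = f none * (f (some p) * ∏ k ∈ Finset.univ.erase p, f (some k)) := by
    intro f
    rw [Fintype.prod_option, Finset.mul_prod_erase _ (fun k => f (some k)) (Finset.mem_univ p)]
  simp_rw [e1]
  rw [← Finset.mul_prod_erase _ _ (Finset.mem_univ p)]
  simp only [Function.update_self, Matrix.mul_apply, Finset.sum_mul]
  refine Finset.sum_congr rfl (fun x _ => ?_)
  rw [h1, h2]
  rw [← mul_assoc]
  congr 1
  · simp [Equiv.piOptionEquivProd, mul_comm]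
  · refine Finset.prod_congr rfl (fun k hk => ?_)
    have := Finset.ne_of_mem_erase hk
    rw [h3 k this, Function.update_of_ne this]
    simp [Equiv.piOptionEquivProd]
theorem TT_rot (d : ℕ) (M : Fin (d+1) → Matrix κ κ R) [DecidableEq κ]:
    TT (finRotate (d+1)) M = trace (List.ofFn M).prod := by
  induction d with
  | zero =>
    unfold TT
    rw [← (Equiv.funUnique (Fin 1) κ).symm.sum_comp]
    simp [trace]
  | succ d ih =>
    rw [TT_reindex (finRotate (d+2)) ((Equiv.permCongr (finSuccEquivLast)) (finRotate (d+2))) finSuccEquivLast.symm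
      (by intro i; simp)]
    rw [TT_contract _ (finRotate (d+1)) (Fin.last d), ih]
    · congr 1
      conv_rhs => rw [List.ofFn_succ_last, List.ofFn_succ_last]
      conv_lhs => rw [List.ofFn_succ_last]
      simp only [List.prod_append, List.prod_cons, List.prod_nil, mul_one, mul_assoc]
      congr 1
      · congr 2
        ext i : 1
        simp [Function.update_of_ne (Fin.castSucc_lt_last i).ne]
      · simp
    · simp only [Equiv.permCongr_apply, finSuccEquivLast_symm_some]
      rw [show finRotate (d+2) (Fin.last d).castSucc = Fin.last (d+1) from ?_]
      · simp
      · ext; rw [coe_finRot_lt] <;> simp [Fin.lt_def]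
    · simp [Equiv.permCongr_apply]
      exact finSuccEquivLast_castSucc (0 : Fin (d+1))
    · intro k hk
      have hk' : k.val < d := by
        have := Fin.val_lt_last hk
        simpa using this
      simp only [Equiv.permCongr_apply, finSuccEquivLast_symm_some]
      rw [show finRotate (d+2) k.castSucc = (finRotate (d+1) k).castSucc from ?_]
      · simp
      · ext
        rw [coe_finRot_lt, Fin.val_castSucc, Fin.val_castSucc, coe_finRot_lt]
        · exact hk'
        · simp only [Fin.val_castSucc]; omega
end TT
section Full
variable {ι : Type*} [Fintype ι] [DecidableEq ι] 
def FullC (d : ℕ) (σ : Equiv.Perm ι) : Prop :=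
  ∃ e : Fin d ≃ ι, ∀ i, σ (e i) = e (finRotate d i)
theorem full_or_split (d : ℕ) (hd : Fintype.card ι = d + 1) (σ : Equiv.Perm ι) :
    FullC (d+1) σ ∨ ∃ p : ι → Prop, (∀ x, p (σ x) ↔ p x) ∧ (∃ x, p x) ∧ ∃ x, ¬ p x := by
  classical
  haveI : Nonempty ι := Fintype.card_pos_iff.mp (by omega)
  obtain ⟨x0⟩ := this
  by_cases H : ∀ y, σ.SameCycle x0 y
  · left
    have hc : σ.IsCycleOn (Finset.univ : Finset ι) := by
      refine ⟨by simpa using σ.bijective.bijOn_univ, ?_⟩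
      intro x _ y _
      exact (H x).symm.trans (H y)
    have hs : Function.Surjective (fun i : Fin (d+1) => (σ ^ (i : ℕ)) x0) := by
      intro y
      obtain ⟨n, hn, h⟩ := hc.exists_pow_eq (Finset.mem_univ x0) (Finset.mem_univ y)
      rw [Finset.card_univ, hd] at hn
      exact ⟨⟨n, hn⟩, h⟩
    have hb := (Fintype.bijective_iff_surjective_and_card (fun i : Fin (d+1) => (σ ^ (i : ℕ)) x0)).2 ⟨hs, by simp [hd]⟩
    refine ⟨Equiv.ofBijective _ hb, fun i => ?_⟩
    simp only [Equiv.ofBijective_apply]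
    rw [← Equiv.Perm.mul_apply, ← pow_succ']
    rcases (Nat.lt_succ_iff_lt_or_eq.mp i.2) with h | h
    · rw [coe_finRot_lt h]
    · have : i = Fin.last d := by ext; simpa using h
      subst this
      have := hc.pow_card_apply (Finset.mem_univ x0)
      rw [Finset.card_univ, hd] at this
      simpa using this
  · right
    push Not at H
    exact ⟨σ.SameCycle x0, fun x => Equiv.Perm.sameCycle_apply_right, ⟨x0, .refl _ _⟩, H⟩
end Full
end
section
section FullSum
variable {A : Type*} [AddCommGroup A]
def zc (d : ℕ) : ℕ := by
  classical exact Fintype.card {h : Sy (d+1) // h * finRotate (d+1) * h⁻¹ = finRotate (d+1)}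
theorem zc_ne (d : ℕ) : zc d ≠ 0 := by
  classical
  unfold zc
  exact (Fintype.card_pos_iff.mpr ⟨⟨1, by simp⟩⟩).ne'
theorem full_sum (d : ℕ) (F G : Sy (d+1) → A)
    (hF : ∀ ρ, ¬ FullC (d+1) ρ → F ρ = 0)
    (hFG : ∀ e, F (e * finRotate (d+1) * e⁻¹) = G e) :
    zc d • ∑ ρ, F ρ = ∑ e, G e := by
  classical
  simp_rw [← hFG]
  rw [← Finset.sum_fiberwise (s := Finset.univ) (g := fun e : Sy (d+1) => e * finRotate (d+1) * e⁻¹)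
    (f := fun e => F (e * finRotate (d+1) * e⁻¹))]
  rw [Finset.smul_sum]
  refine Finset.sum_congr rfl (fun ρ _ => ?_)
  by_cases h : FullC (d+1) ρ
  · obtain ⟨e0, h0⟩ := h
    have h0' : ρ = e0 * finRotate (d+1) * e0⁻¹ := by
      rw [eq_mul_inv_iff_mul_eq]; ext i; simp [h0]
    have : ∀ e ∈ Finset.univ.filter (fun e : Sy (d+1) => e * finRotate (d+1) * e⁻¹ = ρ), F (e * finRotate (d+1) * e⁻¹) = F ρ := by
      intro e he
      rw [(Finset.mem_filter.mp he).2]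
    rw [Finset.sum_congr rfl this, Finset.sum_const]
    congr 1
    unfold zc
    rw [Fintype.card_subtype]
    refine Finset.card_bij (fun h _ => e0 * h) ?_ ?_ ?_
    · intro h hh
      simp only [Finset.mem_filter, Finset.mem_univ, true_and] at hh ⊢
      rw [h0']
      calc e0 * h * finRotate (d+1) * (e0 * h)⁻¹ = e0 * (h * finRotate (d+1) * h⁻¹) * e0⁻¹ := by group
        _ = _ := by rw [hh]
    · intro a _ b _ h
      exact mul_left_cancel h
    · intro b hb
      simp only [Finset.mem_filter, Finset.mem_univ, true_and] at hb
      refine ⟨e0⁻¹ * b, ?_, by simp⟩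
      simp only [Finset.mem_filter, Finset.mem_univ, true_and]
      rw [h0'] at hb
      calc e0⁻¹ * b * finRotate (d+1) * (e0⁻¹ * b)⁻¹ = e0⁻¹ * (b * finRotate (d+1) * b⁻¹) * e0 := by group
        _ = _ := by rw [hb]; group
  · rw [hF ρ h, smul_zero]
    symm
    apply Finset.sum_eq_zero
    intro e he
    rw [(Finset.mem_filter.mp he).2, hF ρ h]
theorem TT_conj {κ R : Type*} [Fintype κ] [DecidableEq κ] [CommSemiring R] (d : ℕ)
    (e : Sy (d+1)) (M : Fin (d+1) → Matrix κ κ R) :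
    TT (e * finRotate (d+1) * e⁻¹) M = trace (List.ofFn (M ∘ e)).prod := by
  rw [TT_reindex _ (finRotate (d+1)) e (by intro i; simp), TT_rot]
end FullSum
theorem fund_trace {R : Type*} [CommRing R] {n m : ℕ} (h : n < m) (M : Fin m → SqM (Fin n) R) :
    ∑ ρ : Sy m, Equiv.Perm.sign ρ • TT ρ M = 0 := by
  unfold TT
  simp_rw [Finset.smul_sum]
  rw [Finset.sum_comm]
  apply Finset.sum_eq_zero
  intro a _
  obtain ⟨i, j, hij, hh⟩ := Fintype.exists_ne_map_eq_of_card_lt a (by simpa using h)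
  have := Matrix.det_zero_of_column_eq (M := Matrix.of fun k l => M k (a k) (a l)) hij (by simp [hh])
  rw [← Matrix.det_transpose, Matrix.det_apply] at this
  simpa using this
section Alg
variable (K : Type*) [Field K] (n : ℕ)
def gen (b : Bool) : SqM (Fin n) (MvPolynomial (MatVar n) K) :=
  Matrix.of fun i j => X (if b then Sum.inr (i, j) else Sum.inl (i, j))
def wm (w : LB) : SqM (Fin n) (MvPolynomial (MatVar n) K) := (w.map (gen K n)).prod
def trw (w : LB) : MvPolynomial (MatVar n) K := trace (wm K n w)
theorem wm_append (u v : LB) : wm K n (u ++ v) = wm K n u * wm K n v := by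
  simp [wm]
theorem wm_flatten (l : List LB) : wm K n l.flatten = (l.map (wm K n)).prod := by
  induction l with
  | nil => simp [wm]
  | cons a l ih => simp [wm_append, ih]
theorem trw_cyc (u v : LB) : trw K n (u ++ v) = trw K n (v ++ u) := by
  rw [trw, trw, wm_append, wm_append, Matrix.trace_mul_comm]
theorem trw_mem (w : LB) : trw K n w ∈ pureAlg K n := by
  intro a A B
  have key : ∀ P Q : SqM (Fin n) K, eval (pairSub P Q) (trw K n w) =
      trace (w.map (fun b => if b then Q else P)).prod := by
    intro P Q
    unfold trw wm
    have h1 : ∀ N : SqM (Fin n) (MvPolynomial (MatVar n) K), eval (pairSub P Q) (trace N) =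
      trace ((eval (pairSub P Q)).mapMatrix N) := by
      intro N; simp [trace]
    rw [h1, map_list_prod, List.map_map]
    congr 3
    funext b
    ext i j
    cases b <;> simp [gen, pairSub]
  rw [key, key]
  clear key
  have : (w.map (fun b => if b then (a : SqM (Fin n) K) * B * ((a⁻¹ : GL (Fin n) K) : SqM (Fin n) K)
     else (a : SqM (Fin n) K) * A * ((a⁻¹ : GL (Fin n) K) : SqM (Fin n) K))).prod =
      (a : SqM (Fin n) K) * (w.map (fun b => if b then B else A)).prod * ((a⁻¹ : GL (Fin n) K) : SqM (Fin n) K) := by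
    induction w with
    | nil => simp [← Units.val_mul]
    | cons b w ih =>
      rw [List.map_cons, List.prod_cons, ih, List.map_cons, List.prod_cons]
      have h2 : ((a⁻¹ : GL (Fin n) K) : SqM (Fin n) K) * (a : SqM (Fin n) K) = 1 := by
        rw [← Units.val_mul]; simp
      cases b <;> simp only [if_true, Bool.false_eq_true, if_false, mul_assoc] <;>
        rw [← mul_assoc ((a⁻¹ : GL (Fin n) K) : SqM (Fin n) K) (a : SqM (Fin n) K), h2, one_mul]
  rw [this, Matrix.trace_mul_comm, ← mul_assoc, ← Units.val_mul]
  simp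
theorem trw_const (w : LB) (hw : w ≠ []) : constantCoeff (trw K n w) = 0 := by
  cases w with
  | nil => exact absurd rfl hw
  | cons b w =>
    unfold trw wm
    simp only [List.map_cons, List.prod_cons, trace, diag_apply, Matrix.mul_apply, map_sum, map_mul]
    apply Finset.sum_eq_zero
    intro i _
    apply Finset.sum_eq_zero
    intro j _
    simp [gen]
variable {K n} in
theorem TT_wm_mem (S : Subalgebra K (MvPolynomial (MatVar n) K)) (hS : ∀ w, trw K n w ∈ S) :
    ∀ (m : ℕ) (ι : Type) [Fintype ι] [DecidableEq ι], Fintype.card ι = m →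
      ∀ (σ : Equiv.Perm ι) (w : ι → LB), TT σ (fun k => wm K n (w k)) ∈ S := by
  intro m
  induction m using Nat.strong_induction_on with
  | _ m ih =>
    intro ι _ _ hm σ w
    classical
    rcases m with _ | m
    · have : IsEmpty ι := Fintype.card_eq_zero_iff.mp hm
      unfold TT
      simp only [Finset.univ_eq_empty, Finset.prod_empty]
      exact sum_mem (fun _ _ => one_mem _)
    · rcases full_or_split m hm σ with ⟨e, he⟩ | ⟨p, hp, ⟨x, hx⟩, ⟨y, hy⟩⟩
      · rw [TT_reindex σ (finRotate (m+1)) e he, TT_rot]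
        have : (List.ofFn ((fun k => wm K n (w k)) ∘ e)).prod = wm K n (List.ofFn (w ∘ e)).flatten := by
          rw [wm_flatten, List.map_ofFn]; rfl
        rw [this]
        exact hS _
      · rw [TT_split σ p hp]
        apply S.mul_mem
        · exact ih (Fintype.card {x // p x}) (by rw [← hm]; exact Fintype.card_subtype_lt hy) _ rfl _ _
        · exact ih (Fintype.card {x // ¬ p x}) (by rw [← hm]; exact Fintype.card_subtype_lt (x := x) (by simpa using hx)) _ rfl _ _
theorem TT_wm_const {ι : Type*} [Fintype ι] [DecidableEq ι] (σ : Equiv.Perm ι) (w : ι → LB) (i : ι) (hw : w i ≠ []) :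
    constantCoeff (TT σ (fun k => wm K n (w k))) = 0 := by
  unfold TT
  rw [map_sum]
  apply Finset.sum_eq_zero
  intro a _
  rw [map_prod]
  apply Finset.prod_eq_zero (Finset.mem_univ i)
  cases hwi : w i with
  | nil => exact absurd hwi hw
  | cons b w =>
    unfold wm
    simp only [hwi, List.map_cons, List.prod_cons, Matrix.mul_apply, map_sum, map_mul]
    apply Finset.sum_eq_zero
    intro j _
    simp [gen]
def Dec : Submodule K (MvPolynomial (MatVar n) K) :=
  Submodule.span K {1} ⊔ Submodule.span K {h | ∃ f ∈ pureAlg K n, ∃ g ∈ pureAlg K n,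
    constantCoeff f = 0 ∧ constantCoeff g = 0 ∧ h = f * g}
theorem TT_wm_dec (d : ℕ) (σ : Sy (d+1)) (w : Fin (d+1) → LB) (hw : ∀ i, w i ≠ [])
    (hσ : ¬ FullC (d+1) σ) : TT σ (fun k => wm K n (w k)) ∈ Dec K n := by
  classical
  rcases full_or_split d (by simp) σ with h | ⟨p, hp, ⟨x, hx⟩, ⟨y, hy⟩⟩
  · exact absurd h hσ
  · rw [TT_split σ p hp]
    apply Submodule.mem_sup_right
    apply Submodule.subset_span
    refine ⟨_, ?_, _, ?_, ?_, ?_, rfl⟩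
    · exact TT_wm_mem _ (trw_mem K n) _ {x // p x} rfl (σ.subtypePerm hp) (fun x => w x.1)
    · exact TT_wm_mem _ (trw_mem K n) _ {x // ¬ p x} rfl _ (fun x => w x.1)
    · exact TT_wm_const K n (ι := {x // p x}) _ (fun x => w x.1) ⟨x, hx⟩ (hw _)
    · exact TT_wm_const K n (ι := {x // ¬ p x}) _ (fun x => w x.1) ⟨y, hy⟩ (hw _)
abbrev EE := MvPolynomial (MatVar n) K ⧸ Dec K n
def ee (w : LB) : EE K n := (Dec K n).mkQ (trw K n w)
theorem ee_cyc (u v : LB) : ee K n (u ++ v) = ee K n (v ++ u) := by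
  unfold ee; rw [trw_cyc]
theorem ee_rel [CharZero K] (d : ℕ) (hd : n < d + 1) (a : Fin (d+1) → LB) (ha : ∀ i, a i ≠ []) :
    ∑ e : Sy (d+1), ee K n (List.ofFn (a ∘ e)).flatten = 0 := by
  have h := full_sum d (A := EE K n) (fun ρ => Equiv.Perm.sign ρ • (Dec K n).mkQ (TT ρ (fun k => wm K n (a k))))
    (fun e => Equiv.Perm.sign (finRotate (d+1)) • ee K n (List.ofFn (a ∘ e)).flatten) ?_ ?_
  · rw [← Finset.smul_sum] at h
    have h2 := congrArg (Dec K n).mkQ (fund_trace hd (fun k => wm K n (a k)))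
    rw [map_sum, map_zero] at h2
    have h3 : ∑ ρ : Sy (d+1), Equiv.Perm.sign ρ • (Dec K n).mkQ (TT ρ (fun k => wm K n (a k))) = 0 := by
      rw [← h2]
      refine Finset.sum_congr rfl (fun ρ _ => ?_)
      rcases Int.units_eq_one_or (Equiv.Perm.sign ρ) with h | h <;> rw [h] <;> simp
    rw [h3, smul_zero] at h
    have h4 := congrArg (fun x => Equiv.Perm.sign (finRotate (d+1)) • x) h
    simp only [smul_zero, smul_smul] at h4
    rcases Int.units_eq_one_or (Equiv.Perm.sign (finRotate (d+1))) with h | h <;> rw [h] at h4 <;> simpa using h4.symm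
  · intro ρ hρ
    have := TT_wm_dec K n d ρ a ha hρ
    rw [← Submodule.Quotient.mk_eq_zero] at this
    simp only [Submodule.mkQ_apply, this, smul_zero]
  · intro e
    have : Equiv.Perm.sign (e * finRotate (d+1) * e⁻¹) = Equiv.Perm.sign (finRotate (d+1)) := by
      simp only [map_mul, map_inv]
      rw [mul_comm, ← mul_assoc]; simp
    rw [this, TT_conj]
    unfold ee trw
    rw [wm_flatten, List.map_ofFn]
    rfl
end Alg
end
section
section LemmaP
variable {K V W : Type*} [Field K] [Fintype V] [DecidableEq V] {d : ℕ}
def mon (ψ : V → W) (w : Fin d → V) : W →₀ ℕ := ∑ k, Finsupp.single (ψ (w k)) 1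
theorem mon_perm (ψ : V → W) (w : Fin d → V) (h : Sy d) : mon ψ (w ∘ h) = mon ψ w := by
  unfold mon
  exact Fintype.sum_equiv h _ _ (fun _ => rfl)
theorem mon_eq (ψ : V → W) (hψ : Function.Injective ψ) (w w' : Fin d → V) (h : mon ψ w = mon ψ w') :
    ∃ h : Sy d, w' = w ∘ h := by
  classical
  have key : ∀ (u : Fin d → V) (v : V), mon ψ u (ψ v) = Fintype.card {k // u k = v} := by
    intro u v
    unfold mon
    rw [Finsupp.finsetSum_apply, Fintype.card_subtype, Finset.card_filter]
    refine Finset.sum_congr rfl (fun k _ => ?_)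
    rw [Finsupp.single_apply]
    simp [hψ.eq_iff]
  have e : ∀ v, {k // w' k = v} ≃ {k // w k = v} := fun v =>
    Fintype.equivOfCardEq (by rw [← key, ← key, h])
  exact ⟨Equiv.ofFiberEquiv e, by ext k; exact (Equiv.ofFiberEquiv_map e k).symm⟩
theorem prod_X_mon (ψ : V → W) (w : Fin d → V) :
    ∏ k, (X (ψ (w k)) : MvPolynomial W K) = monomial (mon ψ w) 1 := by
  unfold mon
  rw [monomial_sum_one]
  rfl
theorem lemmaP (ψ : V → W) (hψ : Function.Injective ψ) (s m : (Fin d → V) → K)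
    (h0 : ∑ w, C (s w) * ∏ k, (X (ψ (w k)) : MvPolynomial W K) = 0)
    (hm : ∀ (w : Fin d → V) (h : Sy d), m (w ∘ h) = m w) :
    ∑ w, s w * m w = 0 := by
  classical
  rw [← Finset.sum_fiberwise_of_maps_to (t := Finset.univ.image (mon ψ)) (g := mon ψ)
    (fun w _ => Finset.mem_image_of_mem _ (Finset.mem_univ w))]
  apply Finset.sum_eq_zero
  intro μ hμ
  obtain ⟨w0, _, rfl⟩ := Finset.mem_image.mp hμ
  have h1 := congrArg (coeff (mon ψ w0)) h0
  rw [coeff_sum] at h1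
  have h2 : ∑ w with mon ψ w = mon ψ w0, s w = 0 := by
    rw [Finset.sum_filter]
    rw [coeff_zero] at h1
    refine Eq.trans ?_ h1
    refine Finset.sum_congr rfl (fun w _ => ?_)
    rw [prod_X_mon, coeff_C_mul, coeff_monomial]
    simp
  have h3 : ∀ w ∈ Finset.univ.filter (fun w => mon ψ w = mon ψ w0), s w * m w = s w * m w0 := by
    intro w hw
    obtain ⟨h, rfl⟩ := mon_eq ψ hψ w0 w (Finset.mem_filter.mp hw).2.symm
    rw [hm]
  rw [Finset.sum_congr rfl h3, ← Finset.sum_mul, h2, zero_mul]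
theorem lemmaP_symm [CharZero K] (ψ : V → W) (hψ : Function.Injective ψ) (s : (Fin d → V) → K)
    (h0 : ∑ w, C (s w) * ∏ k, (X (ψ (w k)) : MvPolynomial W K) = 0)
    (hs : ∀ (w : Fin d → V) (h : Sy d), s (w ∘ h) = s w) (w : Fin d → V) : s w = 0 := by
  classical
  have := lemmaP ψ hψ s (fun w' => if mon ψ w' = mon ψ w then 1 else 0) h0 (by
    intro w' h; rw [mon_perm])
  simp only [mul_ite, mul_one, mul_zero] at this
  rw [← Finset.sum_filter] at this
  have h3 : ∀ w' ∈ Finset.univ.filter (fun w' => mon ψ w' = mon ψ w), s w' = s w := by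
    intro w' hw
    obtain ⟨h, rfl⟩ := mon_eq ψ hψ w w' (Finset.mem_filter.mp hw).2.symm
    rw [hs]
  rw [Finset.sum_congr rfl h3, Finset.sum_const, nsmul_eq_mul, mul_eq_zero] at this
  refine this.resolve_left ?_
  exact Nat.cast_ne_zero.2 (Finset.card_ne_zero.2 ⟨w, by simp⟩)
theorem exists_tensor [CharZero K] (ψ : V → W) (hψ : Function.Bijective ψ) (f : MvPolynomial W K)
    (hf : f.IsHomogeneous d) : ∃ t : (Fin d → V) → K,
      (∀ (w : Fin d → V) (h : Sy d), t (w ∘ h) = t w) ∧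
      f = ∑ w, C (t w) * ∏ k, (X (ψ (w k)) : MvPolynomial W K) := by
  classical
  refine ⟨fun v => coeff (mon ψ v) f / ((Finset.univ.filter (fun v' : Fin d → V => mon ψ v' = mon ψ v)).card : K), ?_, ?_⟩
  · intro w h
    simp only [mon_perm]
  · ext μ
    rw [coeff_sum]
    simp only [prod_X_mon, coeff_C_mul, coeff_monomial, mul_ite, mul_one, mul_zero]
    rw [← Finset.sum_filter]
    have h3 : ∀ w' ∈ Finset.univ.filter (fun w' : Fin d → V => mon ψ w' = μ), coeff (mon ψ w') f / ((Finset.univ.filter (fun v' : Fin d → V => mon ψ v' = mon ψ w')).card : K) = coeff μ f / ((Finset.univ.filter (fun v' : Fin d → V => mon ψ v' = μ)).card : K) := by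
      intro w' hw
      rw [(Finset.mem_filter.mp hw).2]
    rw [Finset.sum_congr rfl h3, Finset.sum_const, nsmul_eq_mul]
    by_cases hc : (Finset.univ.filter (fun v' : Fin d → V => mon ψ v' = μ)).card = 0
    · rw [hc]
      simp only [Nat.cast_zero, zero_mul]
      by_contra hne
      have hdeg := hf hne
      obtain ⟨l, hl⟩ := Quot.exists_rep (Finsupp.toMultiset μ)
      have hlen : l.length = d := by
        have h1 : (Finsupp.toMultiset μ).card = l.length := by rw [← hl]; rfl
        rw [Finsupp.card_toMultiset] at h1
        rw [← h1, ← hdeg, Finsupp.weight_apply]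
        simp [Finsupp.sum]
      subst hlen
      choose g hg using hψ.2
      rw [Finset.card_eq_zero] at hc
      have : (fun k => g (l.get k)) ∈ Finset.univ.filter (fun v' : Fin l.length → V => mon ψ v' = μ) := by
        simp only [Finset.mem_filter, Finset.mem_univ, true_and]
        apply (Function.LeftInverse.injective (g := Multiset.toFinsupp) Finsupp.toMultiset_toFinsupp)
        unfold mon
        simp only [hg, map_sum, Finsupp.toMultiset_single, one_smul]
        rw [← hl, ← List.sum_ofFn]
        have : (List.ofFn fun i => ({l.get i} : Multiset W)) = l.map (fun x => {x}) := by
          conv_rhs => rw [← List.ofFn_get l, List.map_ofFn]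
          rfl
        rw [this]
        clear this hl hdeg hf hc h3
        induction l with
        | nil => rfl
        | cons a l ih => rw [List.map_cons, List.sum_cons, ih]; rfl
      rw [hc] at this
      simp at this
    · field_simp
end LemmaP
end
section
section DC
variable {K I : Type*} [Field K] [CharZero K] [Fintype I] [DecidableEq I] {d : ℕ}
def PP (K : Type*) [Field K] {I : Type*} [DecidableEq I] {d : ℕ} (σ : Sy d) :
    SqM (Fin d → I) K :=
  Matrix.of fun a b => if b = a ∘ σ then 1 else 0
theorem PP_mul_apply (σ : Sy d) (x : SqM (Fin d → I) K) (a b) :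
    (PP K σ * x : SqM (Fin d → I) K) a b = x (a ∘ σ) b := by
  simp [PP, Matrix.mul_apply]
theorem PP_one : PP K (1 : Sy d) = (1 : SqM (Fin d → I) K) := by
  ext a b
  simp [PP, Matrix.one_apply, eq_comm]
theorem PP_mul (σ τ : Sy d) : PP K σ * PP K τ = (PP K (σ * τ) : SqM (Fin d → I) K) := by
  ext a b
  rw [PP_mul_apply]
  rfl
theorem double_cent (T : SqM (Fin d → I) K)
    (hT : ∀ m : SqM (Fin d → I) K,
      (∀ (h : Sy d) a b, m (a ∘ h) (b ∘ h) = m a b) → T * m = m * T) :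
    T ∈ Submodule.span K (Set.range (PP K (I := I) (d := d))) := by
  classical
  set S := Submodule.span K (Set.range (PP K (I := I) (d := d))) with hS
  obtain ⟨p0, hp0⟩ := S.subtype.exists_leftInverse_of_injective S.ker_subtype
  have hp0' : ∀ x (hx : x ∈ S), (p0 x : SqM (Fin d → I) K) = x := by
    intro x hx
    have := LinearMap.congr_fun hp0 ⟨x, hx⟩
    simpa using congrArg Subtype.val this
  let π : SqM (Fin d → I) K → SqM (Fin d → I) K := fun x =>
    (Nat.factorial d : K)⁻¹ • ∑ σ : Sy d, PP K σ * (p0 (PP K σ⁻¹ * x) : SqM (Fin d → I) K)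
  have hSmul : ∀ σ x, x ∈ S → PP K σ * x ∈ S := by
    intro σ x hx
    induction hx using Submodule.span_induction with
    | mem x hx =>
      obtain ⟨τ, rfl⟩ := hx
      rw [PP_mul]
      exact Submodule.subset_span ⟨_, rfl⟩
    | zero => simp
    | add x y _ _ hx hy => rw [mul_add]; exact S.add_mem hx hy
    | smul c x _ hx => rw [mul_smul_comm]; exact S.smul_mem _ hx
  have hπS : ∀ x, π x ∈ S := fun x =>
    S.smul_mem _ (S.sum_mem (fun σ _ => hSmul _ _ (p0 _).2))
  have hπlin : ∀ x y, π (x + y) = π x + π y := by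
    intro x y
    simp only [π, mul_add, map_add, Submodule.coe_add, Finset.sum_add_distrib, smul_add]
  have hπsmul : ∀ (c : K) x, π (c • x) = c • π x := by
    intro c x
    simp only [π, mul_smul_comm, map_smul, Submodule.coe_smul, ← Finset.smul_sum]
    rw [smul_comm]
  let πL : SqM (Fin d → I) K →ₗ[K] SqM (Fin d → I) K :=
    ⟨⟨π, hπlin⟩, hπsmul⟩
  have hπP : ∀ τ x, π (PP K τ * x) = PP K τ * π x := by
    intro τ x
    simp only [π]
    rw [mul_smul_comm, Finset.mul_sum]
    congr 1
    refine Fintype.sum_equiv (Equiv.mulLeft τ⁻¹) _ _ (fun σ => ?_)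
    simp only [Equiv.coe_mulLeft]
    rw [← mul_assoc, ← mul_assoc, PP_mul, PP_mul]
    congr 4 <;> group
  have hπ1 : π 1 = 1 := by
    have : ∀ σ : Sy d, PP K σ * (p0 (PP K σ⁻¹ * 1) : SqM (Fin d → I) K) = 1 := by
      intro σ
      rw [mul_one, hp0' _ (Submodule.subset_span ⟨_, rfl⟩), PP_mul, mul_inv_cancel, PP_one]
    simp only [π]
    rw [Finset.sum_congr rfl (fun σ _ => this σ), Finset.sum_const, Finset.card_univ, Fintype.card_perm, Fintype.card_fin,
      ← Nat.cast_smul_eq_nsmul K, smul_smul, inv_mul_cancel₀ (Nat.cast_ne_zero.2 (Nat.factorial_ne_zero d)), one_smul]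
  have hπT : ∀ x : SqM (Fin d → I) K, ∀ a b, π x a b = ∑ a', ∑ b', x a' b' * π (Matrix.single a' b' 1) a b := by
    intro x a b
    conv_lhs => rw [matrix_eq_sum_single x]
    change πL _ a b = _
    simp only [map_sum, Matrix.sum_apply]
    refine Finset.sum_congr rfl fun a' _ => Finset.sum_congr rfl fun b' _ => ?_
    have : Matrix.single a' b' (x a' b') = (x a' b') • (Matrix.single a' b' 1 : SqM (Fin d → I) K) := by
      simp
    rw [this, map_smul]
    rfl
  have key : π T = T := by
    ext a b
    let m : (Fin d → I) → SqM (Fin d → I) K := fun b' => Matrix.of fun a a' => π (Matrix.single a' b' 1) a b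
    have hm : ∀ b', T * m b' = m b' * T := by
      intro b'
      apply hT
      intro h a a'
      simp only [m, Matrix.of_apply]
      rw [← PP_mul_apply h (π _), ← hπP]
      congr 2
      ext x y
      rw [PP_mul_apply]
      simp only [Matrix.single_apply]
      congr 1
      rw [h.surjective.injective_comp_right.eq_iff]
    rw [hπT]
    have h1 : ∀ b', ∑ a', T a' b' * π (Matrix.single a' b' 1) a b = ∑ c, T a c * π (Matrix.single b' b' 1) c b := by
      intro b'
      have := congrFun (congrFun (hm b') a) b'
      simp only [Matrix.mul_apply, m, Matrix.of_apply] at this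
      rw [this]
      exact Finset.sum_congr rfl (fun _ _ => mul_comm _ _)
    rw [Finset.sum_comm, Finset.sum_congr rfl (fun b' _ => h1 b'), Finset.sum_comm]
    simp_rw [← Finset.mul_sum]
    have h2 : ∀ c, ∑ b', π (Matrix.single b' b' 1) c b = (1 : SqM (Fin d → I) K) c b := by
      intro c
      rw [← hπ1, hπT 1 c b]
      refine Finset.sum_congr rfl fun b' _ => ?_
      simp [Matrix.one_apply]
    simp_rw [h2]
    simp [Matrix.one_apply]
  rw [← key]
  exact hπS T
end DC
end
section
section GG
variable {K : Type*} [Field K] {n d : ℕ}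
def GG (d : ℕ) (g : SqM (Fin n) K) : SqM (Fin d → Fin n) K :=
  Matrix.of fun a b => ∏ k, g (a k) (b k)
theorem GG_mul (g h : SqM (Fin n) K) : GG d g * GG d h = GG d (g * h) := by
  ext a b
  simp only [GG, Matrix.mul_apply, Matrix.of_apply, Finset.prod_univ_sum, Fintype.piFinset_univ, Finset.prod_mul_distrib]
theorem GG_one : GG d (1 : SqM (Fin n) K) = 1 := by
  ext a b
  simp only [GG, Matrix.of_apply, Matrix.one_apply]
  by_cases h : a = b
  · simp [h]
  · rw [if_neg h]
    obtain ⟨k, hk⟩ := Function.ne_iff.mp h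
    exact Finset.prod_eq_zero (Finset.mem_univ k) (by simp [hk])
theorem GG_transpose (g : SqM (Fin n) K) : (GG d g)ᵀ = GG d gᵀ := rfl
variable [CharZero K]
theorem GG_comm (T : SqM (Fin d → Fin n) K)
    (hT : ∀ A : SqM (Fin n) K, A.det ≠ 0 → T * GG d A = GG d A * T)
    (m : SqM (Fin d → Fin n) K)
    (hm : ∀ (h : Sy d) a b, m (a ∘ h) (b ∘ h) = m a b) : T * m = m * T := by
  ext a b
  let s : (Fin d → Fin n × Fin n) → K := fun w =>
    (if Prod.snd ∘ w = b then T a (Prod.fst ∘ w) else 0) - (if Prod.fst ∘ w = a then T (Prod.snd ∘ w) b else 0)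
  have hs : ∀ f : SqM (Fin d → Fin n) K,
      ∑ w, s w * f (Prod.fst ∘ w) (Prod.snd ∘ w) = (T * f) a b - (f * T) a b := by
    intro f
    rw [← (Equiv.arrowProdEquivProdArrow (Fin d) (fun _ => Fin n) (fun _ => Fin n)).symm.sum_comp, Fintype.sum_prod_type]
    have e1 : ∀ x y : Fin d → Fin n, Prod.fst ∘ ((Equiv.arrowProdEquivProdArrow (Fin d) (fun _ => Fin n) (fun _ => Fin n)).symm (x, y)) = x := fun _ _ => rfl
    have e2 : ∀ x y : Fin d → Fin n, Prod.snd ∘ ((Equiv.arrowProdEquivProdArrow (Fin d) (fun _ => Fin n) (fun _ => Fin n)).symm (x, y)) = y := fun _ _ => rfl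
    simp only [s, e1, e2, sub_mul, Finset.sum_sub_distrib, ite_mul, zero_mul, Matrix.mul_apply]
    congr 1
    · simp
    · rw [Finset.sum_comm]
      simp [mul_comm]
  rw [← sub_eq_zero, ← hs m]
  apply lemmaP (W := Fin n × Fin n) id Function.injective_id s (fun w => m (Prod.fst ∘ w) (Prod.snd ∘ w))
  · have hz : (Matrix.det (mvPolynomialX (Fin n) (Fin n) K)) * (∑ w, C (s w) * ∏ k, (X (id (w k)) : MvPolynomial (Fin n × Fin n) K)) = 0 := by
      apply MvPolynomial.funext
      intro x
      rw [map_mul, eval_det_mvPolynomialX, map_zero]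
      by_cases hx : (Matrix.of fun i j => x (i, j)).det = 0
      · rw [hx, zero_mul]
      · convert mul_zero _
        have := hs (GG d (Matrix.of fun i j => x (i, j)))
        rw [hT _ hx, sub_self] at this
        rw [← this]
        simp [GG]
    exact (mul_eq_zero.mp hz).resolve_left (det_mvPolynomialX_ne_zero _ _)
  · intro w h
    exact hm h (Prod.fst ∘ w) (Prod.snd ∘ w)
end GG
section FFT
variable {K : Type*} [Field K] [CharZero K] {n d : ℕ}
def tri (c : Fin d → Bool) (a b : Fin d → Fin n) : Fin d → Bool × (Fin n × Fin n) := fun k => (c k, (a k, b k))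
theorem sum_tri {A : Type*} [AddCommMonoid A] (f : (Fin d → Bool × (Fin n × Fin n)) → A) :
    ∑ v, f v = ∑ c, ∑ a, ∑ b, f (tri c a b) := by
  rw [← (Equiv.arrowProdEquivProdArrow (Fin d) (fun _ => Bool) (fun _ => Fin n × Fin n)).symm.sum_comp, Fintype.sum_prod_type]
  refine Finset.sum_congr rfl fun c _ => ?_
  rw [← (Equiv.arrowProdEquivProdArrow (Fin d) (fun _ => Fin n) (fun _ => Fin n)).symm.sum_comp, Fintype.sum_prod_type]
  rfl
def vI (n : ℕ) : Bool × (Fin n × Fin n) ≃ MatVar n := Equiv.boolProdEquivSum _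
theorem gen_apply (b : Bool) (i j : Fin n) : gen K n b i j = X (vI n (b, (i, j))) := by
  cases b <;> rfl
theorem FFT_hom (f : MvPolynomial (MatVar n) K) (hf : f ∈ pureAlg K n) (hd : f.IsHomogeneous d) :
    f ∈ Submodule.span K (Set.range fun p : Sy d × (Fin d → Bool) =>
      TT p.1 (fun k => gen K n (p.2 k))) := by
  classical
  obtain ⟨t, ht, hft⟩ := exists_tensor (vI n) (vI n).bijective f hd
  have step1 : ∀ (g : GL (Fin n) K) (w : Fin d → Bool × (Fin n × Fin n)),
      ∑ v, t v * ∏ k, (if (v k).1 = (w k).1 then (g : SqM (Fin n) K) (v k).2.1 (w k).2.1 *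
        ((g⁻¹ : GL (Fin n) K) : SqM (Fin n) K) (w k).2.2 (v k).2.2 else 0) = t w := by
    intro g w
    set G : Bool × (Fin n × Fin n) → Bool × (Fin n × Fin n) → K := fun v w => (if v.1 = w.1 then (g : SqM (Fin n) K) v.2.1 w.2.1 *
        ((g⁻¹ : GL (Fin n) K) : SqM (Fin n) K) w.2.2 v.2.2 else 0) with hG
    rw [← sub_eq_zero]
    refine lemmaP_symm (vI n) (vI n).injective (fun w => ∑ v, t v * ∏ k, G (v k) (w k) - t w) ?_ ?_ w
    · apply MvPolynomial.funext
      intro x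
      have hx : x = pairSub (Matrix.of fun i j => x (Sum.inl (i, j))) (Matrix.of fun i j => x (Sum.inr (i, j))) := by
        ext (i | i) <;> rfl
      have hinv := hf g (Matrix.of fun i j => x (Sum.inl (i, j))) (Matrix.of fun i j => x (Sum.inr (i, j)))
      rw [← hx] at hinv
      rw [hft] at hinv
      have hsub : ∀ v, pairSub ((g : SqM (Fin n) K) * (Matrix.of fun i j => x (Sum.inl (i, j))) * ((g⁻¹ : GL (Fin n) K) : SqM (Fin n) K))
          ((g : SqM (Fin n) K) * (Matrix.of fun i j => x (Sum.inr (i, j))) * ((g⁻¹ : GL (Fin n) K) : SqM (Fin n) K)) (vI n v)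
          = ∑ u, G v u * x (vI n u) := by
        rintro ⟨b, i, j⟩
        rw [Fintype.sum_prod_type]
        simp only [Fintype.sum_prod_type, hG, Fintype.sum_bool]
        cases b
        · simp [vI, Equiv.boolProdEquivSum, pairSub, Matrix.mul_apply, Finset.sum_mul]
          rw [Finset.sum_comm]
          refine Finset.sum_congr rfl fun _ _ => Finset.sum_congr rfl fun _ _ => ?_
          ring
        · simp [vI, Equiv.boolProdEquivSum, pairSub, Matrix.mul_apply, Finset.sum_mul]
          rw [Finset.sum_comm]
          refine Finset.sum_congr rfl fun _ _ => Finset.sum_congr rfl fun _ _ => ?_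
          ring
      simp only [map_sum, map_mul, eval_C, map_prod, eval_X, map_zero, hsub] at hinv ⊢
      simp only [Finset.prod_univ_sum, Fintype.piFinset_univ, Finset.prod_mul_distrib] at hinv
      simp only [sub_mul, Finset.sum_sub_distrib]
      rw [← hinv, sub_eq_zero]
      simp only [Finset.sum_mul, Finset.mul_sum]
      rw [Finset.sum_comm]
      refine Finset.sum_congr rfl fun _ _ => Finset.sum_congr rfl fun _ _ => ?_
      ring
    · intro w h
      rw [ht]
      congr 1
      refine Fintype.sum_equiv (Equiv.arrowCongr h (Equiv.refl _)) _ _ (fun v => ?_)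
      have e : (Equiv.arrowCongr h (Equiv.refl (Bool × (Fin n × Fin n)))) v = v ∘ h.symm := rfl
      rw [e, ht]
      congr 1
      exact Fintype.prod_equiv h _ _ (fun k => by simp)
  let T : (Fin d → Bool) → SqM (Fin d → Fin n) K := fun c => Matrix.of fun a b => t (tri c a b)
  have step2 : ∀ c (g : GL (Fin n) K), T c * (GG d (g : SqM (Fin n) K))ᵀ = (GG d (g : SqM (Fin n) K))ᵀ * T c := by
    intro c g
    have h1 : T c = (GG d (g : SqM (Fin n) K))ᵀ * T c * (GG d ((g⁻¹ : GL (Fin n) K) : SqM (Fin n) K))ᵀ := by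
      ext p q
      have := step1 g (tri c p q)
      rw [sum_tri] at this
      change t (tri c p q) = _
      rw [← this, Finset.sum_eq_single c]
      · simp only [tri, if_true, Matrix.mul_apply, Finset.sum_mul, Matrix.transpose_apply, GG, Matrix.of_apply, T]
        rw [Finset.sum_comm]
        refine Finset.sum_congr rfl fun _ _ => Finset.sum_congr rfl fun _ _ => ?_
        rw [Finset.prod_mul_distrib]
        ring
      · intro c' _ hc
        obtain ⟨k, hk⟩ := Function.ne_iff.mp hc
        refine Finset.sum_eq_zero fun a _ => Finset.sum_eq_zero fun b _ => ?_
        rw [Finset.prod_eq_zero (Finset.mem_univ k), mul_zero]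
        simp [tri, hk]
      · simp
    have h2 : (GG d ((g⁻¹ : GL (Fin n) K) : SqM (Fin n) K))ᵀ * (GG d (g : SqM (Fin n) K))ᵀ = 1 := by
      rw [← Matrix.transpose_mul, GG_mul, ← Units.val_mul, mul_inv_cancel, Units.val_one, GG_one, Matrix.transpose_one]
    conv_lhs => rw [h1]
    rw [mul_assoc, h2, mul_one]
  have step3 : ∀ c, T c ∈ Submodule.span K (Set.range (PP K (I := Fin n) (d := d))) := by
    intro c
    apply double_cent
    apply GG_comm
    intro A hA
    have := step2 c (Matrix.GeneralLinearGroup.mkOfDetNeZero Aᵀ (by rwa [Matrix.det_transpose]))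
    rw [GG_transpose] at this
    simpa [Matrix.GeneralLinearGroup.mkOfDetNeZero] using this
  rw [hft, sum_tri]
  refine Submodule.sum_mem _ fun c _ => ?_
  have step4 : ∀ M ∈ Submodule.span K (Set.range (PP K (I := Fin n) (d := d))),
      ∑ a, ∑ b, C (M a b) * ∏ k, (X (vI n (tri c a b k)) : MvPolynomial (MatVar n) K) ∈ Submodule.span K (Set.range fun p : Sy d × (Fin d → Bool) =>
      TT p.1 (fun k => gen K n (p.2 k))) := by
    intro M hM
    induction hM using Submodule.span_induction with
    | mem M hM =>
      obtain ⟨σ, rfl⟩ := hM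
      apply Submodule.subset_span
      refine ⟨(σ, c), ?_⟩
      simp only [TT, gen_apply]
      refine Finset.sum_congr rfl fun a _ => ?_
      rw [Finset.sum_eq_single (a ∘ σ)]
      · simp [PP, tri]
      · intro b _ hb
        simp [PP, hb]
      · simp
    | zero => simp
    | add M N _ _ hM hN =>
      simp only [Matrix.add_apply, C_add, add_mul, Finset.sum_add_distrib]
      exact Submodule.add_mem _ hM hN
    | smul r M _ hM =>
      simp only [Matrix.smul_apply, smul_eq_mul, C_mul, mul_assoc, ← Finset.mul_sum]
      rw [← smul_eq_C_mul]
      exact Submodule.smul_mem _ _ hM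
  exact step4 _ (step3 c)
theorem eval_smul_hom {W : Type*} [Fintype W] {K : Type*} [Field K] (p : MvPolynomial W K) (i : ℕ) (hp : p.IsHomogeneous i) (x : W → K) (s : K) :
    eval (fun j => s * x j) p = s ^ i * eval x p := by
  rw [eval_eq', eval_eq', Finset.mul_sum]
  refine Finset.sum_congr rfl fun d hd => ?_
  have := hp.degree_eq_sum_deg_support hd
  simp only [mul_pow, Finset.prod_mul_distrib, Finset.prod_pow_eq_pow_sum]
  have h2 : ∑ j, d j = i := by
    rw [this]
    symm
    exact Finsupp.sum_fintype d (fun _ e => e) (fun _ => rfl)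
  rw [h2]
  ring
theorem homComp_mem (f : MvPolynomial (MatVar n) K) (hf : f ∈ pureAlg K n) (m : ℕ) :
    homogeneousComponent m f ∈ pureAlg K n := by
  by_cases hm : f.totalDegree < m
  · rw [homogeneousComponent_eq_zero _ _ hm]; exact zero_mem _
  intro g A B
  have key : ∀ (x : MatVar n → K) (s : K), eval (fun i => s * x i) f =
      Polynomial.eval s (∑ i ∈ Finset.range (f.totalDegree + 1), Polynomial.C (eval x (homogeneousComponent i f)) * Polynomial.X ^ i) := by
    intro x s
    conv_lhs => rw [← sum_homogeneousComponent f]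
    rw [map_sum, Polynomial.eval_finsetSum]
    refine Finset.sum_congr rfl fun i _ => ?_
    rw [eval_smul_hom _ i (homogeneousComponent_isHomogeneous i f)]
    rw [Polynomial.eval_mul, Polynomial.eval_C, Polynomial.eval_pow, Polynomial.eval_X, mul_comm]
  set x1 := pairSub ((g : SqM (Fin n) K) * A * ((g⁻¹ : GL (Fin n) K) : SqM (Fin n) K))
          ((g : SqM (Fin n) K) * B * ((g⁻¹ : GL (Fin n) K) : SqM (Fin n) K)) with hx1
  set x2 := pairSub A B with hx2
  have h : (∑ i ∈ Finset.range (f.totalDegree + 1), Polynomial.C (eval x1 (homogeneousComponent i f)) * Polynomial.X ^ i) =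
      (∑ i ∈ Finset.range (f.totalDegree + 1), Polynomial.C (eval x2 (homogeneousComponent i f)) * Polynomial.X ^ i) := by
    apply Polynomial.funext
    intro s
    rw [← key, ← key]
    have h1 := hf g (s • A) (s • B)
    have e1 : pairSub ((g : SqM (Fin n) K) * (s • A) * ((g⁻¹ : GL (Fin n) K) : SqM (Fin n) K))
          ((g : SqM (Fin n) K) * (s • B) * ((g⁻¹ : GL (Fin n) K) : SqM (Fin n) K)) = fun i => s * x1 i := by
      ext (i | i) <;> simp [hx1, pairSub]
    have e2 : pairSub (s • A) (s • B) = fun i => s * x2 i := by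
      ext (i | i) <;> simp [hx2, pairSub]
    rw [e1, e2] at h1
    exact h1
  have h2 := congrArg (fun p => Polynomial.coeff p m) h
  simp only [Polynomial.finsetSum_coeff, Polynomial.coeff_C_mul, Polynomial.coeff_X_pow] at h2
  have hm' : m < f.totalDegree + 1 := by omega
  simpa [hm'] using h2
end FFT
end
section
section SFT
variable {K : Type*} [Field K] {n d : ℕ}
def AntiK (n : ℕ) (Ψ : Sy d → K) : Prop :=
  ∀ (τ : Sy d) (j : Fin (n+1) ↪ Fin d),
    ∑ π : Sy (n+1), ((Equiv.Perm.sign π : ℤ) : K) * Ψ (π.viaFintypeEmbedding j * τ) = 0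
def Ind (K : Type*) [Field K] (a b : Fin d → Fin n) (σ : Sy d) : K := if b = a ∘ σ then 1 else 0
theorem via_mul (π ρ : Sy (n+1)) (j : Fin (n+1) ↪ Fin d) :
    (π * ρ).viaFintypeEmbedding j = π.viaFintypeEmbedding j * ρ.viaFintypeEmbedding j := by
  ext x
  congr 1
  by_cases hx : x ∈ Set.range j
  · obtain ⟨y, rfl⟩ := hx
    simp [Equiv.Perm.viaFintypeEmbedding_apply_image]
  · rw [Equiv.Perm.mul_apply, Equiv.Perm.viaFintypeEmbedding_apply_notMem_range _ _ hx,
      Equiv.Perm.viaFintypeEmbedding_apply_notMem_range _ _ hx, Equiv.Perm.viaFintypeEmbedding_apply_notMem_range _ _ hx]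
theorem via_one (j : Fin (n+1) ↪ Fin d) :
    (1 : Sy (n+1)).viaFintypeEmbedding j = 1 := by
  ext x
  congr 1
  by_cases hx : x ∈ Set.range j
  · obtain ⟨y, rfl⟩ := hx
    simp [Equiv.Perm.viaFintypeEmbedding_apply_image]
  · rw [Equiv.Perm.viaFintypeEmbedding_apply_notMem_range _ _ hx]; rfl
theorem Ind_anti (a b : Fin d → Fin n) : AntiK n (Ind K a b) := by
  intro τ j
  obtain ⟨p, q, hpq, hh⟩ := Fintype.exists_ne_map_eq_of_card_lt (a ∘ j) (by simp)
  have hsw : a ∘ ((Equiv.swap p q).viaFintypeEmbedding j) = a := by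
    ext x
    congr 1
    by_cases hx : x ∈ Set.range j
    · obtain ⟨y, rfl⟩ := hx
      simp only [Function.comp, Equiv.Perm.viaFintypeEmbedding_apply_image] at hh ⊢
      rcases eq_or_ne y p with rfl | h1
      · simp [hh]
      · rcases eq_or_ne y q with rfl | h2
        · simp [hh]
        · rw [Equiv.swap_apply_of_ne_of_ne h1 h2]
    · simp [Equiv.Perm.viaFintypeEmbedding_apply_notMem_range _ _ hx]
  refine Finset.sum_involution (fun π _ => Equiv.swap p q * π) ?_ ?_ ?_ ?_
  · intro π _
    have : Ind K a b ((Equiv.swap p q * π).viaFintypeEmbedding j * τ) = Ind K a b (π.viaFintypeEmbedding j * τ) := by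
      unfold Ind
      rw [via_mul, mul_assoc, Equiv.Perm.coe_mul, ← Function.comp_assoc, hsw]
    rw [this, Equiv.Perm.sign_mul, Equiv.Perm.sign_swap hpq]
    simp
  · intro π _ _ h
    apply hpq
    have h2 : Equiv.swap p q = 1 := by simpa using h
    exact Equiv.swap_eq_one_iff.mp h2
  · simp
  · intro π _
    simp
def Chain (σ : Sy d) (m : ℕ) (k : Fin d) : Prop :=
  ∃ s : Fin (m+1) → Fin d, StrictMono s ∧ StrictAnti (σ ∘ s) ∧ s (Fin.last m) = k
theorem Chain_zero (σ : Sy d) (k : Fin d) : Chain σ 0 k := by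
  refine ⟨fun _ => k, ?_, ?_, rfl⟩
  · intro x y h
    have := x.2; have := y.2
    have h' : x.val < y.val := h
    omega
  · intro x y h
    have := x.2; have := y.2
    have h' : x.val < y.val := h
    omega
theorem Chain_succ (σ : Sy d) (m : ℕ) (k k' : Fin d) (h : Chain σ m k) (hk : k < k') (hs : σ k' < σ k) :
    Chain σ (m+1) k' := by
  obtain ⟨s, h1, h2, rfl⟩ := h
  refine ⟨Fin.snoc (α := fun _ => Fin d) s k', ?_, ?_, by simp⟩
  · rw [Fin.strictMono_iff_lt_succ]
    intro i
    refine Fin.lastCases ?_ (fun i => ?_) i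
    · simpa using hk
    · rw [Fin.succ_castSucc]
      simp only [Fin.snoc_castSucc]
      exact h1 (Fin.castSucc_lt_succ)
  · rw [Fin.strictAnti_iff_succ_lt]
    intro i
    refine Fin.lastCases ?_ (fun i => ?_) i
    · simpa using hs
    · rw [Fin.succ_castSucc]
      simp only [Function.comp, Fin.snoc_castSucc]
      exact h2 (Fin.castSucc_lt_succ)
def lx (σ : Sy d) : Lex (Fin d → Fin d) := toLex (σ : Fin d → Fin d)
theorem lx_inj : Function.Injective (lx (d := d)) := by
  intro σ τ h
  exact DFunLike.coe_injective (toLex.injective h)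
theorem bad_zero (Ψ : Sy d → K) (hΨ : AntiK n Ψ) (σ : Sy d) (k : Fin d)
    (hk : Chain σ n k) (h0 : ∀ τ, lx τ < lx σ → Ψ τ = 0) : Ψ σ = 0 := by
  obtain ⟨s, h1, h2, -⟩ := hk
  let j : Fin (n+1) ↪ Fin d := ⟨σ ∘ s, h2.injective⟩
  have h := hΨ σ j
  rw [Finset.sum_eq_single 1] at h
  · simpa [via_one] using h
  · intro π _ hπ
    rw [h0, mul_zero]
    -- first i with π i ≠ i
    have hex : ∃ i, π i ≠ i := by
      by_contra hc
      push Not at hc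
      exact hπ (Equiv.ext hc)
    classical
    have hne : (Finset.univ.filter (fun i => π i ≠ i)).Nonempty := by
      obtain ⟨i, hi⟩ := hex; exact ⟨i, by simpa using hi⟩
    let i := (Finset.univ.filter (fun i => π i ≠ i)).min' hne
    have hi : π i ≠ i := by
      have := Finset.min'_mem (Finset.univ.filter (fun i => π i ≠ i)) hne
      exact (Finset.mem_filter.mp this).2
    have hlt : ∀ i', i' < i → π i' = i' := by
      intro i' h
      by_contra hc
      have := Finset.min'_le (Finset.univ.filter (fun i => π i ≠ i)) i' (by simpa using hc)
      exact absurd h (not_lt.mpr this)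
    have hgt : i < π i := by
      rcases lt_or_gt_of_ne hi with h | h
      · exact absurd (π.injective (hlt _ h)) hi
      · exact h
    refine ⟨s i, ?_, ?_⟩
    · intro x hx
      show (Equiv.Perm.viaFintypeEmbedding π j * σ) x = σ x
      rw [Equiv.Perm.mul_apply]
      by_cases hr : σ x ∈ Set.range j
      · obtain ⟨y, hy⟩ := hr
        have hy' : x = s y := σ.injective hy.symm
        subst hy'
        have hyi : y < i := h1.lt_iff_lt.mp hx
        rw [← hy, Equiv.Perm.viaFintypeEmbedding_apply_image, hlt y hyi]
      · rw [Equiv.Perm.viaFintypeEmbedding_apply_notMem_range _ _ hr]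
    · have e1 : (Equiv.Perm.viaFintypeEmbedding π j * σ) (s i) = j (π i) := by
        rw [Equiv.Perm.mul_apply]
        exact Equiv.Perm.viaFintypeEmbedding_apply_image π j i
      show (Equiv.Perm.viaFintypeEmbedding π j * σ) (s i) < σ (s i)
      rw [e1]
      exact h2 hgt
  · simp
theorem good_ind (σ : Sy d) (hσ : ∀ k, ¬ Chain σ n k) :
    ∃ a b : Fin d → Fin n, Ind K a b σ = 1 ∧ ∀ τ, lx τ < lx σ → Ind K a b τ = 0 := by
  classical
  let c0 : Fin d → ℕ := fun k => Nat.findGreatest (fun m => Chain σ m k) n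
  have hc1 : ∀ k, Chain σ (c0 k) k := fun k =>
    Nat.findGreatest_spec (P := fun m => Chain σ m k) (Nat.zero_le n) (Chain_zero σ k)
  have hc2 : ∀ k, c0 k < n := by
    intro k
    rcases lt_or_eq_of_le (Nat.findGreatest_le (P := fun m => Chain σ m k) n) with h | h
    · exact h
    · have := hc1 k
      rw [show c0 k = n from h] at this
      exact absurd this (hσ k)
  have hc3 : ∀ k k', k < k' → c0 k = c0 k' → σ k < σ k' := by
    intro k k' h he
    by_contra hc
    have hs : σ k' < σ k := lt_of_le_of_ne (not_lt.mp hc) (fun h' => h.ne' (σ.injective h'))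
    have := Chain_succ σ _ k k' (hc1 k) h hs
    have h4 := Nat.le_findGreatest (P := fun m => Chain σ m k') (hc2 k) this
    have h5 : c0 k + 1 ≤ c0 k' := h4
    omega
  let c : Fin d → Fin n := fun k => ⟨c0 k, hc2 k⟩
  refine ⟨c ∘ σ.symm, c, ?_, ?_⟩
  · unfold Ind
    rw [if_pos]
    ext k; simp
  · intro τ hτ
    unfold Ind
    rw [if_neg]
    intro he
    obtain ⟨k, hk1, hk2⟩ := hτ
    simp only [lx] at hk1 hk2
    have hck := congrFun he k
    simp only [Function.comp] at hck
    set k' := σ.symm (τ k) with hk'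
    have hτk : τ k = σ k' := by simp [hk']
    have hcc : c0 k = c0 k' := by simpa [c] using hck
    have hk2' : σ k' < σ k := by rw [← hτk]; exact hk2
    rcases lt_trichotomy k k' with h | h | h
    · exact absurd (hc3 k k' h hcc) (not_lt.mpr hk2'.le)
    · rw [h] at hk2'; exact absurd hk2' (lt_irrefl _)
    · have := hk1 k' h
      have h6 : τ k' = σ k' := this
      rw [← hτk] at h6
      exact absurd (τ.injective h6) h.ne
theorem SFT_span (Ψ : Sy d → K) (hΨ : AntiK n Ψ) :
    Ψ ∈ Submodule.span K (Set.range fun p : (Fin d → Fin n) × (Fin d → Fin n) => Ind K p.1 p.2) := by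
  classical
  set S := Submodule.span K (Set.range fun p : (Fin d → Fin n) × (Fin d → Fin n) => Ind K p.1 p.2)
  have main : ∀ σ : Sy d, ∀ Ψ : Sy d → K, AntiK n Ψ → (∀ τ, lx τ < lx σ → Ψ τ = 0) → Ψ ∈ S := by
    intro σ
    have wf : WellFounded (InvImage (· > ·) (lx (d := d))) := InvImage.wf _ wellFounded_gt
    induction σ using wf.induction with
    | _ σ ih =>
      intro Ψ hΨ h0
      -- get Ψ' 
      have fin : ∀ Ψ' : Sy d → K, AntiK n Ψ' → (∀ τ, lx τ ≤ lx σ → Ψ' τ = 0) → Ψ' ∈ S := by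
        intro Ψ' hA hz
        by_cases he : Ψ' = 0
        · rw [he]; exact S.zero_mem
        · obtain ⟨τ0, hτ0⟩ := Function.ne_iff.mp he
          obtain ⟨σ', hσ', hmin⟩ := Finset.exists_min_image (Finset.univ.filter (fun τ => Ψ' τ ≠ 0)) lx ⟨τ0, by simpa using hτ0⟩
          have hne : Ψ' σ' ≠ 0 := by simpa using hσ'
          refine ih σ' ?_ Ψ' hA ?_
          · by_contra hc
            exact hne (hz σ' (not_lt.mp hc))
          · intro τ hτ
            by_contra hc
            exact absurd hτ (not_lt.mpr (hmin τ (by simpa using hc)))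
      by_cases hg : ∃ k, Chain σ n k
      · obtain ⟨k, hk⟩ := hg
        refine fin Ψ hΨ (fun τ hτ => ?_)
        rcases hτ.lt_or_eq with h | h
        · exact h0 τ h
        · rw [lx_inj h]; exact bad_zero Ψ hΨ σ k hk h0
      · push Not at hg
        obtain ⟨a, b, h1, h2⟩ := good_ind (K := K) σ hg
        have hmem : Ind K a b ∈ S := Submodule.subset_span ⟨(a, b), rfl⟩
        have : Ψ - Ψ σ • Ind K a b ∈ S := by
          apply fin
          · intro τ j
            have e1 := hΨ τ j
            have e2 := Ind_anti (K := K) a b τ j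
            simp only [Pi.sub_apply, Pi.smul_apply, smul_eq_mul, mul_sub, Finset.sum_sub_distrib, e1]
            simp only [mul_left_comm _ (Ψ σ), ← Finset.mul_sum, e2]
            simp
          · intro τ hτ
            rcases hτ.lt_or_eq with h | h
            · simp [h0 τ h, h2 τ h]
            · rw [lx_inj h]; simp [h1]
        have := S.add_mem this (S.smul_mem (Ψ σ) hmem)
        simpa using this
  by_cases he : Ψ = 0
  · rw [he]; exact S.zero_mem
  · obtain ⟨τ0, hτ0⟩ := Function.ne_iff.mp he
    obtain ⟨σ', hσ', hmin⟩ := Finset.exists_min_image (Finset.univ.filter (fun τ => Ψ τ ≠ 0)) lx ⟨τ0, by simpa using hτ0⟩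
    refine main σ' Ψ hΨ (fun τ hτ => ?_)
    by_contra hc
    exact absurd hτ (not_lt.mpr (hmin τ (by simpa using hc)))
theorem SFT (Ψ : Sy d → K) (hΨ : AntiK n Ψ) (α : Sy d → K)
    (hα : ∀ a b : Fin d → Fin n, ∑ σ, α σ * Ind K a b σ = 0) : ∑ σ, α σ * Ψ σ = 0 := by
  have := SFT_span Ψ hΨ
  clear hΨ
  induction this using Submodule.span_induction with
  | mem x hx => obtain ⟨⟨a, b⟩, rfl⟩ := hx; exact hα a b
  | zero => simp
  | add x y hx hy h1 h2 => simp only [Pi.add_apply, mul_add, Finset.sum_add_distrib, h1, h2, add_zero]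
  | smul c x hx h1 => simp only [Pi.smul_apply, smul_eq_mul, mul_left_comm _ c, ← Finset.mul_sum, h1, mul_zero]
end SFT
end
section
section C1
variable {K : Type*} [Field K] {d : ℕ} [NeZero d]
def Am (K : Type*) [Field K] (ν : ZMod d → Bool) (b : Bool) : SqM (ZMod d) K :=
  Matrix.of fun i j => if j = i + 1 ∧ ν i = b then 1 else 0
def Wm (K : Type*) [Field K] (ν : ZMod d → Bool) (w : LB) : SqM (ZMod d) K :=
  (w.map (Am K ν)).prod
theorem Wm_append (ν : ZMod d → Bool) (u v : LB) : Wm K ν (u ++ v) = Wm K ν u * Wm K ν v := by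
  simp [Wm]
theorem Wm_flatten (ν : ZMod d → Bool) (l : List LB) : Wm K ν l.flatten = (l.map (Wm K ν)).prod := by
  induction l with
  | nil => simp [Wm]
  | cons a l ih => simp [Wm_append, ih]
theorem Wm_cons_apply (ν : ZMod d → Bool) (b : Bool) (w : LB) (i j : ZMod d) :
    Wm K ν (b :: w) i j = if ν i = b then Wm K ν w (i+1) j else 0 := by
  have : Wm K ν (b :: w) = Am K ν b * Wm K ν w := by simp [Wm]
  rw [this, Matrix.mul_apply, Finset.sum_eq_single (i+1)]
  · simp [Am]
  · intro k _ hk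
    simp [Am, hk]
  · simp
theorem Wm_apply (ν : ZMod d → Bool) (w : LB) : ∀ (i j : ZMod d),
    Wm K ν w i j = if j = i + (w.length : ZMod d) ∧ ∀ k (h : k < w.length), ν (i + (k : ZMod d)) = w[k] then 1 else 0 := by
  induction w with
  | nil => intro i j; simp [Wm, Matrix.one_apply, eq_comm]
  | cons b w ih =>
    intro i j
    rw [Wm_cons_apply, ih]
    by_cases hb : ν i = b
    · rw [if_pos hb]
      congr 1
      have e1 : ((b :: w).length : ZMod d) = 1 + (w.length : ZMod d) := by
        simp [add_comm]
      rw [e1, ← add_assoc]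
      apply propext
      refine and_congr Iff.rfl ⟨fun h k hk => ?_, fun h k hk => ?_⟩
      · rcases k with _ | k
        · simpa using hb
        · have := h k (by simpa using hk)
          rw [List.getElem_cons_succ, ← this]
          congr 1; push_cast; ring
      · have := h (k+1) (by simpa using hk)
        rw [List.getElem_cons_succ] at this
        rw [← this]
        congr 1; push_cast; ring
    · rw [if_neg hb, if_neg]
      rintro ⟨-, h⟩
      have h0 := h 0 (by simp)
      rw [List.getElem_cons_zero, Nat.cast_zero, add_zero] at h0
      exact hb h0
theorem TT_Wm_zero {ι : Type*} [Fintype ι] [DecidableEq ι] (σ : Equiv.Perm ι) (w : ι → LB)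
    (h0 : 0 < ∑ k, (w k).length) (h1 : ∑ k, (w k).length < d) (ν : ZMod d → Bool) :
    TT σ (fun k => Wm K ν (w k)) = 0 := by
  unfold TT
  apply Finset.sum_eq_zero
  intro a _
  by_contra hne
  have h2 : ∀ k, a (σ k) = a k + ((w k).length : ZMod d) := by
    intro k
    have := (Finset.prod_ne_zero_iff.mp hne) k (Finset.mem_univ k)
    dsimp only at this
    rw [Wm_apply] at this
    by_contra hc
    exact this (if_neg (fun h => hc h.1))
  have h3 : ∑ k, a (σ k) = ∑ k, a k := Equiv.sum_comp σ a
  simp_rw [h2, Finset.sum_add_distrib] at h3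
  have h4 : ((∑ k, (w k).length : ℕ) : ZMod d) = 0 := by
    push_cast
    simpa using h3
  rw [ZMod.natCast_eq_zero_iff] at h4
  exact absurd (Nat.le_of_dvd h0 h4) (by omega)
def wd (ν : ZMod d → Bool) : LB := List.ofFn (fun k : Fin d => ν ((k : ℕ) : ZMod d))
def Ph (φ : LB → K) {ι : Type*} [Fintype ι] [DecidableEq ι] (d : ℕ) [NeZero d] (σ : Equiv.Perm ι) (w : ι → LB) : K :=
  ∑ ν : ZMod d → Bool, φ (wd ν) * TT σ (fun k => Wm K ν (w k))
theorem rot_inv (φ : LB → K) (hc : ∀ u v, φ (u ++ v) = φ (v ++ u)) (w : LB) (m : ℕ) (hm : m ≤ w.length) :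
    φ (w.rotate m) = φ w := by
  rw [List.rotate_eq_drop_append_take hm, hc, List.take_append_drop]
theorem Ph_tr (φ : LB → K) (hc : ∀ u v, φ (u ++ v) = φ (v ++ u)) (w : LB) (hw : w.length = d) :
    ∑ ν : ZMod d → Bool, φ (wd ν) * trace (Wm K ν w) = d * φ w := by
  have hd : 0 < d := Nat.pos_of_ne_zero (NeZero.ne d)
  simp only [trace, diag_apply, Finset.mul_sum]
  rw [Finset.sum_comm]
  have key : ∀ i : ZMod d, ∑ ν : ZMod d → Bool, φ (wd ν) * Wm K ν w i i = φ w := by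
    intro i
    let ν0 : ZMod d → Bool := fun z => w[(z - i).val]'(by rw [hw]; exact ZMod.val_lt _)
    rw [Finset.sum_eq_single ν0]
    · rw [Wm_apply, if_pos, mul_one]
      · have : wd ν0 = w.rotate ((-i).val) := by
          apply List.ext_getElem
          · simp [wd, hw]
          · intro k h1 h2
            have hk : k < d := by simpa [wd] using h1
            simp only [wd, List.getElem_ofFn, List.getElem_rotate, ν0]
            congr 1
            rw [sub_eq_add_neg, ZMod.val_add, ZMod.val_natCast, Nat.mod_eq_of_lt hk, hw]
        rw [this, rot_inv φ hc]
        rw [hw]; exact (ZMod.val_lt _).le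
      · refine ⟨by simp [hw], fun k hk => ?_⟩
        simp only [ν0]
        congr 1
        rw [add_sub_cancel_left, ZMod.val_natCast, Nat.mod_eq_of_lt (by omega)]
    · intro ν _ hν
      rw [Wm_apply, if_neg, mul_zero]
      rintro ⟨-, h⟩
      apply hν
      funext z
      have := h (z - i).val (by rw [hw]; exact ZMod.val_lt _)
      rw [ZMod.natCast_zmod_val, add_sub_cancel] at this
      exact this
    · simp
  rw [Finset.sum_congr rfl (fun i _ => key i)]
  simp [ZMod.card]
variable {ι ι' : Type*} [Fintype ι] [DecidableEq ι] [Fintype ι'] [DecidableEq ι']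
theorem Ph_reindex (φ : LB → K) (σ : Equiv.Perm ι) (σ' : Equiv.Perm ι') (e : ι' ≃ ι)
    (h : ∀ i, σ (e i) = e (σ' i)) (w : ι → LB) : Ph φ d σ w = Ph φ d σ' (w ∘ e) := by
  unfold Ph
  refine Finset.sum_congr rfl (fun ν _ => ?_)
  rw [TT_reindex σ σ' e h]; rfl
theorem Ph_contract (φ : LB → K) (σ : Equiv.Perm (Option ι)) (σ' : Equiv.Perm ι) (p : ι)
    (h1 : σ (some p) = none) (h2 : σ none = some (σ' p))
    (h3 : ∀ k, k ≠ p → σ (some k) = some (σ' k)) (w : Option ι → LB) :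
    Ph φ d σ w = Ph φ d σ' (Function.update (w ∘ some) p (w (some p) ++ w none)) := by
  unfold Ph
  refine Finset.sum_congr rfl (fun ν _ => ?_)
  rw [TT_contract σ σ' p h1 h2 h3]
  congr 2
  funext k
  rcases eq_or_ne k p with rfl | hk
  · simp [Wm_append]
  · simp [hk]
theorem Ph_split (φ : LB → K) (σ : Equiv.Perm ι) (w : ι → LB) (hw : ∀ k, w k ≠ [])
    (hl : ∑ k, (w k).length = d) (p : ι → Prop) (hp : ∀ x, p (σ x) ↔ p x) (hx : ∃ x, p x) (hy : ∃ x, ¬ p x) :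
    Ph φ d σ w = 0 := by
  classical
  unfold Ph
  apply Finset.sum_eq_zero
  intro ν _
  rw [TT_split σ p hp, TT_Wm_zero (ι := {x // p x}) _ (fun x => w x.1), zero_mul, mul_zero]
  · obtain ⟨x, hx⟩ := hx
    exact Finset.sum_pos (fun i _ => List.length_pos_iff.mpr (hw _)) ⟨⟨x, hx⟩, Finset.mem_univ _⟩
  · obtain ⟨y, hy⟩ := hy
    have h := Fintype.sum_subtype_add_sum_subtype p (fun k => (w k).length)
    have : 0 < ∑ i : {x // ¬ p x}, (w i.1).length :=
      Finset.sum_pos (fun i _ => List.length_pos_iff.mpr (hw _)) ⟨⟨y, hy⟩, Finset.mem_univ _⟩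
    omega
theorem Ph_conj (φ : LB → K) (hc : ∀ u v, φ (u ++ v) = φ (v ++ u)) (m : ℕ) (e : Sy (m+1))
    (w : Fin (m+1) → LB) (hl : ∑ k, (w k).length = d) :
    Ph φ d (e * finRotate (m+1) * e⁻¹) w = d * φ (List.ofFn (w ∘ e)).flatten := by
  rw [← Ph_tr φ hc]
  · unfold Ph
    refine Finset.sum_congr rfl (fun ν _ => ?_)
    rw [TT_conj, Wm_flatten, List.map_ofFn]
    rfl
  · rw [List.length_flatten, List.map_ofFn, List.sum_ofFn, ← hl]
    exact Equiv.sum_comp e (fun k => (w k).length)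
/-- the antisymmetry -/
theorem Ph_anti (φ : LB → K) (n : ℕ) [CharZero K] (hc : ∀ u v, φ (u ++ v) = φ (v ++ u))
    (hr : ∀ a : Fin (n+1) → LB, (∀ i, a i ≠ []) → ∑ i, (a i).length = d →
      ∑ e : Sy (n+1), φ (List.ofFn (a ∘ e)).flatten = 0) :
    ∀ (m : ℕ) (ι : Type) [Fintype ι] [DecidableEq ι], Fintype.card ι = m →
      ∀ (w : ι → LB), (∀ k, w k ≠ []) → ∑ k, (w k).length = d →
      ∀ (τ : Equiv.Perm ι) (j : Fin (n+1) ↪ ι),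
      ∑ π : Sy (n+1), ((Equiv.Perm.sign π : ℤ) : K) * Ph φ d (π.viaFintypeEmbedding j * τ) w = 0 := by
  intro m
  induction m with
  | zero =>
    intro ι _ _ hm w _ _ τ j
    have : IsEmpty ι := Fintype.card_eq_zero_iff.mp hm
    exact isEmptyElim (j 0)
  | succ m ih =>
    intro ι _ _ hm w hw hl τ j
    by_cases hj : Function.Surjective j
    · -- base
      let e : Fin (n+1) ≃ ι := Equiv.ofBijective j ⟨j.injective, hj⟩
      let τ' : Sy (n+1) := (e.trans τ).trans e.symm
      have h1 : ∀ π : Sy (n+1), Ph φ d (π.viaFintypeEmbedding j * τ) w = Ph φ d (π * τ') (w ∘ e) := by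
        intro π
        refine Ph_reindex φ _ _ e ?_ w
        intro i
        have : τ (e i) = j (τ' i) := (e.apply_symm_apply (τ (e i))).symm
        rw [Equiv.Perm.mul_apply, Equiv.Perm.mul_apply, this, Equiv.Perm.viaFintypeEmbedding_apply_image]
        rfl
      simp_rw [h1]
      have hl' : ∑ k, ((w ∘ e) k).length = d := by
        rw [← hl]; exact Equiv.sum_comp e (fun k => (w k).length)
      have h2 := full_sum n (fun ρ => ((Equiv.Perm.sign ρ : ℤ) : K) * Ph φ d ρ (w ∘ e))
        (fun ρ => ((Equiv.Perm.sign (finRotate (n+1)) : ℤ) : K) * (d * φ (List.ofFn ((w ∘ e) ∘ ρ)).flatten)) ?_ ?_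
      · rw [← Finset.mul_sum, ← Finset.mul_sum, hr (w ∘ e) (fun i => hw _) hl', mul_zero, mul_zero] at h2
        have h3 : ∑ ρ : Sy (n+1), ((Equiv.Perm.sign ρ : ℤ) : K) * Ph φ d ρ (w ∘ e) = 0 := by
          rcases smul_eq_zero.mp h2 with h | h
          · exact absurd h (zc_ne n)
          · exact h
        rw [← Equiv.sum_comp (Equiv.mulRight τ')] at h3
        have h4 : ∀ π : Sy (n+1), ((Equiv.Perm.sign (Equiv.mulRight τ' π) : ℤ) : K) * Ph φ d (Equiv.mulRight τ' π) (w ∘ e)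
          = ((Equiv.Perm.sign τ' : ℤ) : K) * (((Equiv.Perm.sign π : ℤ) : K) * Ph φ d (π * τ') (w ∘ e)) := by
          intro π
          simp only [Equiv.coe_mulRight, Equiv.Perm.sign_mul, Units.val_mul, Int.cast_mul]
          ring
        simp_rw [h4] at h3
        rw [← Finset.mul_sum] at h3
        rcases mul_eq_zero.mp h3 with h | h
        · rcases Int.units_eq_one_or (Equiv.Perm.sign τ') with h5 | h5 <;> rw [h5] at h <;> simp at h
        · exact h
      · intro ρ hρ
        rcases full_or_split n (by simp) ρ with h | ⟨p, hp, hx, hy⟩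
        · exact absurd h hρ
        · rw [Ph_split φ ρ (w ∘ e) (fun k => hw _) hl' p hp hx hy, mul_zero]
      · intro ρ
        have : Equiv.Perm.sign (ρ * finRotate (n+1) * ρ⁻¹) = Equiv.Perm.sign (finRotate (n+1)) := by
          simp only [map_mul, map_inv]
          rw [mul_comm, ← mul_assoc]; simp
        rw [this, Ph_conj φ hc n ρ _ hl']
    · -- contraction
      have : ∃ p0, ∀ i, j i ≠ p0 := by
        by_contra h; push Not at h; exact hj h
      obtain ⟨p0, hp0⟩ := this
      by_cases hfix : τ p0 = p0
      · apply Finset.sum_eq_zero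
        intro π _
        have hvia : π.viaFintypeEmbedding j p0 = p0 :=
          Equiv.Perm.viaFintypeEmbedding_apply_notMem_range _ _ (by rintro ⟨i, hi⟩; exact hp0 i hi)
        rw [Ph_split φ _ w hw hl (fun x => x = p0) _ ⟨p0, rfl⟩ ⟨j 0, hp0 0⟩, mul_zero]
        intro x
        have hf : (π.viaFintypeEmbedding j * τ) p0 = p0 := by rw [Equiv.Perm.mul_apply, hfix, hvia]
        constructor
        · intro h; exact (Equiv.injective _ (h.trans hf.symm))
        · intro h; rw [h, hf]
      · let e : Option {x // x ≠ p0} ≃ ι := Equiv.optionSubtypeNe p0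
        have e0 : e none = p0 := Equiv.optionSubtypeNe_none p0
        have e1 : ∀ x, e (some x) = x.1 := fun x => Equiv.optionSubtypeNe_some p0 x
        let t : Equiv.Perm (Option {x // x ≠ p0}) := (e.trans τ).trans e.symm
        have ht : ∀ x, e (t x) = τ (e x) := fun x => e.apply_symm_apply _
        have htn : t none ≠ none := by
          intro h
          have := ht none
          rw [h, e0] at this
          exact hfix this.symm
        let j' : Fin (n+1) ↪ {x // x ≠ p0} := ⟨fun i => ⟨j i, hp0 i⟩, fun a b h => j.injective (congrArg Subtype.val h)⟩
        let τ' := Equiv.removeNone t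
        obtain ⟨p, hp⟩ : ∃ p, t (some p) = none := by
          have : t (t.symm none) = none := t.apply_symm_apply none
          rcases h : t.symm none with _ | p
          · rw [h] at this; exact absurd this htn
          · exact ⟨p, by rw [← h]; exact this⟩
        have hτp : some (τ' p) = t none := Equiv.removeNone_none t hp
        have hτk : ∀ k, k ≠ p → some (τ' k) = t (some k) := by
          intro k hk
          refine Equiv.removeNone_some t ?_
          rcases h : t (some k) with _ | q
          · exact absurd (Option.some_injective _ (t.injective (h.trans hp.symm))) hk
          · exact ⟨q, rfl⟩
        have hv : ∀ (π : Sy (n+1)) (x : {x // x ≠ p0}),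
            ((π.viaFintypeEmbedding j' x : {x // x ≠ p0}) : ι) = π.viaFintypeEmbedding j x.1 := by
          intro π x
          by_cases hx : x ∈ Set.range j'
          · obtain ⟨y, rfl⟩ := hx
            rw [Equiv.Perm.viaFintypeEmbedding_apply_image]
            exact (Equiv.Perm.viaFintypeEmbedding_apply_image π j y).symm
          · rw [Equiv.Perm.viaFintypeEmbedding_apply_notMem_range _ _ hx, Equiv.Perm.viaFintypeEmbedding_apply_notMem_range]
            rintro ⟨y, hy⟩
            exact hx ⟨y, Subtype.ext hy⟩
        have h0v : ∀ π : Sy (n+1), π.viaFintypeEmbedding j p0 = p0 := fun π =>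
          Equiv.Perm.viaFintypeEmbedding_apply_notMem_range _ _ (by rintro ⟨i, hi⟩; exact hp0 i hi)
        let w' : {x // x ≠ p0} → LB := Function.update ((w ∘ e) ∘ some) p ((w ∘ e) (some p) ++ (w ∘ e) none)
        have hmain : ∀ π : Sy (n+1), Ph φ d (π.viaFintypeEmbedding j * τ) w =
            Ph φ d (π.viaFintypeEmbedding j' * τ') w' := by
          intro π
          let s : Equiv.Perm (Option {x // x ≠ p0}) := (e.trans (π.viaFintypeEmbedding j * τ)).trans e.symm
          have hs : ∀ x, e (s x) = π.viaFintypeEmbedding j (e (t x)) := by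
            intro x; rw [ht]; exact e.apply_symm_apply _
          rw [Ph_reindex φ _ s e (fun i => (e.apply_symm_apply _).symm)]
          refine Ph_contract φ s _ p ?_ ?_ ?_ (w ∘ e)
          · apply e.injective
            rw [hs, hp, e0, h0v]
          · apply e.injective
            rw [hs, ← hτp, e1, e1, Equiv.Perm.mul_apply, hv]
          · intro k hk
            apply e.injective
            rw [hs, ← hτk k hk, e1, e1, Equiv.Perm.mul_apply, hv]
        simp_rw [hmain]
        refine ih {x // x ≠ p0} ?_ w' ?_ ?_ τ' j'
        · have := Fintype.card_congr e
          rw [Fintype.card_option] at this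
          omega
        · intro k
          rcases eq_or_ne k p with rfl | hk
          · simp [w', hw]
          · simp [w', hk, hw]
        · rw [← hl, ← Equiv.sum_comp e, Fintype.sum_option]
          rw [← Finset.add_sum_erase _ _ (Finset.mem_univ p), ← Finset.add_sum_erase (Finset.univ) (fun i => (w (e (some i))).length) (Finset.mem_univ p)]
          have : ∑ x ∈ Finset.univ.erase p, (w' x).length = ∑ x ∈ Finset.univ.erase p, (w (e (some x))).length := by
            refine Finset.sum_congr rfl (fun x hx => ?_)
            simp [w', Finset.ne_of_mem_erase hx]
          rw [this]
          simp [w']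
          ring
end C1
end
section
open scoped Pointwise
section C2
variable {K : Type*} [Field K] [CharZero K] {n : ℕ}
theorem exists_factor {A B : Type*} [AddCommGroup A] [Module K A] [AddCommGroup B] [Module K B]
    (T : A →ₗ[K] B) (P : A →ₗ[K] K) (h : ∀ x, T x = 0 → P x = 0) : ∃ Λ : B →ₗ[K] K, ∀ x, Λ (T x) = P x := by
  have h' : LinearMap.ker T ≤ LinearMap.ker P := fun x hx => h x hx
  let g : LinearMap.range T →ₗ[K] K := (Submodule.liftQ (LinearMap.ker T) P h') ∘ₗ T.quotKerEquivRange.symm.toLinearMap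
  obtain ⟨Λ, hΛ⟩ := LinearMap.exists_extend g
  refine ⟨Λ, fun x => ?_⟩
  have := LinearMap.congr_fun hΛ ⟨T x, LinearMap.mem_range_self T x⟩
  rw [LinearMap.comp_apply] at this
  have h2 : T.quotKerEquivRange.symm ⟨T x, LinearMap.mem_range_self T x⟩ = Submodule.Quotient.mk x := by
    rw [LinearEquiv.symm_apply_eq]; rfl
  simp only [Submodule.subtype_apply] at this
  rw [this]
  simp only [g, LinearMap.comp_apply, LinearEquiv.coe_coe, h2]
  rfl
theorem transfer (d : ℕ) (Φ : Sy d → (Fin d → Bool) → K)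
    (hA : ∀ c, AntiK n (fun σ => Φ σ c))
    (hR : ∀ (σ h : Sy d) c, Φ (h⁻¹ * σ * h) (c ∘ h) = Φ σ c)
    (α : Sy d × (Fin d → Bool) → K)
    (h0 : ∑ p, α p • TT p.1 (fun k => gen K n (p.2 k)) = 0) : ∑ p, α p * Φ p.1 p.2 = 0 := by
  classical
  -- s
  let s : (Fin d → Bool × (Fin n × Fin n)) → K := fun t =>
    ∑ σ, α (σ, fun k => (t k).1) * Ind K (fun k => (t k).2.1) (fun k => (t k).2.2) σ
  have hs : ∑ t, C (s t) * ∏ k, (X (vI n (t k)) : MvPolynomial (MatVar n) K) = 0 := by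
    rw [← h0, Fintype.sum_prod_type]
    simp only [s, map_sum, Finset.sum_mul]
    rw [Finset.sum_comm]
    refine Finset.sum_congr rfl (fun σ _ => ?_)
    let E : ((Fin d → Bool) × (Fin d → Fin n)) × (Fin d → Fin n) ≃ (Fin d → Bool × (Fin n × Fin n)) :=
      { toFun := fun p k => (p.1.1 k, (p.1.2 k, p.2 k))
        invFun := fun t => ((fun k => (t k).1, fun k => (t k).2.1), fun k => (t k).2.2)
        left_inv := fun p => rfl
        right_inv := fun t => rfl }
    rw [← E.sum_comp, Fintype.sum_prod_type, Fintype.sum_prod_type]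
    refine Finset.sum_congr rfl (fun c _ => ?_)
    unfold TT
    rw [Finset.smul_sum]
    refine Finset.sum_congr rfl (fun a _ => ?_)
    rw [Finset.sum_eq_single (a ∘ σ)]
    · have hi : Ind K a (a ∘ σ) σ = 1 := if_pos rfl
      show C (α (σ, c) * Ind K a (a ∘ σ) σ) * ∏ k, X (vI n (c k, (a k, a (σ k)))) = α (σ, c) • ∏ k, gen K n (c k) (a k) (a (σ k))
      rw [hi, mul_one, MvPolynomial.smul_eq_C_mul]
      congr 1
    · intro b _ hb
      have hi : Ind K a b σ = 0 := if_neg hb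
      show C (α (σ, c) * Ind K a b σ) * ∏ k, X (vI n (c k, (a k, b k))) = 0
      rw [hi, mul_zero, map_zero, zero_mul]
    · simp
  have key : ∀ (c : Fin d → Bool) (a b : Fin d → Fin n),
      ∑ σ, (∑ h : Sy d, α (h⁻¹ * σ * h, c ∘ h)) * Ind K a b σ = 0 := by
    intro c a b
    let t0 : Fin d → Bool × (Fin n × Fin n) := fun k => (c k, (a k, b k))
    have h := lemmaP (vI n) (vI n).injective s (fun t => ∑ h : Sy d, if t ∘ h = t0 then 1 else 0) hs (by
      intro t g
      refine Fintype.sum_equiv (Equiv.mulLeft g) _ _ (fun h => ?_)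
      rfl)
    simp only [Finset.mul_sum] at h
    rw [Finset.sum_comm] at h
    have h2 : ∀ h : Sy d, ∑ t, s t * (if t ∘ h = t0 then 1 else 0) = s (t0 ∘ h.symm) := by
      intro h
      rw [Finset.sum_eq_single (t0 ∘ h.symm)]
      · rw [if_pos, mul_one]
        funext k; simp
      · intro t _ ht
        rw [if_neg, mul_zero]
        intro he
        apply ht
        rw [← he]; funext k; simp
      · simp
    simp_rw [h2] at h
    rw [← Equiv.sum_comp (Equiv.inv (Sy d))] at h
    rw [← h]
    simp only [Finset.sum_mul]
    rw [Finset.sum_comm]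
    refine Finset.sum_congr rfl (fun h _ => ?_)
    simp only [s]
    refine Fintype.sum_equiv (MulAut.conj h⁻¹).toEquiv _ _ (fun σ => ?_)
    have e1 : (MulAut.conj h⁻¹).toEquiv σ = h⁻¹ * σ * h := by
      simp [MulAut.conj_apply]
    rw [e1]
    congr 1
    unfold Ind
    congr 1
    apply propext
    constructor
    · intro hb
      funext k
      show b (h k) = a (h ((h⁻¹ * σ * h) k))
      rw [hb]
      simp
    · intro hb
      funext k
      have := congrFun hb (h⁻¹ k)
      have h6 : b (h (h⁻¹ k)) = a (h ((h⁻¹ * σ * h) (h⁻¹ k))) := this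
      simpa using h6
  have h3 : ∀ c, ∑ σ, (∑ h : Sy d, α (h⁻¹ * σ * h, c ∘ h)) * Φ σ c = 0 := fun c =>
    SFT _ (hA c) _ (key c)
  have h4 : ∑ c, ∑ σ, (∑ h : Sy d, α (h⁻¹ * σ * h, c ∘ h)) * Φ σ c = 0 :=
    Finset.sum_eq_zero (fun c _ => h3 c)
  have h5 : ∑ c, ∑ σ, (∑ h : Sy d, α (h⁻¹ * σ * h, c ∘ h)) * Φ σ c =
      ∑ h : Sy d, ∑ p : Sy d × (Fin d → Bool), α p * Φ p.1 p.2 := by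
    simp only [Finset.sum_mul]
    rw [Finset.sum_congr rfl (fun c _ => Finset.sum_comm), Finset.sum_comm]
    refine Finset.sum_congr rfl (fun h _ => ?_)
    rw [Fintype.sum_prod_type_right]
    refine Fintype.sum_equiv (Equiv.arrowCongr h⁻¹ (Equiv.refl Bool)) _ _ (fun c => ?_)
    refine Fintype.sum_equiv (MulAut.conj h⁻¹).toEquiv _ _ (fun σ => ?_)
    have e1 : (MulAut.conj h⁻¹).toEquiv σ = h⁻¹ * σ * h := by
      simp [MulAut.conj_apply]
    have e2 : (Equiv.arrowCongr h⁻¹ (Equiv.refl Bool)) c = c ∘ h := by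
      rfl
    rw [e1, e2, hR]
  rw [h5, Finset.sum_const, Finset.card_univ, smul_eq_zero] at h4
  rcases h4 with h | h
  · exact absurd h Fintype.card_ne_zero
  · exact h
theorem TT_gen_hom {ι : Type*} [Fintype ι] [DecidableEq ι] (σ : Equiv.Perm ι) (c : ι → Bool) :
    (TT σ (fun k => gen K n (c k))).IsHomogeneous (Fintype.card ι) := by
  unfold TT
  apply IsHomogeneous.sum
  intro a _
  have : Fintype.card ι = ∑ k : ι, 1 := by simp
  rw [this]
  apply IsHomogeneous.prod
  intro k _
  show (gen K n (c k) (a k) (a (σ k))).IsHomogeneous 1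
  rw [gen_apply]
  exact isHomogeneous_X _ _
theorem trw_TT (w : LB) (d : ℕ) (hw : w.length = d + 1) :
    trw K n w = TT (finRotate (d+1)) (fun k : Fin (d+1) => gen K n (w.get (Fin.cast hw.symm k))) := by
  rw [TT_rot]
  unfold trw wm
  congr 2
  apply List.ext_getElem
  · simp [hw]
  · intro i h1 h2
    simp only [List.getElem_map, List.getElem_ofFn]
    rfl
theorem trw_hom (w : LB) : (trw K n w).IsHomogeneous w.length := by
  rcases h : w.length with _ | d
  · rw [List.length_eq_zero_iff] at h
    subst h
    simp only [trw, wm, List.map_nil, List.prod_nil, Matrix.trace_one]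
    exact isHomogeneous_C _ (Fintype.card (Fin n) : K) |> fun h => by simpa using h
  · rw [trw_TT w d h]
    have := TT_gen_hom (K := K) (n := n) (finRotate (d+1)) (fun k : Fin (d+1) => w.get (Fin.cast h.symm k))
    simpa using this
theorem exists_functional (φ : LB → K) (d : ℕ) (hc : ∀ u v, φ (u ++ v) = φ (v ++ u))
    (hr : ∀ a : Fin (n+1) → LB, (∀ i, a i ≠ []) → ∑ i, (a i).length = d + 1 →
      ∑ e : Sy (n+1), φ (List.ofFn (a ∘ e)).flatten = 0) :
    ∃ Λ : MvPolynomial (MatVar n) K →ₗ[K] K, (∀ x ∈ Dec K n, Λ x = 0) ∧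
      (∀ w, w.length = d + 1 → Λ (trw K n w) = φ w) ∧ (∀ w, w.length ≠ d + 1 → Λ (trw K n w) = 0) := by
  classical
  let Φ : Sy (d+1) → (Fin (d+1) → Bool) → K := fun σ c => Ph φ (d+1) σ (fun k => [c k])
  have hlen : ∀ c : Fin (d+1) → Bool, ∑ k, ([c k] : LB).length = d + 1 := by intro c; simp
  let T : (Sy (d+1) × (Fin (d+1) → Bool) → K) →ₗ[K] MvPolynomial (MatVar n) K :=
    Fintype.linearCombination K (fun p => TT p.1 (fun k => gen K n (p.2 k)))
  let P : (Sy (d+1) × (Fin (d+1) → Bool) → K) →ₗ[K] K :=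
    Fintype.linearCombination K (fun p => Φ p.1 p.2)
  obtain ⟨Λ, hΛ⟩ := exists_factor T P (by
    intro α h0
    refine transfer (n := n) (d+1) Φ ?_ ?_ α h0
    · intro c τ j
      exact Ph_anti φ n hc hr _ (Fin (d+1)) rfl (fun k => [c k]) (by simp) (hlen c) τ j
    · intro σ h c
      exact (Ph_reindex φ σ (h⁻¹ * σ * h) h (by intro i; simp) (fun k => [c k])).symm)
  have hΛ' : ∀ σ c, Λ (TT σ (fun k => gen K n (c k))) = Φ σ c := by
    intro σ c
    have := hΛ (Pi.single (σ, c) 1)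
    simpa [T, P, Fintype.linearCombination_apply_single] using this
  have hd0 : ((d + 1 : ℕ) : K) ≠ 0 := by exact_mod_cast Nat.succ_ne_zero d
  refine ⟨((d + 1 : ℕ) : K)⁻¹ • (Λ ∘ₗ homogeneousComponent (d+1)), ?_, ?_, ?_⟩
  · -- vanishing on Dec
    have hprod : ∀ i j, i + j = d + 1 → 0 < i → 0 < j → ∀ f g : MvPolynomial (MatVar n) K, f ∈ pureAlg K n → g ∈ pureAlg K n →
        f.IsHomogeneous i → g.IsHomogeneous j → Λ (f * g) = 0 := by
      intro i j hij hi hj f g hf hg hfi hgj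
      have h1 := FFT_hom f hf hfi
      have h2 := FFT_hom g hg hgj
      have h3 := Submodule.mul_mem_mul h1 h2
      rw [Submodule.span_mul_span] at h3
      have h4 : Submodule.span K (Set.range (fun p : Sy i × (Fin i → Bool) => TT p.1 (fun k => gen K n (p.2 k))) *
         Set.range (fun p : Sy j × (Fin j → Bool) => TT p.1 (fun k => gen K n (p.2 k)))) ≤ LinearMap.ker Λ := by
        rw [Submodule.span_le]
        rintro _ ⟨_, ⟨⟨σ, c⟩, rfl⟩, _, ⟨⟨τ, c'⟩, rfl⟩, rfl⟩
        rw [SetLike.mem_coe, LinearMap.mem_ker]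
        let e : Fin (d+1) ≃ Fin i ⊕ Fin j := (finCongr hij.symm).trans finSumFinEquiv.symm
        have h5 := TT_sum σ τ (fun k => gen K n (Sum.elim c c' k))
        have h6 := TT_reindex (Equiv.sumCongr σ τ) ((e.trans (Equiv.sumCongr σ τ)).trans e.symm) e (by intro k; simp)
          (fun k => gen K n (Sum.elim c c' k))
        have h7 : TT σ (fun k => gen K n (c k)) * TT τ (fun k => gen K n (c' k)) =
          TT ((e.trans (Equiv.sumCongr σ τ)).trans e.symm) (fun k => gen K n ((Sum.elim c c' ∘ e) k)) := by
          rw [← show _ = TT σ (fun k => gen K n (c k)) * TT τ (fun k => gen K n (c' k)) from h5, h6]; rfl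
        dsimp only
        rw [h7, hΛ']
        refine Ph_split φ _ _ (by simp) (hlen _) (fun x => (e x).isLeft) ?_ ?_ ?_
        · intro x
          rcases h : e x with y | y <;> simp [h]
        · exact ⟨e.symm (Sum.inl ⟨0, hi⟩), by simp⟩
        · exact ⟨e.symm (Sum.inr ⟨0, hj⟩), by simp⟩
      exact h4 h3
    intro x hx
    have : Dec K n ≤ LinearMap.ker (((d + 1 : ℕ) : K)⁻¹ • (Λ ∘ₗ homogeneousComponent (d+1))) := by
      unfold Dec
      refine sup_le (Submodule.span_le.mpr ?_) (Submodule.span_le.mpr ?_)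
      · rintro _ rfl
        rw [SetLike.mem_coe, LinearMap.mem_ker, LinearMap.smul_apply, LinearMap.comp_apply,
          homogeneousComponent_of_mem (isHomogeneous_one _ _), if_neg (by omega), map_zero, smul_zero]
      · rintro _ ⟨f, hf, g, hg, hf0, hg0, rfl⟩
        rw [SetLike.mem_coe, LinearMap.mem_ker, LinearMap.smul_apply, LinearMap.comp_apply]
        have h8 : Λ (homogeneousComponent (d+1) (f * g)) = 0 := by
          conv_lhs => rw [← sum_homogeneousComponent f, ← sum_homogeneousComponent g, Finset.sum_mul_sum]
          rw [map_sum, map_sum]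
          apply Finset.sum_eq_zero
          intro i _
          rw [map_sum, map_sum]
          apply Finset.sum_eq_zero
          intro j _
          rw [homogeneousComponent_of_mem ((homogeneousComponent_isHomogeneous i f).mul (homogeneousComponent_isHomogeneous j g))]
          split_ifs with hij
          · rcases Nat.eq_zero_or_pos i with rfl | hi
            · rw [homogeneousComponent_zero, ← constantCoeff_eq, hf0]; simp
            rcases Nat.eq_zero_or_pos j with rfl | hj
            · rw [homogeneousComponent_zero g, ← constantCoeff_eq, hg0]; simp
            exact hprod i j hij.symm hi hj _ _ (homComp_mem f hf i) (homComp_mem g hg j) (homogeneousComponent_isHomogeneous i f) (homogeneousComponent_isHomogeneous j g)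
          · simp
        rw [h8, smul_zero]
    exact this hx
  · intro w hw
    have h1 := trw_hom (K := K) (n := n) w
    rw [hw] at h1
    rw [LinearMap.smul_apply, LinearMap.comp_apply, homogeneousComponent_of_mem h1, if_pos rfl, trw_TT w d hw,
      hΛ', smul_eq_mul]
    have h2 := Ph_conj (d := d+1) φ hc d 1 (fun k => [w.get (Fin.cast hw.symm k)]) (by simp)
    rw [one_mul, inv_one, mul_one] at h2
    have h3 : (List.ofFn ((fun k => [w.get (Fin.cast hw.symm k)]) ∘ (1 : Sy (d+1)))).flatten = w := by
      have : ∀ (m : ℕ) (g : Fin m → Bool), (List.ofFn (fun k => [g k])).flatten = List.ofFn g := by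
        intro m
        induction m with
        | zero => intro g; simp
        | succ m ih => intro g; rw [List.ofFn_succ, List.flatten_cons, ih]; simp [List.ofFn_succ]
      rw [show ((fun k => [w.get (Fin.cast hw.symm k)]) ∘ (1 : Sy (d+1))) = fun k => [w.get (Fin.cast hw.symm k)] from rfl, this]
      apply List.ext_getElem
      · simp [hw]
      · intro i h1 h2; simp only [List.getElem_ofFn]; rfl
    rw [h3] at h2
    rw [show Φ (finRotate (d+1)) (fun k => w.get (Fin.cast hw.symm k)) = _ from h2, ← mul_assoc, inv_mul_cancel₀ hd0, one_mul]
  · intro w hw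
    rw [LinearMap.smul_apply, LinearMap.comp_apply, homogeneousComponent_of_mem (trw_hom w), if_neg hw.symm, map_zero, smul_zero]
end C2
end
section
section PF
variable {K : Type*} [Field K] [CharZero K] {n : ℕ}
theorem trw_bihom (w : LB) : ∃ p q : ℕ, (trw K n w).IsWeightedHomogeneous (bideg n) (p, q) := by
  have key : ∀ w : LB, ∃ m : ℕ × ℕ, ∀ i j, (wm K n w i j).IsWeightedHomogeneous (bideg n) m := by
    intro w
    induction w with
    | nil =>
      refine ⟨0, fun i j => ?_⟩
      simp only [wm, List.map_nil, List.prod_nil, Matrix.one_apply]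
      split_ifs
      · exact isWeightedHomogeneous_one _ _
      · exact isWeightedHomogeneous_zero _ _ _
    | cons b w ih =>
      obtain ⟨m, hm⟩ := ih
      refine ⟨(if b then (0, 1) else (1, 0)) + m, fun i j => ?_⟩
      have : wm K n (b :: w) = gen K n b * wm K n w := by simp [wm]
      rw [this, Matrix.mul_apply]
      apply IsWeightedHomogeneous.sum
      intro k _
      refine IsWeightedHomogeneous.mul ?_ (hm k j)
      cases b
      · exact isWeightedHomogeneous_X _ _ (Sum.inl (i, k))
      · exact isWeightedHomogeneous_X _ _ (Sum.inr (i, k))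
  obtain ⟨m, hm⟩ := key w
  refine ⟨m.1, m.2, ?_⟩
  unfold trw trace
  apply IsWeightedHomogeneous.sum
  intro i _
  exact hm i i
theorem bihom_hom (f : MvPolynomial (MatVar n) K) (p q : ℕ) (h : f.IsWeightedHomogeneous (bideg n) (p, q)) :
    f.IsHomogeneous (p + q) := by
  intro m hm
  have h1 := h hm
  have key : ∀ m : MatVar n →₀ ℕ, Finsupp.weight 1 m = (Finsupp.weight (bideg n) m).1 + (Finsupp.weight (bideg n) m).2 := by
    intro m
    induction m using Finsupp.induction_linear with
    | zero => simp
    | add f g hf hg => rw [map_add, map_add, hf, hg, Prod.fst_add, Prod.snd_add]; ring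
    | single a b =>
      rw [Finsupp.weight_single, Finsupp.weight_single]
      rcases a with a | a <;> simp [bideg]
  rw [key, h1]
abbrev qq (K : Type*) [Field K] (n : ℕ) := (Dec K n).mkQ
theorem qq_pure (f : MvPolynomial (MatVar n) K) (hf : f ∈ pureAlg K n) :
    qq K n f ∈ Submodule.span K (ee K n '' {w | w ≠ []}) := by
  rw [← sum_homogeneousComponent f, map_sum]
  apply Submodule.sum_mem
  intro d _
  rcases d with _ | d
  · have : qq K n (homogeneousComponent 0 f) = 0 := by
      rw [homogeneousComponent_zero, Submodule.mkQ_apply, Submodule.Quotient.mk_eq_zero]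
      refine Submodule.mem_sup_left (Submodule.mem_span_singleton.mpr ⟨coeff 0 f, ?_⟩)
      rw [MvPolynomial.smul_eq_C_mul, mul_one]
    rw [this]; exact zero_mem _
  · have h1 := FFT_hom _ (homComp_mem f hf (d+1)) (homogeneousComponent_isHomogeneous (d+1) f)
    have h2 : Submodule.span K (Set.range fun p : Sy (d+1) × (Fin (d+1) → Bool) =>
        TT p.1 (fun k => gen K n (p.2 k))) ≤ (Submodule.span K (ee K n '' {w | w ≠ []})).comap (qq K n) := by
      rw [Submodule.span_le]
      rintro _ ⟨⟨σ, c⟩, rfl⟩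
      rw [SetLike.mem_coe, Submodule.mem_comap]
      have hg : ∀ b, gen K n b = wm K n [b] := by intro b; simp [wm]
      by_cases hσ : FullC (d+1) σ
      · obtain ⟨e, he⟩ := hσ
        apply Submodule.subset_span
        refine ⟨List.ofFn (c ∘ e), by simp, ?_⟩
        dsimp only
        rw [TT_reindex σ (finRotate (d+1)) e he, TT_rot]
        unfold ee trw wm
        rw [List.map_ofFn]
        rfl
      · have := TT_wm_dec K n d σ (fun k => [c k]) (by simp) hσ
        simp only [← hg] at this
        rw [← Submodule.Quotient.mk_eq_zero] at this
        dsimp only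
        rw [Submodule.mkQ_apply, this]
        exact zero_mem _
    exact h2 h1
theorem qq_const (c : K) : qq K n (algebraMap K _ c) = 0 := by
  rw [Submodule.mkQ_apply, Submodule.Quotient.mk_eq_zero]
  refine Submodule.mem_sup_left (Submodule.mem_span_singleton.mpr ⟨c, ?_⟩)
  rw [Algebra.algebraMap_eq_smul_one]
theorem qq_adjoin (S : Set (MvPolynomial (MatVar n) K)) (hS : S ⊆ pureAlg K n) (f : MvPolynomial (MatVar n) K)
    (hf : f ∈ Algebra.adjoin K S) : f ∈ pureAlg K n ∧ qq K n f ∈ Submodule.span K (qq K n '' S) := by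
  induction hf using Algebra.adjoin_induction with
  | mem x hx => exact ⟨hS hx, Submodule.subset_span ⟨x, hx, rfl⟩⟩
  | algebraMap c => exact ⟨Subalgebra.algebraMap_mem _ c, by rw [qq_const]; exact zero_mem _⟩
  | add f g _ _ h1 h2 => exact ⟨add_mem h1.1 h2.1, by rw [map_add]; exact add_mem h1.2 h2.2⟩
  | mul f g _ _ h1 h2 =>
    refine ⟨mul_mem h1.1 h2.1, ?_⟩
    set a := constantCoeff f
    set b := constantCoeff g
    have e1 : f * g = (f - algebraMap K _ a) * (g - algebraMap K _ b) + a • g + b • f - algebraMap K _ (a * b) := by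
      rw [Algebra.smul_def, Algebra.smul_def, map_mul]; ring
    have e2 : qq K n ((f - algebraMap K _ a) * (g - algebraMap K _ b)) = 0 := by
      rw [Submodule.mkQ_apply, Submodule.Quotient.mk_eq_zero]
      refine Submodule.mem_sup_right (Submodule.subset_span ⟨_, sub_mem h1.1 (Subalgebra.algebraMap_mem _ a), _, sub_mem h2.1 (Subalgebra.algebraMap_mem _ b), ?_, ?_, rfl⟩)
      · simp [a, MvPolynomial.algebraMap_eq]
      · simp [b, MvPolynomial.algebraMap_eq]
    rw [e1, map_sub, map_add, map_add, e2, qq_const, map_smul, map_smul, sub_zero, zero_add]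
    exact add_mem (Submodule.smul_mem _ _ h2.2) (Submodule.smul_mem _ _ h1.2)
theorem adjoin_of_span (S : Set (MvPolynomial (MatVar n) K)) (hS : S ⊆ pureAlg K n)
    (hh : ∀ f ∈ S, ∃ p q : ℕ, f.IsWeightedHomogeneous (bideg n) (p, q))
    (hsp : ∀ f ∈ pureAlg K n, qq K n f ∈ Submodule.span K (qq K n '' S)) : Algebra.adjoin K S = pureAlg K n := by
  apply le_antisymm (Algebra.adjoin_le hS)
  have key : ∀ d, ∀ f ∈ pureAlg K n, f.IsHomogeneous d → f ∈ Algebra.adjoin K S := by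
    intro d
    induction d using Nat.strong_induction_on with
    | _ d ih =>
      intro f hf hd
      rcases Nat.eq_zero_or_pos d with rfl | hpos
      · have h5 := homogeneousComponent_of_mem (m := 0) hd
        rw [if_pos rfl, homogeneousComponent_zero] at h5
        rw [← h5]
        exact Subalgebra.algebraMap_mem _ _
      have h1 := hsp f hf
      rw [← Submodule.map_span] at h1
      obtain ⟨g, hg, hgf⟩ := h1
      have h2 : f - g ∈ Dec K n := by
        rw [← Submodule.Quotient.mk_eq_zero, Submodule.Quotient.mk_sub]
        exact sub_eq_zero.mpr hgf.symm
      let A : Submodule K (MvPolynomial (MatVar n) K) := (Subalgebra.toSubmodule (Algebra.adjoin K S)).comap (homogeneousComponent d)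
      have hA1 : Submodule.span K S ≤ A := by
        rw [Submodule.span_le]
        intro s hs
        obtain ⟨p, q, hpq⟩ := hh s hs
        show homogeneousComponent d s ∈ Algebra.adjoin K S
        rw [homogeneousComponent_of_mem (bihom_hom s p q hpq)]
        split_ifs
        · exact Algebra.subset_adjoin hs
        · exact zero_mem _
      have hA2 : Dec K n ≤ A := by
        refine sup_le (Submodule.span_le.mpr ?_) (Submodule.span_le.mpr ?_)
        · rintro _ rfl
          show homogeneousComponent d 1 ∈ Algebra.adjoin K S
          rw [homogeneousComponent_of_mem (isHomogeneous_one _ _), if_neg (by omega)]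
          exact zero_mem _
        · rintro _ ⟨f, hf, g, hg, hf0, hg0, rfl⟩
          show homogeneousComponent d (f * g) ∈ Algebra.adjoin K S
          rw [← sum_homogeneousComponent f, ← sum_homogeneousComponent g, Finset.sum_mul_sum, map_sum]
          apply sum_mem
          intro i _
          rw [map_sum]
          apply sum_mem
          intro j _
          rw [homogeneousComponent_of_mem ((homogeneousComponent_isHomogeneous i f).mul (homogeneousComponent_isHomogeneous j g))]
          split_ifs with hij
          · rcases Nat.eq_zero_or_pos i with rfl | hi
            · rw [homogeneousComponent_zero, ← constantCoeff_eq, hf0]; simp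
            rcases Nat.eq_zero_or_pos j with rfl | hj
            · rw [homogeneousComponent_zero g, ← constantCoeff_eq, hg0]; simp
            exact mul_mem (ih i (by omega) _ (homComp_mem f hf i) (homogeneousComponent_isHomogeneous i f))
              (ih j (by omega) _ (homComp_mem g hg j) (homogeneousComponent_isHomogeneous j g))
          · exact zero_mem _
      have h3 : f ∈ A := by
        have := A.add_mem (hA2 h2) (hA1 hg)
        simpa using this
      have h4 : homogeneousComponent d f ∈ Algebra.adjoin K S := h3
      rwa [homogeneousComponent_of_mem hd, if_pos rfl] at h4
  intro f hf
  rw [← sum_homogeneousComponent f]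
  exact sum_mem (fun i _ => key i _ (homComp_mem f hf i) (homogeneousComponent_isHomogeneous i f))
theorem final_red (B : Finset LB) (hB0 : ∀ b ∈ B, b ≠ [])
    (hli : LinearIndepOn K (ee K n) (B : Set LB))
    (hsp : ∀ w, w ≠ [] → ee K n w ∈ Submodule.span K (ee K n '' (B : Set LB))) :
    (∀ S : Set (MvPolynomial (MatVar n) K),
      (∀ f ∈ S, ∃ p q : ℕ, f.IsWeightedHomogeneous (bideg n) (p, q)) →
      Algebra.adjoin K S = pureAlg K n →
      (∀ T : Set (MvPolynomial (MatVar n) K), T ⊂ S → Algebra.adjoin K T ≠ pureAlg K n) →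
      S.ncard = B.card) ∧
    ∃ S : Set (MvPolynomial (MatVar n) K),
      (∀ f ∈ S, ∃ p q : ℕ, f.IsWeightedHomogeneous (bideg n) (p, q)) ∧
      Algebra.adjoin K S = pureAlg K n ∧
      (∀ T : Set (MvPolynomial (MatVar n) K), T ⊂ S → Algebra.adjoin K T ≠ pureAlg K n) ∧
      S.ncard = B.card := by
  set V := Submodule.span K (ee K n '' (B : Set LB)) with hV
  have hqV : ∀ f ∈ pureAlg K n, qq K n f ∈ V := by
    intro f hf
    have : Submodule.span K (ee K n '' {w | w ≠ []}) ≤ V := by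
      rw [Submodule.span_le]
      rintro _ ⟨w, hw, rfl⟩
      exact hsp w hw
    exact this (qq_pure f hf)
  have hVle : ∀ S : Set (MvPolynomial (MatVar n) K), S ⊆ pureAlg K n → Algebra.adjoin K S = pureAlg K n →
      Submodule.span K (qq K n '' S) = V := by
    intro S hS had
    apply le_antisymm
    · rw [Submodule.span_le]
      rintro _ ⟨s, hs, rfl⟩
      exact hqV s (hS hs)
    · rw [hV, Submodule.span_le]
      rintro _ ⟨b, hb, rfl⟩
      exact (qq_adjoin S hS (trw K n b) (by rw [had]; exact trw_mem K n b)).2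
  have hsub : ∀ S : Set (MvPolynomial (MatVar n) K), Algebra.adjoin K S = pureAlg K n → S ⊆ pureAlg K n := by
    intro S had x hx
    rw [← had]
    exact Algebra.subset_adjoin hx
  have hfr : Module.finrank K V = B.card := by
    have := finrank_span_eq_card (R := K) hli
    have h7 : V = Submodule.span K (Set.range fun x : (B : Set LB) => ee K n x) := by
      rw [hV, Set.image_eq_range]
    rw [h7, this]
    simp
  constructor
  · intro S hh had hmin
    have hS := hsub S had
    obtain ⟨T, hTS, -, hT1, hT2⟩ := exists_linearIndepOn_extension (K := K) (v := qq K n) (linearIndepOn_empty K _) (Set.empty_subset S)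
    have hspT : Submodule.span K (qq K n '' T) = V := by
      rw [← hVle S hS had]
      apply le_antisymm
      · exact Submodule.span_mono (Set.image_mono hTS)
      · exact Submodule.span_le.mpr hT1
    have hadT : Algebra.adjoin K T = pureAlg K n := by
      refine adjoin_of_span T (hTS.trans hS) (fun f hf => hh f (hTS hf)) (fun f hf => ?_)
      rw [hspT]; exact hqV f hf
    have hTS' : T = S := by
      by_contra hne
      exact hmin T (lt_of_le_of_ne hTS hne) hadT
    subst hTS'
    rw [← hfr, ← hspT, Set.image_eq_range]
    have h := Module.finrank_eq_nat_card_basis (Module.Basis.span hT2)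
    rw [h]
    rfl
  · have hspS : Submodule.span K (qq K n '' (trw K n '' (B : Set LB))) = V := by
      rw [Set.image_image]; rfl
    have hSp : trw K n '' (B : Set LB) ⊆ pureAlg K n := by
      rintro _ ⟨b, -, rfl⟩; exact trw_mem K n b
    refine ⟨trw K n '' (B : Set LB), ?_, ?_, ?_, ?_⟩
    · rintro _ ⟨b, -, rfl⟩; exact trw_bihom b
    · refine adjoin_of_span _ hSp ?_ ?_
      · rintro _ ⟨b, -, rfl⟩; exact trw_bihom b
      · intro f hf; rw [hspS]; exact hqV f hf
    · intro T hT had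
      have h1 := hVle T (hT.1.trans hSp) had
      obtain ⟨s, hs, hsT⟩ := Set.exists_of_ssubset hT
      obtain ⟨b, hb, rfl⟩ := hs
      have h2 : ee K n b ∈ Submodule.span K (ee K n '' ((B : Set LB) \ {b})) := by
        have h3 : ee K n b ∈ Submodule.span K (qq K n '' T) := by
          rw [h1]; exact Submodule.subset_span ⟨b, hb, rfl⟩
        refine Submodule.span_mono ?_ h3
        rintro _ ⟨t, ht, rfl⟩
        obtain ⟨b', hb', rfl⟩ := hT.1 ht
        refine ⟨b', ⟨hb', ?_⟩, rfl⟩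
        rintro rfl
        exact hsT ht
      exact (linearIndepOn_iff_notMem_span.mp hli b hb) h2
    · rw [Set.ncard_image_of_injOn]
      · exact Set.ncard_coe_finset B
      · intro a ha b hb hab
        have : ee K n a = ee K n b := congrArg (qq K n) hab
        exact hli.injOn ha hb this
end PF
end
section
namespace PD
def frc {α : Type} (n : ℕ) (f : ℕ → α) : α := Nat.rec (f nZ) (fun k _ => f (Nat.succ k)) n
def frcL {α : Type} (l : List ℕ) (k : List ℕ → α) : α :=
  LR ((List ℕ → α) → α) (fun k => k [])
    (fun a _ ih k => frc a fun a => ih fun t => k (a :: t)) l k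
def nth {α : Type} (l : List α) (n : ℕ) : Option α :=
  LR (ℕ → Option α) (fun _ => none)
    (fun a _ ih n => Nat.rec (some a) (fun k _ => ih k) n) l n
def MSK : ℕ := 73487848419179040739631520624061256661907877516300225779048792491384469537046505590147748714547026927232285222864636179636902823261327603071118659622003903445426586804947341548498885908191015647833165856525745827836204880200141226098934336277328311217519294137616606937721227492406179139358445278742393114398166180980962231721987822611500092892284456736807450695584096610800041333207916144989813212624708434287647655669260330998072697251530738467473225938757650221334724616300652453444750000374450181518276339439025046337472292143870392515002124814638694114020406195297197486188103222599420600538654876942915203803396766306491534702627999543392689067566425410554840513106978458197462529458516348554951120802768801536905931284791749439950918708603456240356199163389448921846826670107449691297369549063448390340173725358564226831756547949753877152732012002850937519394280003582571540469921299978757373878069232571727926416411921087305656690009432748515512896358175758425819737490837409709523821858218166297907130933961426905491779055344177282738536741396233243544663372659754487087715744201562180730202382958548349427018106048144063595220899518504619733566060572725458143208539542860438686276399139514682571894213958604394264850437135448974781579264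
def mv (rows : List ℕ) (X : ℕ) : ℕ → ℕ → ℕ :=
  LR (ℕ → ℕ → ℕ) (fun _ acc => acc)
    (fun r _ ih s acc =>
      frc (Nat.add acc (Nat.mul (Nat.mod (Nat.shiftRight X s) (nat_lit 4294967296)) r)) fun acc' =>
        frc (Nat.add s nR) fun s' => ih s' acc') rows
def fold (X : ℕ) : ℕ := frc X fun X =>
  frc (Nat.sub X (Nat.mul nS (Nat.land (Nat.shiftRight (Nat.mul X (nat_lit 37450)) (nat_lit 18)) MSK))) fun W =>
  Nat.add (Nat.shiftLeft (Nat.shiftRight W nQ) nQ) (Nat.mod W (nat_lit 4294967291))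
abbrev Tab := List (List (List ℕ) × List (List ℕ))
def lookup (T : Tab) (l : Bool) (m q : ℕ) : Option (List ℕ) :=
  Option.bind (nth T m) fun lv => nth (cond l lv.2 lv.1) q
def inc (l : Bool) (q : ℕ) : ℕ := cond l (Nat.succ q) q
/-- state : key, m, q, X -/
structure Sta where
  k : ℕ
  m : ℕ
  q : ℕ
  X : ℕ
def appW (T : Tab) (w : LB) : ℕ → ℕ → ℕ → Option (ℕ × ℕ × ℕ) :=
  LR (ℕ → ℕ → ℕ → Option (ℕ × ℕ × ℕ)) (fun m q X => some (m, q, X))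
    (fun l _ ih m q X => Option.bind (lookup T l m q) fun rows =>
      frc (fold (mv rows X nQ nZ)) fun Y => frc (Nat.succ m) fun m' => frc (inc l q) fun q' => ih m' q' Y) w
def ins {α : Type} (s : Sta) (l : List Sta) (k : List Sta → α) : α :=
  LR ((List Sta → α) → α) (fun k => k [s])
    (fun t r ih k => cond (Nat.beq s.k t.k) (cond (Nat.beq s.m t.m) (cond (Nat.beq s.q t.q)
      (frc (fold (Nat.add s.X t.X)) fun Y => k (⟨s.k, s.m, s.q, Y⟩ :: r)) (ih fun r' => k (t :: r')))
        (ih fun r' => k (t :: r'))) (ih fun r' => k (t :: r'))) l k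
/-- expand one state into an accumulator -/
def expd (T : Tab) (s : Sta) (ws : List LB) : ℕ → ℕ → List Sta → Option (List Sta) :=
  LR (ℕ → ℕ → List Sta → Option (List Sta)) (fun _ _ acc => some acc)
    (fun w _ ih kk pw acc => frc (Nat.mod kk nE) fun dg =>
      frc (Nat.div kk nE) fun kk' => frc (Nat.mul pw nE) fun pw' =>
      cond (Nat.beq dg nZ) (ih kk' pw' acc)
        (frc (fold (Nat.mul dg s.X)) fun X => Option.bind (appW T w s.m s.q X) fun r =>
          frc (Nat.sub s.k pw) fun sk => ins ⟨sk, r.1, r.2.1, r.2.2⟩ acc fun acc' => ih kk' pw' acc')) ws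
def stepS (T : Tab) (ws : List LB) (l : List Sta) : List Sta → Option (List Sta) :=
  LR (List Sta → Option (List Sta)) (fun acc => some acc)
    (fun s _ ih acc => Option.bind (expd T s ws s.k nU acc) fun acc' => ih acc') l
def digs (ws : List LB) : ℕ → ℕ :=
  LR (ℕ → ℕ) (fun _ => nZ)
    (fun _ _ ih k => Nat.add (Nat.mod k nE) (ih (Nat.div k nE))) ws
def unit (i : ℕ) : ℕ := Nat.add (Nat.shiftLeft nU (Nat.add nQ (Nat.mul nR i)))
  (Nat.mul (nat_lit 1234577) (Nat.succ i))
def finS (m q : ℕ) (l : List Sta) : Option ℕ :=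
  LR (Option ℕ) none
    (fun s t _ => LR (Option ℕ)
      (cond (Nat.beq s.m m) (cond (Nat.beq s.q q) (some s.X) none) none) (fun _ _ _ => none) t) l
def relRow (T : Tab) (ws : List LB) (key m q m0 q0 i : ℕ) : Option ℕ :=
  cond (Nat.ble i (nat_lit 127)) (frc (unit i) fun X =>
  Option.bind (stepS T ws [⟨key, m0, q0, X⟩] []) fun s =>
  Option.bind (stepS T ws s []) fun s =>
  Option.bind (stepS T ws s []) fun s =>
  Option.bind (stepS T ws s []) fun s =>
  Option.bind (stepS T ws s []) fun s => finS m q s) none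
/-- pivots: list of (shift, row) in insertion order -/
abbrev Piv := List (ℕ × ℕ)
def reduce (P : Piv) : ℕ → ℕ :=
  LR (ℕ → ℕ) (fun X => X)
    (fun p _ ih X => frc (Nat.mod (Nat.shiftRight X p.1) (nat_lit 4294967296)) fun c =>
      cond (Nat.beq c nZ) (ih X)
        (frc (fold (Nat.add X (Nat.mul (Nat.sub nS c) p.2))) fun Y => ih Y)) P
def snoc {α : Type} (l : List α) (a : α) : List α :=
  LR (List α) [a] (fun b _ ih => b :: ih) l
/-- add a relation row -/
def addP (P : Piv) (X : ℕ) : Piv :=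
  frc (reduce P X) fun R =>
  cond (Nat.beq (Nat.shiftRight R nQ) nZ) P
    (frc (Nat.mul nR (Nat.div (Nat.log2 R) nR)) fun s =>
      frc (Nat.mod (Nat.pow (Nat.shiftRight R s) (nat_lit 5)) nS) fun c =>
      frc (fold (Nat.mul c R)) fun R' => snoc P (s, R'))
def frcP {α : Type} (l : Piv) (k : Piv → α) : α :=
  LR ((Piv → α) → α) (fun k => k [])
    (fun a _ ih k => frc a.1 fun a1 => frc a.2 fun a2 => ih fun t => k ((a1, a2) :: t)) l k
/-- words decode: leading one bit; bits most significant first -/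
def decw (fuel : ℕ) : ℕ → LB → LB :=
  Nat.rec (motive := fun _ => ℕ → LB → LB) (fun _ acc => acc)
    (fun _ ih c acc => cond (Nat.ble c nU) acc
      (frc (Nat.div c nT) fun c' => ih c' (Nat.beq (Nat.mod c nT) nU :: acc))) fuel
def frcB {α : Type} (b : Bool) (k : Bool → α) : α := Bool.rec (k false) (k true) b
def frcW {α : Type} (l : LB) (k : LB → α) : α :=
  LR ((LB → α) → α) (fun k => k [])
    (fun a _ ih k => frcB a fun a => ih fun t => k (a :: t)) l k
def decs {α : Type} (l : List ℕ) (k : List LB → α) : α :=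
  LR ((List LB → α) → α) (fun k => k [])
    (fun a _ ih k => frcW (decw nW a []) fun a => ih fun t => k (a :: t)) l k
def wlen (w : LB) : ℕ :=
  LR ℕ nZ (fun _ _ ih => Nat.succ ih) w
def wct (w : LB) : ℕ :=
  LR ℕ nZ (fun l _ ih => inc l ih) w
def wtot (f : LB → ℕ) (ws : List LB) : ℕ → ℕ :=
  LR (ℕ → ℕ) (fun _ => nZ)
    (fun w _ ih k => Nat.add (Nat.mul (Nat.mod k nE) (f w)) (ih (Nat.div k nE))) ws
def allNE (ws : List LB) : Bool :=
  LR Bool true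
    (fun w _ ih => LR Bool false (fun _ _ _ => ih) w) ws
/-- relation group: word codes, key, indices -/
abbrev RelG := List ℕ × ℕ × List ℕ
def addIdx (T : Tab) (ws : List LB) (key m q m0 q0 : ℕ) (is : List ℕ) : Piv → Option Piv :=
  LR (Piv → Option Piv) (fun P => some P)
    (fun i _ ih P => Option.bind (relRow T ws key m q m0 q0 i) fun X => frcP (addP P X) fun P => ih P) is
def addG (T : Tab) (m q : ℕ) (g : RelG) (P : Piv) : Option Piv :=
  decs g.1 fun ws => cond (allNE ws) (cond (Nat.beq (digs ws g.2.1) (nat_lit 5))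
    (frc (Nat.sub m (wtot wlen ws g.2.1)) fun m0 => frc (Nat.sub q (wtot wct ws g.2.1)) fun q0 =>
      addIdx T ws g.2.1 m q m0 q0 g.2.2 P) none) none
def addGs (T : Tab) (m q : ℕ) (gs : List RelG) : Piv → Option Piv :=
  LR (Piv → Option Piv) (fun P => some P)
    (fun g _ ih P => Option.bind (addG T m q g P) fun P => ih P) gs
abbrev Wd := List (List (List LB))
def wget (W : Wd) (m q : ℕ) : List LB := ((nth W m).bind fun l => nth l q).getD []
/-- coordinate words from the previous level -/
def cmap (l : Bool) (ws r : List LB) : List LB :=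
  LR (List LB) r (fun w _ ih => (l :: w) :: ih) ws
def llen {α : Type} (l : List α) : ℕ := LR ℕ nZ (fun _ _ ih => Nat.succ ih) l
/-- units `i, i+1, ...`, one for each element of the list -/
def units {α : Type} (l : List α) : ℕ → List ℕ :=
  LR (ℕ → List ℕ) (fun _ => []) (fun _ _ ih i => unit i :: ih (Nat.succ i)) l
def isPiv (P : Piv) (u : ℕ) : Bool :=
  LR Bool false (fun p _ ih => cond (Nat.beq p.1 (Nat.log2 u)) true ih) P
/-- kept units / words -/
def keepU (P : Piv) (us : List ℕ) : List ℕ :=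
  LR (List ℕ) [] (fun u _ ih => cond (isPiv P u) ih (u :: ih)) us
def keepW (P : Piv) (ws : List LB) : List ℕ → List LB :=
  LR (List ℕ → List LB) (fun _ => [])
    (fun w _ ih us => LR (List LB) []
      (fun u us _ => cond (isPiv P u) (ih us) (w :: ih us)) us) ws
def comp (P : Piv) (us : List ℕ) : ℕ → List ℕ :=
  LR (ℕ → List ℕ) (fun _ => [])
    (fun u _ ih i => cond (isPiv P u) (nZ :: ih i) (unit i :: ih (Nat.succ i))) us
/-- final rows -/
def mkRow (P : Piv) (ku cm : List ℕ) (u : ℕ) : Option ℕ :=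
  frc (reduce P u) fun X => frc (fold (mv cm X nQ nZ)) fun Y =>
    cond (Nat.beq (Nat.shiftRight (mv ku Y nQ nZ) nQ) (Nat.shiftRight X nQ)) (some Y) none
def mkRows (P : Piv) (ku cm us : List ℕ) : Option (List ℕ) :=
  LR (Option (List ℕ)) (some [])
    (fun u _ ih => Option.bind (mkRow P ku cm u) fun Y => Option.bind ih fun t => some (Y :: t)) us
def frcWs {α : Type} (l : List LB) (k : List LB → α) : α :=
  LR ((List LB → α) → α) (fun k => k [])
    (fun a _ ih k => frcW a fun a => ih fun t => k (a :: t)) l k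
def tk {α : Type} (l : List α) (r : List ℕ) : List ℕ :=
  LR (List ℕ → List ℕ) (fun _ => [])
    (fun _ _ ih r => LR (List ℕ) [] (fun a t _ => a :: ih t) r) l r
def dp {α : Type} (l : List α) (r : List ℕ) : List ℕ :=
  LR (List ℕ → List ℕ) (fun r => r)
    (fun _ _ ih r => LR (List ℕ) [] (fun _ t _ => ih t) r) l r
/-- coordinate words for level over `wx` (x-part) and `wy` (y-part) -/
def cw (wx wy : List LB) : List LB := cmap false wx (cmap true wy [])
/-- temporary level: trivial tables; input the previous level's list of word lists -/
def trivX (ls : List (List LB)) : List (List ℕ) :=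
  LR (List (List ℕ)) [] (fun wx _ ih => frcL (units wx nZ) fun u => u :: ih) ls
def trivY (ls : List (List LB)) : List (List ℕ) :=
  LR (List (List ℕ)) []
    (fun wy t ih => LR (List (List ℕ)) []
      (fun wx _ _ => frcL (units wy (llen wx)) fun u => u :: ih) t) ls
/-- one weight: returns (words, rows) -/
def doQ (T : Tab) (m q : ℕ) (wx wy : List LB) (gs : List RelG) : Option (List LB × List ℕ × List ℕ) :=
  Option.bind (addGs T m q gs []) fun P =>
  frcWs (cw wx wy) fun ws =>
  frcL (units ws nZ) fun us => frcL (keepU P us) fun ku => frcL (comp P us nZ) fun cm =>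
  frcWs (keepW P ws us) fun kw =>
  Option.bind (mkRows P ku cm us) fun rows => some (kw, tk wx rows, dp wx rows)
/-- all weights. `wy` the previous weight's word list; result: (new word lists, TX, TY with extra head) -/
def doQs (T : Tab) (m : ℕ) (ls : List (List LB)) :
    ℕ → List LB → List (List RelG) → Option (List (List LB) × List (List ℕ) × List (List ℕ)) :=
  LR (ℕ → List LB → List (List RelG) → Option (List (List LB) × List (List ℕ) × List (List ℕ)))
    (fun _ _ _ => some ([], [], []))
    (fun wx _ ih q wy gss => LR (Option (List (List LB) × List (List ℕ) × List (List ℕ))) none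
      (fun gs gss' _ => Option.bind (doQ T m q wx wy gs) fun r =>
        Option.bind (ih (Nat.succ q) wx gss') fun z => some (r.1 :: z.1, r.2.1 :: z.2.1, r.2.2 :: z.2.2)) gss) ls
def tl {α : Type} (l : List α) : List α := LR (List α) [] (fun _ t _ => t) l
def frcLL {α : Type} (l : List (List ℕ)) (k : List (List ℕ) → α) : α :=
  LR ((List (List ℕ) → α) → α) (fun k => k [])
    (fun a _ ih k => frcL a fun a => ih fun t => k (a :: t)) l k
def frcWW {α : Type} (l : List (List LB)) (k : List (List LB) → α) : α :=
  LR ((List (List LB) → α) → α) (fun k => k [])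
    (fun a _ ih k => frcWs a fun a => ih fun t => k (a :: t)) l k
/-- `l ++ [a]`, evaluated -/
def snocF {α β : Type} (l : List α) (a : α) (k : List α → β) : β :=
  LR ((List α → β) → β) (fun k => k [a]) (fun b _ ih k => ih fun t => k (b :: t)) l k
def lenOK (ls : List (List LB)) : Bool :=
  LR Bool true (fun w _ ih => cond (Nat.ble (llen w) nX) ih false) ls
/-- one level : cur = last level of words -/
def doM (T : Tab) (m : ℕ) (cur : List (List LB)) (gss : List (List RelG))
    (k : List (List LB) → Tab → Bool) : Bool :=
  cond (lenOK cur)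
  (frcLL (trivX cur) fun tx => frcLL (trivY cur) fun ty =>
  snocF T (tx, ty) fun T' =>
  Option.rec (motive := fun _ => Bool) false (fun r =>
    frcLL r.2.1 fun tx => frcLL (tl r.2.2) fun ty => frcWW r.1 fun w =>
    cond (Nat.beq (llen tx) nE) (cond (Nat.beq (llen ty) nS) (snocF T (tx, ty) fun T' => k w T') false) false)
    (doQs T' m cur nZ [] gss)) false
def rv (l : LB) : LB → LB :=
  LR (LB → LB) (fun acc => acc) (fun b _ ih acc => ih (b :: acc)) l
/-- tensor vector of the word `l` applied after `rw` -/
def tenR (T : Tab) (m q : ℕ) (uX uY : List ℕ) (l : Bool) (rw : LB) : Option ℕ :=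
  Option.bind (appW T rw nZ nZ (unit nZ)) fun r =>
    cond (Nat.beq r.1 m) (cond (Nat.beq (inc l r.2.1) q)
      (frc (fold (mv (cond l uY uX) r.2.2 nQ nZ)) fun X => some X) none) none
/-- cyclic relation row -/
def cycRow (T : Tab) (m q : ℕ) (uX uY : List ℕ) (w : LB) (u : ℕ) : Option ℕ :=
  LR (Option ℕ) none
    (fun l w' _ => LR (Option ℕ) none
      (fun l1 w'' _ => Option.bind (tenR T m q uX uY l1 (l :: rv w'' [])) fun X =>
        frc (fold (Nat.add u (Nat.mul (nat_lit 6) X))) fun X => some X) w') w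
def cycRows (T : Tab) (m q : ℕ) (uX uY : List ℕ) (ws : List LB) : List ℕ → Piv → Option Piv :=
  LR (List ℕ → Piv → Option Piv) (fun _ P => some P)
    (fun w _ ih us P => LR (Option Piv) none
      (fun u us _ => Option.bind (cycRow T m q uX uY w u) fun X => frcP (addP P X) fun P => ih us P) us) ws
def tenW (T : Tab) (m q : ℕ) (uX uY : List ℕ) (w : LB) : Option ℕ :=
  LR (Option ℕ) none (fun l w' _ => tenR T m q uX uY l (rv w' [])) w
def extRows (T : Tab) (m q : ℕ) (uX uY : List ℕ) (ws : List LB) : Piv → Option Piv :=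
  LR (Piv → Option Piv) (fun P => some P)
    (fun w _ ih P => Option.bind (tenW T m q uX uY w) fun u =>
      Option.bind (cycRow T m q uX uY w u) fun X => frcP (addP P X) fun P => ih P) ws
/-- least significant bit first -/
def dcd (fuel : ℕ) : ℕ → LB :=
  Nat.rec (motive := fun _ => ℕ → LB) (fun _ => [])
    (fun _ ih c => cond (Nat.ble c nU) []
      (Nat.beq (Nat.mod c nT) nU :: ih (Nat.div c nT))) fuel
def dcds {α : Type} (l : List ℕ) (k : List LB → α) : α :=
  LR ((List LB → α) → α) (fun k => k [])
    (fun a _ ih k => frcW (dcd nW a) fun a => ih fun t => k (a :: t)) l k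
def code (w : LB) : ℕ :=
  LR ℕ nU (fun l _ ih => Nat.add (Nat.mul nT ih) (cond l nU nZ)) w
def sameC (ws : List LB) : List ℕ → Bool :=
  LR (List ℕ → Bool)
    (fun cs => LR Bool true (fun _ _ _ => false) cs)
    (fun w _ ih cs => LR Bool false (fun c cs _ => cond (Nat.beq (code w) c) (ih cs) false) cs) ws
/-- `m` = length of the words in `wx`, `wy`; degree is `m+1`, weight `q`; `ex` : expected codes, extra relations -/
def doE (T : Tab) (m q : ℕ) (wx wy : List LB) (ex : List ℕ × List ℕ) : Bool :=
  cond (Nat.ble (llen wx) nX) (cond (Nat.ble (llen wy) nX)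
  (frcWs (cw wx wy) fun ws =>
  frcL (units ws nZ) fun us => frcL (units wx nZ) fun uX => frcL (units wy (llen wx)) fun uY =>
  dcds ex.2 fun xs =>
  Option.rec (motive := fun _ => Bool) false (fun P =>
    frcL (keepU P us) fun ku => frcL (comp P us nZ) fun cm =>
    frcWs (keepW P ws us) fun kw =>
    Option.rec (motive := fun _ => Bool) false (fun _ => sameC kw ex.1) (mkRows P ku cm us))
    (Option.bind (cycRows T m q uX uY ws us []) fun P => extRows T m q uX uY xs P)) false) false
def doEs (T : Tab) (m : ℕ) (ls : List (List LB)) : ℕ → List LB → List (List ℕ × List ℕ) → Bool :=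
  LR (ℕ → List LB → List (List ℕ × List ℕ) → Bool) (fun _ _ exps =>
    LR Bool true (fun _ _ _ => false) exps)
    (fun wx _ ih q wy exps => LR Bool true
      (fun ex exps _ => cond (doE T m q wx wy ex) (ih (Nat.succ q) wx exps) false) exps) ls
def allE (ls : List (List LB)) : Bool :=
  LR Bool true (fun w _ ih => LR Bool ih (fun _ _ _ => false) w) ls
/-- `m` = length of the words in `cur` = length of `T` -/
def run (gs : List (List (List RelG) × List (List ℕ × List ℕ))) : ℕ → Tab → List (List LB) → Bool :=
  LR (ℕ → Tab → List (List LB) → Bool)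
   (fun _ _ cur => allE cur)
   (fun g _ ih m T cur => cond (doEs T m cur nZ [] g.2)
     (frc (Nat.succ m) fun m' => doM T m' cur g.1 fun cur' T' => ih m' T' cur') false) gs
end PD
end
section
namespace PD
def edat : List (List (List ℕ × List ℕ)) := [[],
 [([4], []), ([6], [])],
 [([8], []), ([12], [])],
 [([16], []), ([24], []), ([28,26], [])],
 [([32], []), ([48], []), ([56,52], [])],
 [([], []), ([], []), ([112,104], []), ([120,116,108], [])],
 [([], []), ([], []), ([208], []), ([240,232,216], [])],
 [([], []), ([], []), ([400], []), ([464,432,456], []), ([496,488,472,468,436], [])],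
 [([], []), ([], []), ([], []), ([912,848,840], []), ([976,944,968,936,872], [])],
 [([], []), ([], []), ([], []), ([1808,1680], [1346]), ([1936,1872,1744,1840,1864], []), ([2000,1968,1904,1992,1960,1896,1944,1748], [])],
 [([], []), ([], []), ([], []), ([3344], [3138]), ([3856,3728,3472,3376], [3394]), ([3984,3920,3792,3888,3760,3912,3496], [])],
 [([], []), ([], []), ([], []), ([6416], []), ([7440,6928,7312], [7234]), ([7952,7824,7568,7760,6992,7472], [7746]), ([8016,7888,7984,7856,8008,7880,7592], [])],
 [([], []), ([], []), ([], []), ([], []), ([14608], [14912]), ([15632,15120,15504], [15426,14914]), ([16016,15760,15952,15184,15664], [15682,15170])],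
 [([], []), ([], []), ([], []), ([], []), ([], [26144]), ([30992], [29762]), ([31504,31888], [31298]), ([32144,32080,31568], [31554])],
 [([], []), ([], []), ([], []), ([], []), ([], []), ([59664], [62016]), ([62736], []), ([64144], [63168])]]
/-- unpacking of the relation data -/
def dcA (b o f : ℕ) : ∀ {α : Type}, ℕ → (List ℕ → ℕ → α) → α :=
  Nat.rec (motive := fun _ => ∀ {α : Type}, ℕ → (List ℕ → ℕ → α) → α) (fun n k => k [] n)
    (fun _ ih {α} n k => frc (Nat.div n b) fun n' => frc (Nat.mod n b) fun c =>
      Nat.rec (motive := fun _ => α) (k [] n') (fun p _ => frc (Nat.add p o) fun p => ih n' fun l => k (p :: l)) c) f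
def dcM : List ℕ := [5, 12, 19, 26, 33, 75, 82, 89, 138, 145, 201, 586, 593, 649, 1097, 4681]
def dcC (f : ℕ) : ∀ {α : Type}, ℕ → (List RelG → ℕ → α) → α :=
  Nat.rec (motive := fun _ => ∀ {α : Type}, ℕ → (List RelG → ℕ → α) → α) (fun n k => k [] n)
    (fun _ ih {α} n k => dcA (nat_lit 15) nT (nat_lit 9) n fun a n => LR α (k [] n)
      (fun _ _ _ => frc (dcM.getD (Nat.mod n nH) nZ) fun m => frc (Nat.div n nH) fun n =>
        dcA (nat_lit 47) nZ (nat_lit 40) n fun l n => ih n fun t => k ((a, m, l) :: t)) a) f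
def dcD (f : ℕ) : ℕ → List (List RelG) :=
  Nat.rec (motive := fun _ => ℕ → List (List RelG)) (fun _ => [])
    (fun _ ih n => dcC nX n fun t n => t :: ih n) f
def gdat : List (List (List RelG)) := List.map (dcD nE) [
 0,
 0,
 0,
 0,
 4404089414794581872016599408213504238707872119601,
 264348630760955996934504867856759008806858545372747892518298221794015,
 26345754198674160257572120879363165559809413866198259543962982842183840313230789781758130488185088839364088449774596493700156104018750087519625208992409398015,
 2619581985692539351077866318279577187629212213869906356762432317754597261825122924184412941880502176574965959836496849676609472178536314758342093235354173302934637945293501807583659177421334907254151300662478246663099113113767428954838778313011143906914436816542075945973686131971553452015,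
 39602796738168472508232520619728313487021800953937359383006381081630475492791563647082461614204669914885061198287916201451981348909625483577254712137349543981296933186709798583293791922386700721405373305412384218074777885810766130308962964327881730549165128937895574029196923033529566749303420652311313739505876839651665257426227464016458744524970473233195687188224118958389752662296082606705810436851432720525925795382254566575333716515237823465506015,
 4615413886071089050724770823981474679568992224963478985485283685730823114715515578896281689033833571237297307427570367735759408286975018086671239921424121643817998006549685832039012083434866418987274250383211261029258057664169882447883355713273307137905227158398299516330684760137954459170988808131957614359831212339067247385157626718436000910526233917218641369875741486715414966794999477003410780024566984277588350362338805822891726958190312844227373221797365382616594613991291677115610896150900566417846752527328172559726181796017411259536181927505115933947499301045262957789974726676082301674852050511747942497579044144843015207527467606601317990225,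
 12320317980838753213093082966154636548337122318052403867298095328669580202843205360251294367675662611106178317047620109740498429618766773310347273762516836157512034307573045152935857469534989097913647681299759249431826116793371259753024393648754088035067990264560243608888644232083114893039009256403646033386160451240892685318399863437318699000526202795475440568814166621009337041778767159999736085432412285957489139463279853602729262098687103556914719799531803716853383332399674586020612466314333790807864982916478719027687348104754356090247915359105072849317481115261948388716809014849066119786922059754915840987496949527769235874477637679800622605695359922544337824049797907497580349974309653326610856451515135359051543405854200589811082319930532406745799840860913667659621065075346958699305636274015589447164034381728154311386190252988617673893036320225,
 4770984335623179342104137068367522906061116180318757952302273483607412252155421868940404195951690938187005483344748073351730096263186777176851965137782259845831349961834569472216240595838921730002636239272883717807383468918030349569389038711498476201145553801499915437059744553446395935835036744016330354778129418593889912622706954480877847966737550021647058172955386246364165425462551562294739888182231744036824735364456106853885745072121691354300029617882368634732788600111510999518955203403441027817932247895776138053486267074623594560259799309536840195353442570284012991747095625190240426087059524575782735409820568935202426875375952510593348842882397252073945541970840763009461284654274087665170475541806362218251667687578199224998977355400628945479749127251558793398758976900052319706296874753351080107586814051899114272504202626374781036289189925952988608774718218270105504871438410478400906959555282879990243946245621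15723745767965369306383635497603448470849213789629397848260225,
 6726243191991979706657222394579123541239981845918902771529715931080468261284106130333128747376043219549472538383531438491597646661130491074762371691255906832648914427416544560736029377479649460229664216992681450302553665222602988812468179503990338878197400292482553201334176889515447855320259152605667251952967685110236743625144221499269980965111316529239624523290106674258725447752966428865867791246690789466836477254800840355984549981722367409670953121222792246927635207808459437309550319533202962116496220277608657008466097599601009991065242086899772810787909421686528467490933751657545091658269629015392793431733730483973453861136210417528576836227112203570000505176584791664257816976541636301838194589136826870961104747453375,
 1984888606105786293443241429913751385120103638008743589255472433937209801455403014137041824473048465978219294911528838620186136490158055569921029179281733310884150030464223850919801963918982791669831145434291285367169486337789697266469726006488834327029702878937983892366825451935618616356877715670728571031140759389966685675264159136325126121349447360577511961685787860188588205417964577346743669703375,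
 13414969953220768226330237525303339356212596474563718173175749796160580029906143443510830373784597704963733617470294486920993330578409097050625]
end PD
end
section
namespace PD
def ini : List (List LB) := [[[]],[],[],[],[],[],[],[]]
set_option maxRecDepth 100000
theorem run_true : run (gdat.zip edat) nZ [] ini = true := by decide +kernel
end PD
end
section
namespace PD
theorem frc_eq {α : Type} (n : ℕ) (f : ℕ → α) : frc n f = f n := by cases n <;> rfl
theorem frcL_eq {α : Type} (l : List ℕ) (k : List ℕ → α) : frcL l k = k l := by
  induction l generalizing k with
  | nil => rfl
  | cons a t ih =>
    have : frcL (a :: t) k = frc a fun a => frcL t fun t => k (a :: t) := rfl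
    rw [this, frc_eq, ih]
def pk : ℕ → (ℕ → ℕ) → ℕ
  | 0, _ => 0
  | n+1, x => x 0 + 2^32 * pk n (fun i => x (i+1))
theorem pk_add (n : ℕ) (x y : ℕ → ℕ) : pk n (fun i => x i + y i) = pk n x + pk n y := by
  induction n generalizing x y with
  | zero => rfl
  | succ n ih => simp only [pk]; rw [ih]; ring
theorem pk_mul (n k : ℕ) (x : ℕ → ℕ) : pk n (fun i => k * x i) = k * pk n x := by
  induction n generalizing x with
  | zero => rfl
  | succ n ih => simp only [pk]; rw [ih]; ring
theorem pk_get (n i : ℕ) (x : ℕ → ℕ) (hx : ∀ i, x i < 2^32) (hi : i < n) :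
    pk n x / 2^(32*i) % 2^32 = x i := by
  induction i generalizing n x with
  | zero =>
    obtain ⟨n, rfl⟩ : ∃ k, n = k+1 := ⟨n-1, by omega⟩
    simp only [pk, mul_zero, pow_zero, Nat.div_one]
    rw [Nat.add_mul_mod_self_left]; exact Nat.mod_eq_of_lt (hx 0)
  | succ i ih =>
    obtain ⟨n, rfl⟩ : ∃ k, n = k+1 := ⟨n-1, by omega⟩
    have h1 : 2^(32*(i+1)) = 2^32 * 2^(32*i) := by ring
    rw [h1, ← Nat.div_div_eq_div_mul]
    simp only [pk]
    rw [Nat.add_mul_div_left _ _ (by norm_num), Nat.div_eq_of_lt (hx 0), zero_add]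
    exact ih n (fun i => x (i+1)) (fun i => hx _) (by omega)
theorem pk_land (n : ℕ) (x : ℕ → ℕ) (hx : ∀ i, x i ≤ 8191) :
    (37450 * pk n x / 2^18) &&& pk n (fun _ => 16383) = pk n (fun i => x i / 7) := by
  induction n generalizing x with
  | zero => simp [pk]
  | succ n ih =>
    simp only [pk]
    have h0 := hx 0
    have ih' := ih (fun i => x (i+1)) (fun i => hx _)
    set P := pk n (fun i => x (i+1)) with hP
    set A := pk n (fun _ => 16383) with hA
    have e1 : 37450 * (x 0 + 2^32 * P) / 2^18 = x 0 / 7 + 2^14 * (37450 * P) := by omega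
    rw [e1]
    set u := x 0 / 7 + 2^14 * (37450 * P) with hu
    have e2 : (u &&& (16383 + 2^32 * A)) % 2^32 = x 0 / 7 := by
      rw [Nat.and_mod_two_pow]
      have : (16383 + 2^32 * A) % 2^32 = 2^14 - 1 := by omega
      rw [this, Nat.and_two_pow_sub_one_eq_mod]
      omega
    have e3 : (u &&& (16383 + 2^32 * A)) / 2^32 = pk n (fun i => x (i+1) / 7) := by
      rw [Nat.and_div_two_pow, ← ih']
      congr 1 <;> omega
    have := Nat.mod_add_div (u &&& (16383 + 2^32 * A)) (2^32)
    rw [e2, e3] at this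
    exact this.symm
theorem MSK_eq : MSK = 2^64 * pk 128 (fun _ => 16383) := by decide +kernel
structure Rep (c : ℕ) (x : ℕ → ℕ) (X : ℕ) : Prop where
  bd : ∀ i, x i ≤ c
  eq : ∃ s, s ≤ c * 2^32 ∧ X = s + 2^64 * pk 128 x
theorem Rep.add {c c' x y X Y} (h : Rep c x X) (h' : Rep c' y Y) : Rep (c+c') (fun i => x i + y i) (X+Y) := by
  obtain ⟨hb, s, hs, e⟩ := h
  obtain ⟨hb', s', hs', e'⟩ := h'
  refine ⟨fun i => add_le_add (hb i) (hb' i), s+s', by rw [add_mul]; omega, ?_⟩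
  rw [pk_add, e, e']; ring
theorem Rep.mul {c x X} (k : ℕ) (h : Rep c x X) : Rep (k*c) (fun i => k * x i) (k*X) := by
  obtain ⟨hb, s, hs, e⟩ := h
  refine ⟨fun i => Nat.mul_le_mul_left _ (hb i), k*s, by rw [mul_assoc]; exact Nat.mul_le_mul_left _ hs, ?_⟩
  rw [pk_mul, e]; ring
theorem Rep.mono {c c' x X} (h : Rep c x X) (hc : c ≤ c') : Rep c' x X := by
  obtain ⟨hb, s, hs, e⟩ := h
  exact ⟨fun i => (hb i).trans hc, s, hs.trans (Nat.mul_le_mul_right _ hc), e⟩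
theorem Rep.shift {c x X} (h : Rep c x X) (hc : c < 2^32) : X / 2^64 = pk 128 x := by
  obtain ⟨hb, s, hs, e⟩ := h
  rw [e, Nat.add_mul_div_left _ _ (by norm_num), Nat.div_eq_of_lt, zero_add]
  have : c * 2^32 < 2^32 * 2^32 := Nat.mul_lt_mul_of_pos_right hc (by norm_num)
  calc s ≤ _ := hs
    _ < _ := this
    _ = 2^64 := by norm_num
theorem Rep.get {c x X} (h : Rep c x X) (hc : c < 2^32) (i : ℕ) (hi : i < 128) :
    X / 2^(64+32*i) % 2^32 = x i := by
  rw [pow_add, ← Nat.div_div_eq_div_mul, h.shift hc, pk_get _ _ _ (fun i => (h.bd i).trans_lt hc) hi]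
theorem Rep.inj {c c' x y X Y} (h : Rep c x X) (h' : Rep c' y Y) (hc : c < 2^32) (hc' : c' < 2^32)
    (e : X / 2^64 = Y / 2^64) (i : ℕ) (hi : i < 128) : x i = y i := by
  rw [← h.get hc i hi, ← h'.get hc' i hi, pow_add, ← Nat.div_div_eq_div_mul, e, Nat.div_div_eq_div_mul]
theorem Rep.zero (c : ℕ) : Rep c (fun _ => 0) 0 := by
  refine ⟨fun i => Nat.zero_le _, 0, Nat.zero_le _, ?_⟩
  have := pk_mul 128 0 (fun _ => 0)
  simp at this; simp [this]
theorem pk_single (n i : ℕ) (hi : i < n) : pk n (fun j => if j = i then 1 else 0) = 2^(32*i) := by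
  induction n generalizing i with
  | zero => omega
  | succ n ih =>
    cases i with
    | zero =>
      simp [pk]
      have := pk_mul n 0 (fun _ => 0)
      simp at this; simp [this]
    | succ i =>
      simp only [pk]
      have := ih i (by omega)
      simp only [add_left_inj] at this ⊢
      rw [this, if_neg (by omega), mul_add, pow_add]; ring
theorem Rep.unit (i : ℕ) (hi : i < 128) : Rep 6 (fun j => if j = i then 1 else 0) (unit i) := by
  refine ⟨fun j => by split_ifs <;> omega, 1234577 * (i+1), by omega, ?_⟩
  have : PD.unit i = (1 <<< (64 + 32 * i)) + 1234577 * (i+1) := rfl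
  rw [this, pk_single _ _ hi, Nat.shiftLeft_eq, one_mul, pow_add, add_comm]
theorem fold_def (X : ℕ) : fold X =
    (((X - 7 * (((X * 37450) >>> 18) &&& MSK)) >>> 64) <<< 64) + (X - 7 * (((X * 37450) >>> 18) &&& MSK)) % 4294967291 := by
  unfold fold
  rw [frc_eq, frc_eq]; rfl
theorem Rep.fold {c x X} (h : Rep c x X) (hc : c ≤ 8191) : Rep 6 (fun i => x i % 7) (fold X) := by
  have hb := fun i => (h.bd i).trans hc
  have hsh := h.shift (by omega)
  obtain ⟨_, s, hs, e⟩ := h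
  have hs' : s ≤ 8191 * 2^32 := hs.trans (Nat.mul_le_mul_right _ hc)
  have key : ((X * 37450) >>> 18) &&& MSK = 2^64 * pk 128 (fun i => x i / 7) := by
    rw [← pk_land 128 x hb, MSK_eq, Nat.shiftRight_eq_div_pow]
    set A := pk 128 (fun _ => 16383)
    set P := pk 128 x
    have e1 := Nat.mod_add_div ((X * 37450 / 2^18) &&& (2^64 * A)) (2^64)
    rw [Nat.and_mod_two_pow, Nat.and_div_two_pow, Nat.mul_mod_right, Nat.and_zero, zero_add,
      Nat.mul_div_cancel_left _ (by norm_num)] at e1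
    rw [← e1]
    have e2 : X * 37450 / 2^18 / 2^64 = 37450 * P / 2^18 := by
      rw [e]; clear_value P; omega
    rw [e2]
  rw [fold_def, key]
  have h7 : pk 128 x = 7 * pk 128 (fun i => x i / 7) + pk 128 (fun i => x i % 7) := by
    rw [← pk_mul, ← pk_add]; congr 1; funext i; omega
  have hW : X - 7 * (2^64 * pk 128 (fun i => x i / 7)) = s + 2^64 * pk 128 (fun i => x i % 7) := by
    rw [e, h7]; omega
  rw [hW]
  refine ⟨fun i => by omega, (s + 2^64 * pk 128 (fun i => x i % 7)) % 4294967291, ?_, ?_⟩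
  · have := Nat.mod_lt (s + 2^64 * pk 128 (fun i => x i % 7)) (show 0 < 4294967291 by norm_num)
    omega
  · rw [Nat.shiftLeft_eq, Nat.shiftRight_eq_div_pow]
    have : (s + 2^64 * pk 128 (fun i => x i % 7)) / 2^64 = pk 128 (fun i => x i % 7) := by omega
    rw [this]; ring
/-! denotation -/
section
variable {V V' : Type*} [AddCommMonoid V] [AddCommMonoid V']
def den : List V → (ℕ → ℕ) → V
  | [], _ => 0
  | v :: vs, x => x 0 • v + den vs (fun i => x (i+1))
theorem den_add (vs : List V) (x y : ℕ → ℕ) : den vs (fun i => x i + y i) = den vs x + den vs y := by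
  induction vs generalizing x y with
  | nil => simp [den]
  | cons v vs ih => simp only [den]; rw [ih, add_smul]; abel
theorem den_mul (vs : List V) (k : ℕ) (x : ℕ → ℕ) : den vs (fun i => k * x i) = k • den vs x := by
  induction vs generalizing x with
  | nil => simp [den]
  | cons v vs ih => simp only [den]; rw [ih, smul_add, mul_smul]
theorem den_mod (h7 : ∀ v : V, 7 • v = 0) (vs : List V) (x : ℕ → ℕ) : den vs (fun i => x i % 7) = den vs x := by
  have : x = fun i => 7 * (x i / 7) + x i % 7 := by funext i; omega
  conv_rhs => rw [this]
  rw [den_add, den_mul, h7, zero_add]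
theorem den_congr (vs : List V) (x y : ℕ → ℕ) (h : ∀ i < vs.length, x i = y i) : den vs x = den vs y := by
  induction vs generalizing x y with
  | nil => rfl
  | cons v vs ih =>
    simp only [den]
    rw [h 0 (by simp), ih _ (fun i => y (i+1)) (fun i hi => h _ (by simpa using hi))]
theorem den_single (vs : List V) (i : ℕ) (x : ℕ → ℕ) (hx : x = fun j => if j = i then 1 else 0) :
    den vs x = vs.getD i 0 := by
  subst hx
  induction vs generalizing i with
  | nil => simp [den]
  | cons v vs ih =>
    cases i with
    | zero =>
      simp only [den]
      have := den_mul vs 0 (fun _ => 0)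
      simp at this; simp [this]
    | succ i =>
      simp only [den, add_left_inj]
      rw [ih]; simp
theorem den_mem (vs : List V) (x : ℕ → ℕ) : den vs x ∈ AddSubmonoid.closure {v | v ∈ vs} := by
  induction vs generalizing x with
  | nil => simp [den]
  | cons v vs ih =>
    simp only [den]
    refine add_mem (AddSubmonoid.nsmul_mem _ (AddSubmonoid.subset_closure (by simp)) _) ?_
    exact AddSubmonoid.closure_mono (fun w hw => by simp at hw ⊢; exact Or.inr hw) (ih _)
/-- `X` denotes `v` -/
def Dn (c : ℕ) (vs : List V) (X : ℕ) (v : V) : Prop := ∃ x, Rep c x X ∧ den vs x = v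
theorem Dn.add {c c' : ℕ} {vs : List V} {X Y : ℕ} {v w : V} (h : Dn c vs X v) (h' : Dn c' vs Y w) :
    Dn (c+c') vs (X+Y) (v+w) := by
  obtain ⟨x, hx, rfl⟩ := h
  obtain ⟨y, hy, rfl⟩ := h'
  exact ⟨_, hx.add hy, den_add _ _ _⟩
theorem Dn.mul {c : ℕ} {vs : List V} {X : ℕ} {v : V} (k : ℕ) (h : Dn c vs X v) : Dn (k*c) vs (k*X) (k • v) := by
  obtain ⟨x, hx, rfl⟩ := h
  exact ⟨_, hx.mul k, den_mul _ _ _⟩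
theorem Dn.mono {c c' : ℕ} {vs : List V} {X : ℕ} {v : V} (h : Dn c vs X v) (hc : c ≤ c') : Dn c' vs X v := by
  obtain ⟨x, hx, rfl⟩ := h
  exact ⟨_, hx.mono hc, rfl⟩
theorem Dn.fold (h7 : ∀ v : V, 7 • v = 0) {c : ℕ} {vs : List V} {X : ℕ} {v : V} (h : Dn c vs X v) (hc : c ≤ 8191) :
    Dn 6 vs (fold X) v := by
  obtain ⟨x, hx, rfl⟩ := h
  exact ⟨_, hx.fold hc, den_mod h7 _ _⟩
theorem Dn.zero (c : ℕ) (vs : List V) : Dn c vs 0 0 := by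
  refine ⟨_, Rep.zero c, ?_⟩
  have := den_mul vs 0 (fun _ => 0)
  simpa using this
theorem Dn.unit (vs : List V) (i : ℕ) (hi : i < 128) : Dn 6 vs (unit i) (vs.getD i 0) :=
  ⟨_, Rep.unit i hi, den_single _ _ _ rfl⟩
theorem Dn.mem {c : ℕ} {vs : List V} {X : ℕ} {v : V} (h : Dn c vs X v) : v ∈ AddSubmonoid.closure {v | v ∈ vs} := by
  obtain ⟨x, hx, rfl⟩ := h
  exact den_mem _ _
theorem Dn.inj {c c' : ℕ} {vs : List V} {X Y : ℕ} {v w : V} (h : Dn c vs X v) (h' : Dn c' vs Y w)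
    (hc : c < 2^32) (hc' : c' < 2^32) (hl : vs.length ≤ 128) (e : X / 2^64 = Y / 2^64) : v = w := by
  obtain ⟨x, hx, rfl⟩ := h
  obtain ⟨y, hy, rfl⟩ := h'
  exact den_congr _ _ _ fun i hi => hx.inj hy hc hc' e i (by omega)
theorem mv_cons (r : ℕ) (rows : List ℕ) (X s acc : ℕ) :
    mv (r :: rows) X s acc = mv rows X (s+32) (acc + ((X >>> s) % 4294967296) * r) := by
  have : mv (r :: rows) X s acc = frc (acc + ((X >>> s) % 4294967296) * r) fun acc' => frc (s+32) fun s' =>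
    mv rows X s' acc' := rfl
  rw [this, frc_eq, frc_eq]
theorem Dn.mv_aux (f : V →+ V') {vs : List V} {vs' : List V'} {rows : List ℕ} {X c acc j : ℕ} {a : V'} {x : ℕ → ℕ}
    (hx : Rep 6 x X) (hr : List.Forall₂ (fun v r => Dn 6 vs' r (f v)) vs rows) (ha : Dn c vs' acc a)
    (hj : j + rows.length ≤ 128) :
    Dn (c + 36 * rows.length) vs' (mv rows X (64+32*j) acc) (a + f (den vs (fun i => x (i+j)))) := by
  induction hr generalizing j acc a c with
  | nil =>
    have : PD.mv [] X (64+32*j) acc = acc := rfl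
    rw [this]; simpa [den] using ha
  | @cons v r vs rows h hr ih =>
    rw [mv_cons]
    have e1 : X >>> (64+32*j) % 4294967296 = x j := by
      rw [Nat.shiftRight_eq_div_pow]
      simp only [List.length_cons] at hj
      exact hx.get (by norm_num) j (by omega)
    rw [e1]
    have h2 : Dn (c + 36) vs' (acc + x j * r) (a + x j • f v) := by
      have := (h.mul (x j))
      exact ha.add (this.mono (by have := hx.bd j; omega))
    have h3 := ih (j := j+1) h2 (by simp only [List.length_cons] at hj; omega)
    have e2 : 64 + 32 * j + 32 = 64 + 32 * (j+1) := by ring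
    rw [e2]
    convert h3 using 1
    · simp only [List.length_cons]; ring
    · simp only [den, map_add, map_nsmul, zero_add]
      rw [add_assoc]
      congr 4
      funext i; congr 1; omega
theorem Dn.mv (f : V →+ V') {vs : List V} {vs' : List V'} {rows : List ℕ} {X : ℕ} {v : V}
    (hx : Dn 6 vs X v) (hr : List.Forall₂ (fun v r => Dn 6 vs' r (f v)) vs rows)
    (hj : rows.length ≤ 128) :
    Dn 4608 vs' (mv rows X nQ nZ) (f v) := by
  obtain ⟨x, hx, rfl⟩ := hx
  have := Dn.mv_aux f (j := 0) hx hr (Dn.zero 0 vs') (by simpa using hj)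
  simp only [add_zero, zero_add, mul_zero] at this
  exact this.mono (by omega)
end
end PD
end
section
namespace PD
theorem nbeq {a b : ℕ} (h : a ≠ b) : Nat.beq a b = false := by
  cases hh : Nat.beq a b
  · rfl
  · exact absurd (Nat.eq_of_beq_eq_true hh) h
theorem cond_some {α : Type*} {b : Bool} {o : Option α} {x : α} (h : cond b o none = some x) : b = true ∧ o = some x := by
  cases b
  · simp at h
  · exact ⟨rfl, h⟩
section
variable {M : Type*} [AddCommGroup M] (ρ : Bool → M →+ M) (eh : LB → M)
def rs : LB → M →+ M
  | [] => AddMonoidHom.id M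
  | l :: w => (rs w).comp (ρ l)
def vl (W : ℕ → ℕ → List LB) (m q : ℕ) : List M := (W m q).map eh
def TInv (W : ℕ → ℕ → List LB) (T : Tab) : Prop :=
  ∀ l m q rows, lookup T l m q = some rows →
    List.Forall₂ (fun v r => Dn 6 (vl eh W (m+1) (inc l q)) r (ρ l v)) (vl eh W m q) rows ∧ rows.length ≤ 128
theorem appW_ok (h7 : ∀ v : M, 7 • v = 0) {W T} (hT : TInv ρ eh W T) (w : LB) (m q X : ℕ) (v : M) (r : ℕ × ℕ × ℕ)
    (hX : Dn 6 (vl eh W m q) X v) (h : appW T w m q X = some r) :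
    Dn 6 (vl eh W r.1 r.2.1) r.2.2 (rs ρ w v) := by
  induction w generalizing m q X v with
  | nil =>
    have : appW T [] m q X = some (m, q, X) := rfl
    rw [this] at h
    obtain rfl := Option.some.inj h
    exact hX
  | cons l w ih =>
    have e : appW T (l :: w) m q X = Option.bind (lookup T l m q) fun rows =>
      frc (fold (mv rows X nQ nZ)) fun Y => frc (Nat.succ m) fun m' => frc (inc l q) fun q' =>
        appW T w m' q' Y := rfl
    rw [e, Option.bind_eq_some_iff] at h
    obtain ⟨rows, hl, h⟩ := h
    rw [frc_eq, frc_eq, frc_eq] at h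
    obtain ⟨h1, h2⟩ := hT _ _ _ _ hl
    exact ih _ _ _ (ρ l v) ((hX.mv (ρ l) h1 h2).fold h7 (by norm_num)) h
/-- multiset of words encoded by the key -/
def ms : List LB → ℕ → Multiset LB
  | [], _ => 0
  | w :: ws, k => Multiset.replicate (k % 8) w + ms ws (k / 8)
theorem ms_sub (ps : List LB) (w : LB) (ws : List LB) (k : ℕ)
    (h : k / 8^ps.length % 8 ≠ 0) : ms (ps ++ w :: ws) k = w ::ₘ ms (ps ++ w :: ws) (k - 8^ps.length) := by
  induction ps generalizing k with
  | nil =>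
    simp only [List.length_nil, pow_zero, Nat.div_one, List.nil_append, ms] at h ⊢
    have h1 : k % 8 = (k-1) % 8 + 1 := by omega
    have h2 : k / 8 = (k-1) / 8 := by omega
    rw [h1, h2, Multiset.replicate_succ, Multiset.cons_add]
  | cons p ps ih =>
    simp only [List.length_cons, List.cons_append, ms] at h ⊢
    have e : 8^(ps.length+1) = 8 * 8^ps.length := by ring
    rw [e, ← Nat.div_div_eq_div_mul] at h
    have h3 : 8^ps.length ≤ k / 8 := by
      by_contra hh
      rw [Nat.div_eq_of_lt (by omega)] at h
      simp at h
    have h1 : (k - 8^(ps.length+1)) % 8 = k % 8 := by omega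
    have h2 : (k - 8^(ps.length+1)) / 8 = k / 8 - 8^ps.length := by omega
    rw [h1, h2, ih _ h, Multiset.add_cons]
def Gs : ℕ → Multiset LB → M →+ M
  | 0, _ => AddMonoidHom.id M
  | n+1, s => (s.map fun w => (Gs n (s.erase w)).comp (rs ρ w)).sum
theorem Gs_succ (n : ℕ) (s : Multiset LB) (v : M) :
    Gs ρ (n+1) s v = (s.map fun w => Gs ρ n (s.erase w) (rs ρ w v)).sum := by
  simp only [Gs]
  have := map_multiset_sum (AddMonoidHom.eval v) (s.map fun w => (Gs ρ n (s.erase w)).comp (rs ρ w))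
  rw [Multiset.map_map] at this
  exact this
variable (W : ℕ → ℕ → List LB) (T : Tab) (ws : List LB)
def SOK (s : Sta) (v : M) : Prop := Dn 6 (vl eh W s.m s.q) s.X v
inductive LOK (n : ℕ) : List Sta → M → Prop
  | nil : LOK n [] 0
  | cons {s v S t} : SOK eh W s v → LOK n S t → LOK n (s :: S) (Gs ρ n (ms ws s.k) v + t)
theorem ins_ok (h7 : ∀ v : M, 7 • v = 0) (n : ℕ) (s : Sta) (v : M) (S : List Sta) (t : M) (hs : SOK eh W s v)
    (hS : LOK ρ eh W ws n S t) :
    ∃ S', (∀ {α : Type} (k : List Sta → α), ins s S k = k S') ∧ LOK ρ eh W ws n S' (Gs ρ n (ms ws s.k) v + t) := by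
  induction hS with
  | nil => exact ⟨[s], fun k => rfl, LOK.cons hs LOK.nil⟩
  | @cons s' v' S t' hs' hS ih =>
    obtain ⟨S', h1, h2⟩ := ih
    have e : ∀ {α : Type} (k : List Sta → α), ins s (s' :: S) k =
      cond (Nat.beq s.k s'.k) (cond (Nat.beq s.m s'.m) (cond (Nat.beq s.q s'.q)
      (frc (fold (Nat.add s.X s'.X)) fun Y => k (⟨s.k, s.m, s.q, Y⟩ :: S)) (ins s S fun r' => k (s' :: r')))
        (ins s S fun r' => k (s' :: r'))) (ins s S fun r' => k (s' :: r')) := fun k => rfl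
    have h3 : LOK ρ eh W ws n (s' :: S') (Gs ρ n (ms ws s.k) v + (Gs ρ n (ms ws s'.k) v' + t')) := by
      rw [add_left_comm]
      exact LOK.cons hs' h2
    by_cases hk : s.k = s'.k
    · by_cases hm : s.m = s'.m
      · by_cases hq : s.q = s'.q
        · refine ⟨⟨s.k, s.m, s.q, fold (s.X + s'.X)⟩ :: S, ?_, ?_⟩
          · intro α k
            rw [e, hk, hm, hq, Nat.beq_refl, Nat.beq_refl, Nat.beq_refl]
            simp only [cond_true, frc_eq]; rfl
          · have hD : Dn 6 (vl eh W s.m s.q) (fold (s.X + s'.X)) (v + v') := by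
              have h' := hs'
              unfold SOK at hs h'
              rw [← hm, ← hq] at h'
              exact (hs.add h').fold h7 (by norm_num)
            rw [← add_assoc, ← hk, ← map_add]
            exact LOK.cons (s := ⟨s.k, s.m, s.q, fold (s.X + s'.X)⟩) hD hS
        · refine ⟨s' :: S', fun k => ?_, h3⟩
          have : Nat.beq s.q s'.q = false := nbeq hq
          rw [e, this, hk, hm, Nat.beq_refl, Nat.beq_refl]
          simp only [cond_true, cond_false]; exact h1 _
      · refine ⟨s' :: S', fun k => ?_, h3⟩
        have : Nat.beq s.m s'.m = false := nbeq hm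
        rw [e, this, hk, Nat.beq_refl]
        simp only [cond_true, cond_false]; exact h1 _
    · refine ⟨s' :: S', fun k => ?_, h3⟩
      have : Nat.beq s.k s'.k = false := nbeq hk
      rw [e, this]
      simp only [cond_false]; exact h1 _
theorem expd_ok (h7 : ∀ v : M, 7 • v = 0) (hT : TInv ρ eh W T) (n : ℕ) (s : Sta) (v : M) (hs : SOK eh W s v)
    (ps ws' : List LB) (hps : ws = ps ++ ws') (acc acc' : List Sta) (t : M)
    (hacc : LOK ρ eh W ws n acc t) (h : expd T s ws' (s.k / 8^ps.length) (8^ps.length) acc = some acc') :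
    LOK ρ eh W ws n acc' (t + ((ms ws' (s.k / 8^ps.length)).map
      fun w => Gs ρ n ((ms ws s.k).erase w) (rs ρ w v)).sum) := by
  induction ws' generalizing ps acc t with
  | nil =>
    have : expd T s [] (s.k / 8^ps.length) (8^ps.length) acc = some acc := rfl
    rw [this] at h
    obtain rfl := Option.some.inj h
    simpa [ms] using hacc
  | cons w ws' ih =>
    set kk := s.k / 8^ps.length with hkk
    have e : expd T s (w :: ws') kk (8^ps.length) acc = frc (kk % 8) fun dg =>
      frc (kk / 8) fun kk' => frc (8^ps.length * 8) fun pw' =>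
      cond (Nat.beq dg nZ) (expd T s ws' kk' pw' acc)
        (frc (fold (dg * s.X)) fun X => Option.bind (appW T w s.m s.q X) fun r =>
          frc (s.k - 8^ps.length) fun sk => ins ⟨sk, r.1, r.2.1, r.2.2⟩ acc fun acc' => expd T s ws' kk' pw' acc') := rfl
    rw [e] at h
    simp only [frc_eq] at h
    have e1 : kk / 8 = s.k / 8^(ps ++ [w]).length := by
      rw [hkk, Nat.div_div_eq_div_mul, List.length_append, List.length_singleton, pow_succ]
    have e2 : 8^ps.length * 8 = 8^(ps ++ [w]).length := by
      rw [List.length_append, List.length_singleton, pow_succ]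
    have hps' : ws = (ps ++ [w]) ++ ws' := by simp [hps]
    by_cases hd : kk % 8 = 0
    · rw [hd] at h
      simp only [Nat.beq_refl, cond_true] at h
      rw [e1, e2] at h
      have := ih (ps ++ [w]) hps' acc t hacc h
      simp only [ms, hd, Multiset.replicate_zero, zero_add]
      rw [e1]; exact this
    · have hb : Nat.beq (kk % 8) nZ = false := nbeq hd
      rw [hb] at h
      simp only [cond_false] at h
      rw [Option.bind_eq_some_iff] at h
      obtain ⟨r, hr, h⟩ := h
      have hX : Dn 6 (vl eh W s.m s.q) (fold (kk % 8 * s.X)) ((kk % 8) • v) := by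
        refine ((Dn.mul (kk % 8) hs)).fold h7 (by omega)
      have hr' := appW_ok ρ eh h7 hT w _ _ _ _ r hX hr
      obtain ⟨S', h1, h2⟩ := ins_ok ρ eh W ws h7 n ⟨s.k - 8^ps.length, r.1, r.2.1, r.2.2⟩ _ acc t hr' hacc
      rw [h1, e1, e2] at h
      have := ih (ps ++ [w]) hps' S' _ h2 h
      rw [← e1] at this
      convert this using 1
      simp only [ms, Multiset.map_add, Multiset.sum_add, Multiset.map_replicate, Multiset.sum_replicate]
      have e3 : ms ws (s.k - 8^ps.length) = (ms ws s.k).erase w := by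
        rw [hps, ms_sub ps w ws' s.k hd, Multiset.erase_cons_head]
      rw [e3, map_nsmul, map_nsmul]
      abel
theorem stepS_ok (h7 : ∀ v : M, 7 • v = 0) (hT : TInv ρ eh W T) (n : ℕ) (S acc S' : List Sta) (t0 t : M)
    (hS : LOK ρ eh W ws (n+1) S t0) (hacc : LOK ρ eh W ws n acc t) (h : stepS T ws S acc = some S') :
    LOK ρ eh W ws n S' (t + t0) := by
  induction hS generalizing acc t with
  | nil =>
    have : stepS T ws [] acc = some acc := rfl
    rw [this] at h
    obtain rfl := Option.some.inj h
    simpa using hacc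
  | @cons s v S t1 hs hS ih =>
    have e : stepS T ws (s :: S) acc = Option.bind (expd T s ws s.k nU acc) fun acc' => stepS T ws S acc' := rfl
    rw [e, Option.bind_eq_some_iff] at h
    obtain ⟨acc', h1, h⟩ := h
    have h2 := expd_ok ρ eh W T ws h7 hT n s v hs [] ws rfl acc acc' t hacc (by simpa using h1)
    have := ih acc' _ h2 h
    convert this using 1
    rw [Gs_succ, add_assoc]
    simp
theorem finS_ok (m q X : ℕ) (S : List Sta) (t : M) (hS : LOK ρ eh W ws 0 S t) (h : finS m q S = some X) :
    Dn 6 (vl eh W m q) X t := by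
  cases hS with
  | nil => exact absurd h (by simp [finS])
  | @cons s v S t hs hS =>
    cases hS with
    | cons _ _ => exact absurd h (by simp [finS])
    | nil =>
      have e : finS m q [s] = cond (Nat.beq s.m m) (cond (Nat.beq s.q q) (some s.X) none) none := rfl
      rw [e] at h
      by_cases hm : s.m = m
      · by_cases hq : s.q = q
        · subst hm hq
          simp only [Nat.beq_refl, cond_true] at h
          obtain rfl := Option.some.inj h
          simp only [Gs, add_zero]; exact hs
        · have : Nat.beq s.q q = false := nbeq hq
          rw [this] at h; cases hh : Nat.beq s.m m <;> simp [hh] at h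
      · have : Nat.beq s.m m = false := nbeq hm
        rw [this] at h; simp at h
theorem relRow_ok (h7 : ∀ v : M, 7 • v = 0) (hT : TInv ρ eh W T) (key m q m0 q0 i X : ℕ)
    (h : relRow T ws key m q m0 q0 i = some X) :
    Dn 6 (vl eh W m q) X (Gs ρ 5 (ms ws key) ((vl eh W m0 q0).getD i 0)) := by
  unfold relRow at h
  cases hi : Nat.ble i (nat_lit 127)
  · rw [hi] at h; simp at h
  rw [hi] at h
  simp only [cond_true, frc_eq, Option.bind_eq_some_iff] at h
  obtain ⟨s1, h1, s2, h2, s3, h3, s4, h4, s5, h5, h⟩ := h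
  have hi' : i < 128 := by
    have : i ≤ 127 := Nat.le_of_ble_eq_true hi
    omega
  have h0 : LOK ρ eh W ws 5 [⟨key, m0, q0, unit i⟩] (Gs ρ 5 (ms ws key) ((vl eh W m0 q0).getD i 0) + 0) :=
    LOK.cons (s := ⟨key, m0, q0, unit i⟩) (Dn.unit _ i hi') LOK.nil
  have g1 := stepS_ok ρ eh W T ws h7 hT 4 _ _ _ _ _ h0 LOK.nil h1
  have g2 := stepS_ok ρ eh W T ws h7 hT 3 _ _ _ _ _ g1 LOK.nil h2
  have g3 := stepS_ok ρ eh W T ws h7 hT 2 _ _ _ _ _ g2 LOK.nil h3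
  have g4 := stepS_ok ρ eh W T ws h7 hT 1 _ _ _ _ _ g3 LOK.nil h4
  have g5 := stepS_ok ρ eh W T ws h7 hT 0 _ _ _ _ _ g4 LOK.nil h5
  have := finS_ok ρ eh W ws m q X s5 _ g5 h
  simpa using this
end
end PD
end
section
namespace PD
section
variable {M : Type*} [AddCommGroup M] (ρ : Bool → M →+ M) (eh : LB → M)
theorem rs_append (u w : LB) (v : M) : rs ρ (u ++ w) v = rs ρ w (rs ρ u v) := by
  induction u generalizing v with
  | nil => rfl
  | cons l u ih => exact ih (ρ l v)
theorem Gs_perm (n : ℕ) (a : Fin n → LB) (v : M) :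
    Gs ρ n (↑(List.ofFn a)) v = ∑ e : Sy n, rs ρ (List.ofFn (a ∘ e)).flatten v := by
  induction n generalizing v with
  | zero => simp [Gs, rs]
  | succ n ih =>
    rw [Gs_succ, ← Equiv.sum_comp (Equiv.Perm.decomposeFin (n := n)).symm, Fintype.sum_prod_type]
    have h1 : ∀ f : LB → M, ((↑(List.ofFn a) : Multiset LB).map f).sum = ∑ i, f (a i) := by
      intro f
      rw [Multiset.map_coe, Multiset.sum_coe, List.map_ofFn, List.sum_ofFn]; rfl
    rw [h1]
    refine Finset.sum_congr rfl fun p _ => ?_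
    have h2 : (↑(List.ofFn a) : Multiset LB) = a p ::ₘ ↑(List.ofFn (fun i : Fin n => a (Equiv.swap 0 p i.succ))) := by
      have : (↑(List.ofFn a) : Multiset LB) = ↑(List.ofFn (a ∘ Equiv.swap 0 p)) :=
        (Multiset.coe_eq_coe.2 (Equiv.Perm.ofFn_comp_perm _ a)).symm
      rw [this, List.ofFn_succ, ← Multiset.cons_coe]
      simp
    rw [h2, Multiset.erase_cons_head, ih]
    refine Finset.sum_congr rfl fun e _ => ?_
    rw [← rs_append]
    congr 2
    rw [List.ofFn_succ, List.flatten_cons]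
    simp only [Function.comp_apply, Equiv.Perm.decomposeFin_symm_apply_zero, Equiv.Perm.decomposeFin_symm_apply_succ]
    rfl
def HRel : Prop := ∀ (u : LB) (a : Fin 5 → LB), (∀ i, a i ≠ []) →
  ∑ e : Sy 5, rs ρ (List.ofFn (a ∘ e)).flatten (eh u) = 0
theorem digs_eq (ws : List LB) (k : ℕ) : digs ws k = (ms ws k).card := by
  induction ws generalizing k with
  | nil => rfl
  | cons w ws ih =>
    have : digs (w :: ws) k = k % 8 + digs ws (k / 8) := rfl
    rw [this, ih, ms]; simp
theorem mem_ms (ws : List LB) (k : ℕ) (w : LB) (h : w ∈ ms ws k) : w ∈ ws := by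
  induction ws generalizing k with
  | nil => simp [ms] at h
  | cons w' ws ih =>
    rw [ms, Multiset.mem_add] at h
    rcases h with h | h
    · simp [Multiset.eq_of_mem_replicate h]
    · simp [ih _ h]
theorem allNE_ok (ws : List LB) (h : allNE ws = true) : ∀ w ∈ ws, w ≠ [] := by
  induction ws with
  | nil => simp
  | cons w ws ih =>
    cases w with
    | nil => exact absurd h (by simp [allNE])
    | cons l w =>
      have : allNE ((l :: w) :: ws) = allNE ws := rfl
      rw [this] at h
      simpa using ih h
variable {ρ eh}
theorem Gs_zero (hrel : HRel ρ eh) (ws : List LB) (key : ℕ) (h5 : digs ws key = 5) (hne : allNE ws = true)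
    (vs : List LB) (i : ℕ) : Gs ρ 5 (ms ws key) ((vs.map eh).getD i 0) = 0 := by
  rcases lt_or_ge i vs.length with hi | hi
  · have e1 : (vs.map eh).getD i 0 = eh vs[i] := by simp [hi]
    rw [e1]
    obtain ⟨l, hl⟩ := Quotient.exists_rep (ms ws key)
    have hl' : (↑l : Multiset LB) = ms ws key := hl
    have hlen : l.length = 5 := by
      rw [digs_eq, ← hl'] at h5; simpa using h5
    have h2 : l = List.ofFn (fun i : Fin 5 => l[i.1]'(by omega)) := by
      apply List.ext_getElem
      · simp [hlen]
      · intro i h1 h2; rw [List.getElem_ofFn]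
    rw [← hl', h2, Gs_perm]
    apply hrel
    intro i
    apply allNE_ok ws hne
    apply mem_ms ws key
    rw [← hl']
    simp
  · have e1 : (vs.map eh).getD i 0 = 0 := by simp [hi]
    rw [e1, map_zero]
end
section
variable {V : Type*} [AddCommGroup V]
def PInv (vs : List V) (P : Piv) : Prop := ∀ p ∈ P, Dn 6 vs p.2 0
theorem reduce_ok (h7 : ∀ v : V, 7 • v = 0) (vs : List V) (P : Piv) (hP : PInv vs P) (X : ℕ) (v : V) (h : Dn 6 vs X v) :
    Dn 6 vs (reduce P X) v := by
  induction P generalizing X with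
  | nil => exact h
  | cons p P ih =>
    have hP' : PInv vs P := fun q hq => hP q (by simp [hq])
    have e : reduce (p :: P) X = frc (Nat.mod (Nat.shiftRight X p.1) (nat_lit 4294967296)) fun c =>
      cond (Nat.beq c nZ) (reduce P X)
        (frc (fold (X + (7 - c) * p.2)) fun Y => reduce P Y) := rfl
    rw [e, frc_eq, frc_eq]
    generalize Nat.mod (Nat.shiftRight X p.1) (nat_lit 4294967296) = c
    cases Nat.beq c nZ
    · simp only [cond_false]
      apply ih hP'
      have h1 := h.add ((hP p (by simp)).mul (7 - c))
      rw [smul_zero, add_zero] at h1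
      exact h1.fold h7 (by have : 7 - c ≤ 7 := Nat.sub_le _ _; omega)
    · exact ih hP' _ h
theorem mem_snoc {α : Type} (l : List α) (a b : α) (h : b ∈ snoc l a) : b ∈ l ∨ b = a := by
  induction l with
  | nil =>
    have : snoc [] a = [a] := rfl
    rw [this] at h; right; simpa using h
  | cons c l ih =>
    have : snoc (c :: l) a = c :: snoc l a := rfl
    rw [this] at h
    rcases List.mem_cons.1 h with h | h
    · simp [h]
    · rcases ih h with h | h <;> simp [h]
theorem addP_ok (h7 : ∀ v : V, 7 • v = 0) (vs : List V) (P : Piv) (hP : PInv vs P) (X : ℕ) (h : Dn 6 vs X 0) :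
    PInv vs (addP P X) := by
  have hR := reduce_ok h7 vs P hP X 0 h
  unfold addP
  rw [frc_eq, frc_eq, frc_eq, frc_eq]
  generalize reduce P X = R at *
  cases Nat.beq (Nat.shiftRight R nQ) nZ
  · simp only [cond_false]
    intro p hp
    rcases mem_snoc _ _ _ hp with hp | hp
    · exact hP p hp
    · subst hp
      set c := Nat.mod (Nat.pow (Nat.shiftRight R (Nat.mul nR (Nat.div (Nat.log2 R) nR))) (nat_lit 5)) nS with hc
      have hc7 : c < 7 := Nat.mod_lt _ (by norm_num)
      have h1 := hR.mul c
      rw [smul_zero] at h1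
      exact h1.fold h7 (by omega)
  · exact hP
theorem frcP_eq {α : Type} (l : Piv) (k : Piv → α) : frcP l k = k l := by
  induction l generalizing k with
  | nil => rfl
  | cons a t ih =>
    have : frcP (a :: t) k = frc a.1 fun a1 => frc a.2 fun a2 => frcP t fun t => k ((a1, a2) :: t) := rfl
    rw [this, frc_eq, frc_eq, ih]
theorem frcB_eq {α : Type} (b : Bool) (k : Bool → α) : frcB b k = k b := by cases b <;> rfl
theorem frcW_eq {α : Type} (l : LB) (k : LB → α) : frcW l k = k l := by
  induction l generalizing k with
  | nil => rfl
  | cons a t ih =>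
    have : frcW (a :: t) k = frcB a fun a => frcW t fun t => k (a :: t) := rfl
    rw [this, frcB_eq, ih]
theorem frcWs_eq {α : Type} (l : List LB) (k : List LB → α) : frcWs l k = k l := by
  induction l generalizing k with
  | nil => rfl
  | cons a t ih =>
    have : frcWs (a :: t) k = frcW a fun a => frcWs t fun t => k (a :: t) := rfl
    rw [this, frcW_eq, ih]
theorem frcLL_eq {α : Type} (l : List (List ℕ)) (k : List (List ℕ) → α) : frcLL l k = k l := by
  induction l generalizing k with
  | nil => rfl
  | cons a t ih =>
    have : frcLL (a :: t) k = frcL a fun a => frcLL t fun t => k (a :: t) := rfl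
    rw [this, frcL_eq, ih]
theorem frcWW_eq {α : Type} (l : List (List LB)) (k : List (List LB) → α) : frcWW l k = k l := by
  induction l generalizing k with
  | nil => rfl
  | cons a t ih =>
    have : frcWW (a :: t) k = frcWs a fun a => frcWW t fun t => k (a :: t) := rfl
    rw [this, frcWs_eq, ih]
theorem snocF_eq {α β : Type} (l : List α) (a : α) (k : List α → β) : snocF l a k = k (l ++ [a]) := by
  induction l generalizing k with
  | nil => rfl
  | cons b t ih =>
    have : snocF (b :: t) a k = snocF t a fun t => k (b :: t) := rfl
    rw [this, ih]; rfl
theorem decs_eq {α : Type} (l : List ℕ) (k : List LB → α) :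
    decs l k = k (l.map fun a => decw nW a []) := by
  induction l generalizing k with
  | nil => rfl
  | cons a t ih =>
    have : decs (a :: t) k = frcW (decw nW a []) fun a => decs t fun t => k (a :: t) := rfl
    rw [this, frcW_eq, ih]; rfl
theorem dcds_eq {α : Type} (l : List ℕ) (k : List LB → α) :
    dcds l k = k (l.map fun a => dcd nW a) := by
  induction l generalizing k with
  | nil => rfl
  | cons a t ih =>
    have : dcds (a :: t) k = frcW (dcd nW a) fun a => dcds t fun t => k (a :: t) := rfl
    rw [this, frcW_eq, ih]; rfl
end
section
variable {M : Type*} [AddCommGroup M] {ρ : Bool → M →+ M} {eh : LB → M}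
variable {W : ℕ → ℕ → List LB} {T : Tab}
theorem addIdx_ok (h7 : ∀ v : M, 7 • v = 0) (hrel : HRel ρ eh) (hT : TInv ρ eh W T) (ws : List LB)
    (key m q m0 q0 : ℕ) (h5 : digs ws key = 5) (hne : allNE ws = true) (is : List ℕ) (P P' : Piv)
    (hP : PInv (vl eh W m q) P) (h : addIdx T ws key m q m0 q0 is P = some P') : PInv (vl eh W m q) P' := by
  induction is generalizing P with
  | nil => obtain rfl := Option.some.inj h; exact hP
  | cons i is ih =>
    have e : addIdx T ws key m q m0 q0 (i :: is) P = Option.bind (relRow T ws key m q m0 q0 i) fun X =>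
      frcP (addP P X) fun P => addIdx T ws key m q m0 q0 is P := rfl
    rw [e, Option.bind_eq_some_iff] at h
    obtain ⟨X, hX, h⟩ := h
    rw [frcP_eq] at h
    have h1 := relRow_ok ρ eh W T ws h7 hT key m q m0 q0 i X hX
    unfold vl at h1
    rw [Gs_zero hrel ws key h5 hne] at h1
    exact ih _ (addP_ok h7 _ P hP X h1) h
theorem addG_ok (h7 : ∀ v : M, 7 • v = 0) (hrel : HRel ρ eh) (hT : TInv ρ eh W T)
    (m q : ℕ) (g : RelG) (P P' : Piv)
    (hP : PInv (vl eh W m q) P) (h : addG T m q g P = some P') : PInv (vl eh W m q) P' := by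
  unfold addG at h
  rw [decs_eq] at h
  obtain ⟨hne, h⟩ := cond_some h
  obtain ⟨h5, h⟩ := cond_some h
  rw [frc_eq, frc_eq] at h
  exact addIdx_ok h7 hrel hT _ _ m q _ _ (Nat.eq_of_beq_eq_true h5) hne _ P P' hP h
theorem addGs_ok (h7 : ∀ v : M, 7 • v = 0) (hrel : HRel ρ eh) (hT : TInv ρ eh W T)
    (m q : ℕ) (gs : List RelG) (P P' : Piv)
    (hP : PInv (vl eh W m q) P) (h : addGs T m q gs P = some P') : PInv (vl eh W m q) P' := by
  induction gs generalizing P with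
  | nil => obtain rfl := Option.some.inj h; exact hP
  | cons g gs ih =>
    have e : addGs T m q (g :: gs) P = Option.bind (addG T m q g P) fun P => addGs T m q gs P := rfl
    rw [e, Option.bind_eq_some_iff] at h
    obtain ⟨P1, h1, h⟩ := h
    exact ih _ (addG_ok h7 hrel hT m q g P P1 hP h1) h
end
end PD
end
section
namespace PD
theorem nth_eq {α : Type} (l : List α) (n : ℕ) : nth l n = l[n]? := by
  induction l generalizing n with
  | nil => rfl
  | cons a l ih =>
    cases n with
    | zero => rfl
    | succ n => exact ih n
theorem llen_eq {α : Type} (l : List α) : llen l = l.length := by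
  induction l with
  | nil => rfl
  | cons a l ih => exact congrArg Nat.succ ih
theorem cmap_eq (l : Bool) (ws r : List LB) : cmap l ws r = ws.map (fun w => l :: w) ++ r := by
  induction ws with
  | nil => rfl
  | cons a t ih => exact congrArg (List.cons (l :: a)) ih
theorem cw_eq (wx wy : List LB) : cw wx wy = wx.map (fun w => false :: w) ++ wy.map (fun w => true :: w) := by
  unfold cw; rw [cmap_eq, cmap_eq, List.append_nil]
theorem rv_eq (l acc : LB) : rv l acc = l.reverse ++ acc := by
  induction l generalizing acc with
  | nil => rfl
  | cons a l ih =>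
    have : rv (a :: l) acc = rv l (a :: acc) := rfl
    rw [this, ih]; simp
theorem units_length {α : Type} (l : List α) (i : ℕ) : (units l i).length = l.length := by
  induction l generalizing i with
  | nil => rfl
  | cons a l ih => exact congrArg Nat.succ (ih _)
section
variable {V : Type*} [AddCommGroup V]
theorem units_ok {α : Type} (l : List α) (g : α → V) (pre post : List V) (h : pre.length + l.length ≤ 128) :
    List.Forall₂ (fun v u => Dn 6 (pre ++ (l.map g ++ post)) u v) (l.map g) (units l pre.length) := by
  induction l generalizing pre with
  | nil => exact List.Forall₂.nil
  | cons a l ih =>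
    have e : units (a :: l) pre.length = unit pre.length :: units l (pre.length+1) := rfl
    rw [e, List.map_cons]
    refine List.Forall₂.cons ?_ ?_
    · have := Dn.unit (pre ++ (g a :: l.map g ++ post)) pre.length (by simp at h; omega)
      simpa using this
    · have := ih (pre ++ [g a]) (by simp at h ⊢; omega)
      simpa using this
theorem keep_f2 (P : Piv) (g : LB → V) (R : V → ℕ → Prop) (ws : List LB) (us : List ℕ)
    (h : List.Forall₂ R (ws.map g) us) : List.Forall₂ R ((keepW P ws us).map g) (keepU P us) := by
  induction ws generalizing us with
  | nil =>
    cases h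
    exact List.Forall₂.nil
  | cons w ws ih =>
    cases us with
    | nil => cases h
    | cons u us =>
      rw [List.map_cons] at h
      cases h with
      | cons h1 h2 =>
        have e1 : keepW P (w :: ws) (u :: us) = cond (isPiv P u) (keepW P ws us) (w :: keepW P ws us) := rfl
        have e2 : keepU P (u :: us) = cond (isPiv P u) (keepU P us) (u :: keepU P us) := rfl
        rw [e1, e2]
        cases isPiv P u
        · exact List.Forall₂.cons h1 (ih us h2)
        · exact ih us h2
theorem keepU_length (P : Piv) (us : List ℕ) : (keepU P us).length ≤ us.length := by
  induction us with
  | nil => exact le_refl _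
  | cons u us ih =>
    have e2 : keepU P (u :: us) = cond (isPiv P u) (keepU P us) (u :: keepU P us) := rfl
    rw [e2]
    cases isPiv P u <;> simp <;> omega
theorem comp_length (P : Piv) (us : List ℕ) (i : ℕ) : (comp P us i).length = us.length := by
  induction us generalizing i with
  | nil => rfl
  | cons u us ih =>
    have e : comp P (u :: us) i = cond (isPiv P u) (0 :: comp P us i) (unit i :: comp P us (i+1)) := rfl
    rw [e]; cases isPiv P u <;> simp [ih]
theorem comp_f2 (P : Piv) (us : List ℕ) (vs : List V) (i : ℕ) (hl : vs.length = us.length) (hi : i + us.length ≤ 128) :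
    List.Forall₂ (fun v r => Dn 6 ([] : List V) r ((0 : V →+ V) v)) vs (comp P us i) := by
  induction us generalizing i vs with
  | nil =>
    have : vs = [] := by simpa using hl
    subst this; exact List.Forall₂.nil
  | cons u us ih =>
    cases vs with
    | nil => simp at hl
    | cons v vs =>
    simp only [List.length_cons] at hi hl
    have e : comp P (u :: us) i = cond (isPiv P u) (0 :: comp P us i) (unit i :: comp P us (i+1)) := rfl
    rw [e]; cases isPiv P u
    · refine List.Forall₂.cons ?_ (ih _ _ (by omega) (by omega))
      have := Dn.unit ([] : List V) i (by omega)
      simpa using this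
    · refine List.Forall₂.cons (Dn.zero _ _) (ih _ _ (by omega) (by omega))
theorem mkRow_ok (h7 : ∀ v : V, 7 • v = 0) (vs kv : List V) (P : Piv) (hP : PInv vs P) (ku cm : List ℕ) (u Y : ℕ) (v : V)
    (hl : vs.length ≤ 128) (hkl : ku.length ≤ 128)
    (hu : Dn 6 vs u v) (hku : List.Forall₂ (fun v u => Dn 6 vs u v) kv ku)
    (hcm : List.Forall₂ (fun v r => Dn 6 ([] : List V) r ((0 : V →+ V) v)) vs cm)
    (h : mkRow P ku cm u = some Y) : Dn 6 kv Y v := by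
  unfold mkRow at h
  rw [frc_eq, frc_eq] at h
  obtain ⟨hb, h⟩ := cond_some h
  obtain rfl := Option.some.inj h
  have hX := reduce_ok h7 vs P hP u v hu
  have hcl : cm.length ≤ 128 := by rw [← hcm.length_eq]; exact hl
  obtain ⟨y, hy, -⟩ := (hX.mv (0 : V →+ V) hcm hcl).fold h7 (by norm_num)
  refine ⟨y, hy, ?_⟩
  have hD : Dn 6 kv _ (den kv y) := ⟨y, hy, rfl⟩
  have h1 := hD.mv (AddMonoidHom.id V) hku hkl
  have e := Nat.eq_of_beq_eq_true hb
  have e2 : ∀ a, Nat.shiftRight a nQ = a / 2^64 := fun a => Nat.shiftRight_eq_div_pow a 64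
  rw [e2, e2] at e
  exact h1.inj hX (by norm_num) (by norm_num) hl e
theorem mkRows_ok (h7 : ∀ v : V, 7 • v = 0) (vs kv : List V) (P : Piv) (hP : PInv vs P) (ku cm : List ℕ)
    (hl : vs.length ≤ 128) (hkl : ku.length ≤ 128)
    (hku : List.Forall₂ (fun v u => Dn 6 vs u v) kv ku)
    (hcm : List.Forall₂ (fun v r => Dn 6 ([] : List V) r ((0 : V →+ V) v)) vs cm)
    (us rows : List ℕ) (vs' : List V) (hus : List.Forall₂ (fun v u => Dn 6 vs u v) vs' us)
    (h : mkRows P ku cm us = some rows) : List.Forall₂ (fun v r => Dn 6 kv r v) vs' rows := by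
  induction hus generalizing rows with
  | nil =>
    obtain rfl := Option.some.inj h
    exact List.Forall₂.nil
  | @cons v u vs' us h1 h2 ih =>
    have e : mkRows P ku cm (u :: us) = Option.bind (mkRow P ku cm u) fun Y =>
      Option.bind (mkRows P ku cm us) fun t => some (Y :: t) := rfl
    rw [e, Option.bind_eq_some_iff] at h
    obtain ⟨Y, hY, h⟩ := h
    rw [Option.bind_eq_some_iff] at h
    obtain ⟨t, ht, h⟩ := h
    obtain rfl := Option.some.inj h
    exact List.Forall₂.cons (mkRow_ok h7 vs kv P hP ku cm u Y v hl hkl h1 hku hcm hY) (ih t ht)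
theorem keep_ok (h7 : ∀ v : V, 7 • v = 0) (g : LB → V) (ws : List LB) (hl : ws.length ≤ 128)
    (P : Piv) (hP : PInv (ws.map g) P) (rows : List ℕ)
    (h : mkRows P (keepU P (units ws 0)) (comp P (units ws 0) 0) (units ws 0) = some rows) :
    List.Forall₂ (fun v r => Dn 6 ((keepW P ws (units ws 0)).map g) r v) (ws.map g) rows := by
  have hu := units_ok ws g [] [] (by simpa using hl)
  simp only [List.nil_append, List.append_nil, List.length_nil] at hu
  have hul := units_length ws 0
  refine mkRows_ok h7 (ws.map g) _ P hP _ _ (by simpa using hl) ?_ (keep_f2 P g _ ws _ hu)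
    (comp_f2 P _ _ 0 (by simp [hul]) (by omega)) _ rows _ hu h
  have := keepU_length P (units ws 0)
  omega
theorem tk_dp {α : Type} (R : V → ℕ → Prop) (l : List α) (vs vs' : List V) (r : List ℕ) (hl : vs.length = l.length)
    (h : List.Forall₂ R (vs ++ vs') r) : List.Forall₂ R vs (tk l r) ∧ List.Forall₂ R vs' (dp l r) := by
  induction l generalizing vs r with
  | nil =>
    have : vs = [] := by simpa using hl
    subst this; exact ⟨List.Forall₂.nil, h⟩
  | cons a l ih =>
    cases vs with
    | nil => simp at hl
    | cons v vs =>
      cases r with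
      | nil => cases h
      | cons b r =>
        cases h with
        | cons h1 h2 =>
          obtain ⟨g1, g2⟩ := ih vs r (by simpa using hl) h2
          exact ⟨List.Forall₂.cons h1 g1, g2⟩
end
section
variable {M : Type*} [AddCommGroup M] {ρ : Bool → M →+ M} {eh : LB → M}
variable {W : ℕ → ℕ → List LB} {T : Tab}
theorem doQ_ok (h7 : ∀ v : M, 7 • v = 0) (hrel : HRel ρ eh) (hT : TInv ρ eh W T)
    (m q : ℕ) (wx wy : List LB) (hx : wx.length ≤ 60) (hy : wy.length ≤ 60) (hW : W m q = cw wx wy)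
    (gs : List RelG) (r) (h : doQ T m q wx wy gs = some r) :
    List.Forall₂ (fun v r' => Dn 6 (r.1.map eh) r' v) (wx.map fun w => eh (false :: w)) r.2.1 ∧
    List.Forall₂ (fun v r' => Dn 6 (r.1.map eh) r' v) (wy.map fun w => eh (true :: w)) r.2.2 := by
  unfold doQ at h
  rw [Option.bind_eq_some_iff] at h
  obtain ⟨P, hP, h⟩ := h
  rw [frcWs_eq, frcL_eq, frcL_eq, frcL_eq, frcWs_eq, Option.bind_eq_some_iff] at h
  obtain ⟨rows, hr, h⟩ := h
  obtain rfl := Option.some.inj h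
  have hP' := addGs_ok h7 hrel hT m q gs [] P (fun p hp => by simp at hp) hP
  have hv : vl eh W m q = (cw wx wy).map eh := by unfold vl; rw [hW]
  rw [hv] at hP'
  have hl : (cw wx wy).length ≤ 128 := by rw [cw_eq]; simp; omega
  have := keep_ok h7 eh (cw wx wy) hl P hP' rows hr
  have e : (cw wx wy).map eh = (wx.map fun w => eh (false :: w)) ++ (wy.map fun w => eh (true :: w)) := by
    rw [cw_eq, List.map_append, List.map_map, List.map_map]; rfl
  rw [e] at this
  exact tk_dp _ wx _ _ rows (by simp) this
def gl (ls : List (List LB)) (q : ℕ) : List LB := (ls[q]?).getD []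
theorem gl_cons_succ (a) (ls) (q) : gl (a :: ls) (q+1) = gl ls q := rfl
theorem doQs_ok (h7 : ∀ v : M, 7 • v = 0) (hrel : HRel ρ eh) (hT : TInv ρ eh W T)
    (m q : ℕ) (ls : List (List LB)) (wy : List LB) (hls : ∀ q, (gl ls q).length ≤ 60)
    (hy : wy.length ≤ 60) (hW : ∀ i, W m (q+i) = cw (gl ls i) (gl (wy :: ls) i))
    (gss : List (List RelG)) (r) (h : doQs T m ls q wy gss = some r) (i : ℕ) :
    (∀ rx, r.2.1[i]? = some rx →
      List.Forall₂ (fun v r' => Dn 6 ((gl r.1 i).map eh) r' v) ((gl ls i).map fun w => eh (false :: w)) rx) ∧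
    (∀ rx, r.2.2[i]? = some rx →
      List.Forall₂ (fun v r' => Dn 6 ((gl r.1 i).map eh) r' v) ((gl (wy :: ls) i).map fun w => eh (true :: w)) rx) := by
  induction ls generalizing q wy gss r i with
  | nil =>
    obtain rfl := Option.some.inj h
    simp
  | cons wx ls ih =>
    cases gss with
    | nil => exact absurd h (by simp [doQs])
    | cons gs gss =>
      have e : doQs T m (wx :: ls) q wy (gs :: gss) = Option.bind (doQ T m q wx wy gs) fun r =>
        Option.bind (doQs T m ls (Nat.succ q) wx gss) fun z => some (r.1 :: z.1, r.2.1 :: z.2.1, r.2.2 :: z.2.2) := rfl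
      rw [e, Option.bind_eq_some_iff] at h
      obtain ⟨r1, hr1, h⟩ := h
      rw [Option.bind_eq_some_iff] at h
      obtain ⟨z, hz, h⟩ := h
      obtain rfl := Option.some.inj h
      have hx : wx.length ≤ 60 := hls 0
      cases i with
      | zero =>
        have h1 := doQ_ok h7 hrel hT m q wx wy hx hy (hW 0) gs r1 hr1
        refine ⟨?_, ?_⟩
        · intro rx hrx
          obtain rfl := Option.some.inj hrx
          exact h1.1
        · intro rx hrx
          obtain rfl := Option.some.inj hrx
          exact h1.2
      | succ i =>
        exact ih (q+1) wx (fun q => hls (q+1)) hx (fun i => by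
          have := hW (i+1)
          rw [gl_cons_succ, gl_cons_succ] at this
          rw [← this]; congr 1; omega) gss z hz i
theorem trivX_get (ls : List (List LB)) (q : ℕ) (r) (h : (trivX ls)[q]? = some r) : r = units (gl ls q) 0 := by
  induction ls generalizing q with
  | nil => simp [trivX] at h
  | cons a ls ih =>
    have e : trivX (a :: ls) = frcL (units a nZ) fun u => u :: trivX ls := rfl
    rw [e, frcL_eq] at h
    cases q with
    | zero => exact (Option.some.inj h).symm
    | succ q => exact ih q h
theorem trivY_get (ls : List (List LB)) (q : ℕ) (r) (h : (trivY ls)[q]? = some r) :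
    r = units (gl ls q) (gl ls (q+1)).length := by
  induction ls generalizing q with
  | nil => simp [trivY] at h
  | cons a ls ih =>
    cases ls with
    | nil => simp [trivY] at h
    | cons b ls =>
    have e : trivY (a :: b :: ls) = frcL (units a (llen b)) fun u => u :: trivY (b :: ls) := rfl
    rw [e, frcL_eq, llen_eq] at h
    cases q with
    | zero => exact (Option.some.inj h).symm
    | succ q => exact ih q h
theorem lenOK_ok (ls : List (List LB)) (h : lenOK ls = true) (q : ℕ) : (gl ls q).length ≤ 60 := by
  induction ls generalizing q with
  | nil => simp [gl]
  | cons a ls ih =>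
    have e : lenOK (a :: ls) = cond (Nat.ble (llen a) nX) (lenOK ls) false := rfl
    rw [e] at h
    cases hb : Nat.ble (llen a) nX
    · rw [hb] at h; simp at h
    · rw [hb] at h
      cases q with
      | zero =>
        have := Nat.le_of_ble_eq_true hb
        rw [llen_eq] at this; exact this
      | succ q => exact ih h q
theorem lookup_snoc (T : Tab) (t) (l : Bool) (m q : ℕ) (r) (h : lookup (T ++ [t]) l m q = some r) :
    (m < T.length ∧ lookup T l m q = some r) ∨ (m = T.length ∧ (cond l t.2 t.1)[q]? = some r) := by
  unfold lookup at h ⊢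
  rw [nth_eq] at h ⊢
  rcases lt_trichotomy m T.length with hm | hm | hm
  · left
    rw [List.getElem?_append_left hm] at h
    exact ⟨hm, h⟩
  · right
    refine ⟨hm, ?_⟩
    rw [hm] at h
    simp only [List.getElem?_concat_length] at h
    have h' : nth (cond l t.2 t.1) q = some r := h
    rw [nth_eq] at h'; exact h'
  · rw [List.getElem?_eq_none (by simp; omega)] at h
    simp at h
def updW (W : ℕ → ℕ → List LB) (m : ℕ) (new : ℕ → List LB) (a q : ℕ) : List LB :=
  if a = m then new q else W a q
theorem updW_self (W : ℕ → ℕ → List LB) (m new q) : updW W m new m q = new q := if_pos rfl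
theorem updW_ne (W : ℕ → ℕ → List LB) (m new a q) (h : a ≠ m) : updW W m new a q = W a q := if_neg h
theorem TInv_snoc (hT : TInv ρ eh W T) (m : ℕ) (hm : T.length = m) (cur : List (List LB))
    (new : ℕ → List LB)
    (hW : ∀ q, W m q = gl cur q) (tx ty : List (List ℕ)) (hcur : ∀ q, (gl cur q).length ≤ 60)
    (h1 : ∀ q r, tx[q]? = some r →
      List.Forall₂ (fun v r' => Dn 6 ((new q).map eh) r' v) ((gl cur q).map fun w => ρ false (eh w)) r)
    (h2 : ∀ q r, ty[q]? = some r →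
      List.Forall₂ (fun v r' => Dn 6 ((new (q+1)).map eh) r' v) ((gl cur q).map fun w => ρ true (eh w)) r) :
    TInv ρ eh (updW W (m+1) new) (T ++ [(tx, ty)]) := by
  intro l a q rows h
  rcases lookup_snoc T _ l a q rows h with ⟨ha, h⟩ | ⟨ha, h⟩
  · have := hT l a q rows h
    unfold vl at this ⊢
    rw [updW_ne _ _ _ _ _ (by omega), updW_ne _ _ _ _ _ (by omega)]
    exact this
  · rw [hm] at ha
    subst ha
    unfold vl
    rw [updW_self, updW_ne _ _ _ _ _ (by omega)]
    have key : List.Forall₂ (fun v r' => Dn 6 ((new (inc l q)).map eh) r' v) ((gl cur q).map fun w => ρ l (eh w)) rows := by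
      cases l
      · exact h1 q rows h
      · exact h2 q rows h
    rw [hW]
    refine ⟨?_, ?_⟩
    · rw [List.forall₂_map_left_iff] at key ⊢
      exact key
    · have h3 := key.length_eq
      rw [List.length_map] at h3
      have := hcur q
      omega
end
end PD
end
section
namespace PD
section
variable {M : Type*} [AddCommGroup M] (ρ : Bool → M →+ M) (eh : LB → M)
def ct (w : LB) : ℕ := w.count true
def Inv (m : ℕ) (T : Tab) (cur : List (List LB)) : Prop :=
  ∃ W, TInv ρ eh W T ∧ T.length = m ∧ (∀ q, W m q = gl cur q) ∧ W 0 0 = [[]] ∧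
    ∀ w : LB, w.length = m → ct w ≤ 7 → eh w ∈ AddSubmonoid.closure {v | v ∈ (gl cur (ct w)).map eh}
variable {ρ eh}
theorem closure_map {A B : Type*} [AddCommGroup A] [AddCommGroup B] (f : A →+ B) (s : Set A) (N : AddSubmonoid B)
    (h : ∀ a ∈ s, f a ∈ N) {x : A} (hx : x ∈ AddSubmonoid.closure s) : f x ∈ N := by
  have : AddSubmonoid.closure s ≤ N.comap f := by
    rw [AddSubmonoid.closure_le]; exact h
  exact this hx
theorem doM_ok (h7 : ∀ v : M, 7 • v = 0) (hrel : HRel ρ eh) (hρ : ∀ l w, eh (l :: w) = ρ l (eh w))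
    (m : ℕ) (T : Tab) (cur : List (List LB)) (hI : Inv ρ eh m T cur) (gss : List (List RelG))
    (k : List (List LB) → Tab → Bool) (h : doM T (m+1) cur gss k = true) :
    ∃ cur' T', Inv ρ eh (m+1) T' cur' ∧ k cur' T' = true := by
  obtain ⟨W, hT, hTl, hW, hW0, hsp⟩ := hI
  unfold doM at h
  cases hlen : lenOK cur
  · rw [hlen] at h; simp at h
  rw [hlen] at h
  simp only [cond_true] at h
  rw [frcLL_eq, frcLL_eq, snocF_eq] at h
  have hcur := lenOK_ok cur hlen
  set cur1 : ℕ → List LB := fun q => cw (gl cur q) (gl ([] :: cur) q) with hcur1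
  have hcur1e : ∀ q, (cur1 q).map eh = ((gl cur q).map fun w => ρ false (eh w)) ++ ((gl ([] :: cur) q).map fun w => ρ true (eh w)) := by
    intro q
    simp only [hcur1]
    rw [cw_eq, List.map_append, List.map_map, List.map_map]
    congr 1 <;> exact List.map_congr_left fun w _ => hρ _ _
  have hT1 : TInv ρ eh (updW W (m+1) cur1) (T ++ [(trivX cur, trivY cur)]) := by
    refine TInv_snoc hT m hTl cur cur1 hW _ _ hcur ?_ ?_
    · intro q r hr
      rw [trivX_get _ _ _ hr, hcur1e]
      have := units_ok (gl cur q) (fun w => ρ false (eh w)) [] ((gl ([] :: cur) q).map fun w => ρ true (eh w))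
        (by have := hcur q; simp; omega)
      simpa using this
    · intro q r hr
      rw [trivY_get _ _ _ hr, hcur1e]
      have := units_ok (gl cur q) (fun w => ρ true (eh w)) ((gl cur (q+1)).map fun w => ρ false (eh w)) []
        (by have := hcur q; have := hcur (q+1); simp; omega)
      simpa [gl_cons_succ] using this
  cases hr : doQs (T ++ [(trivX cur, trivY cur)]) (m+1) cur nZ [] gss with
  | none => rw [hr] at h; simp at h
  | some r =>
    rw [hr] at h
    simp only at h
    rw [frcLL_eq, frcLL_eq, frcWW_eq] at h
    cases hb1 : Nat.beq (llen r.2.1) nE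
    · rw [hb1] at h; simp at h
    cases hb2 : Nat.beq (llen (tl r.2.2)) nS
    · rw [hb1, hb2] at h; simp at h
    rw [hb1, hb2] at h
    simp only [cond_true] at h
    rw [snocF_eq] at h
    have hl1 : r.2.1.length = 8 := by rw [← llen_eq]; exact Nat.eq_of_beq_eq_true hb1
    have hl2 : (tl r.2.2).length = 7 := by rw [← llen_eq]; exact Nat.eq_of_beq_eq_true hb2
    have hQ := doQs_ok h7 hrel hT1 (m+1) 0 cur [] hcur (by simp) (fun i => by
      rw [updW_self, zero_add]) gss r hr
    have htl : ∀ q : ℕ, (tl r.2.2)[q]? = r.2.2[q+1]? := by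
      intro q
      cases h : r.2.2 with
      | nil => rfl
      | cons a b => rfl
    simp only [hρ] at hQ
    have hQ1 := fun q => (hQ q).1
    have hQ2 : ∀ q rx, (tl r.2.2)[q]? = some rx → _ := fun q rx h => (hQ (q+1)).2 rx (by rw [← htl]; exact h)
    simp only [gl_cons_succ] at hQ2
    refine ⟨r.1, _, ⟨updW W (m+1) (gl r.1), ?_, ?_, ?_, ?_, ?_⟩, h⟩
    · exact TInv_snoc hT m hTl cur (gl r.1) hW _ _ hcur hQ1 hQ2
    · simp [hTl]
    · intro q; rw [updW_self]
    · rw [updW_ne _ _ _ _ _ (by omega)]; exact hW0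
    · intro w hw hc
      cases w with
      | nil => simp at hw
      | cons l w =>
        have hw' : w.length = m := by simpa using hw
        rw [hρ]
        have hcc : ct (l :: w) = ct w + if l = true then 1 else 0 := by
          unfold ct; rw [List.count_cons]; simp
        refine closure_map (ρ l) _ _ ?_ (hsp w hw' (by omega))
        intro a ha
        obtain ⟨u, hu, rfl⟩ := List.mem_map.1 ha
        obtain ⟨n, hn, hun⟩ := List.mem_iff_getElem.1 hu
        have fin : ∀ (rx : List ℕ) (kv : List M), List.Forall₂ (fun v r' => Dn 6 kv r' v) ((gl cur (ct w)).map fun w => ρ l (eh w)) rx →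
            ρ l (eh u) ∈ AddSubmonoid.closure {v | v ∈ kv} := by
          intro rx kv hf
          have hle := hf.length_eq
          rw [List.length_map] at hle
          have := hf.get (i := n) (by simpa using hn) (by omega)
          simp only [List.get_eq_getElem, List.getElem_map, hun] at this
          exact this.mem
        cases l
        · simp only [Bool.false_eq_true, if_false, add_zero] at hcc
          rw [hcc] at hc ⊢
          exact fin _ _ (hQ1 (ct w) r.2.1[ct w] (by rw [List.getElem?_eq_getElem]))
        · simp only [if_true] at hcc
          rw [hcc] at hc ⊢
          exact fin _ _ (hQ2 (ct w) (tl r.2.2)[ct w] (by rw [List.getElem?_eq_getElem]))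
end
section
variable {M V : Type*} [AddCommGroup M] [AddCommGroup V] {ρ : Bool → M →+ M} {eh : LB → M} {ev : Bool → M →+ V}
variable {W : ℕ → ℕ → List LB} {T : Tab}
def evw (eh : LB → M) (ev : Bool → M →+ V) : LB → V
  | [] => 0
  | l :: w => ev l (eh w)
theorem rs_eh (hρ : ∀ l w, eh (l :: w) = ρ l (eh w)) (w u : LB) : rs ρ w (eh u) = eh (w.reverse ++ u) := by
  induction w generalizing u with
  | nil => rfl
  | cons l w ih =>
    have : rs ρ (l :: w) (eh u) = rs ρ w (ρ l (eh u)) := rfl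
    rw [this, ← hρ, ih]; simp
/-- hypotheses for E-step -/
structure EH (ev : Bool → M →+ V) (wx wy : List LB) (uX uY : List ℕ) (vs : List V) : Prop where
  x : List.Forall₂ (fun v r => Dn 6 vs r (ev false v)) (wx.map eh) uX
  y : List.Forall₂ (fun v r => Dn 6 vs r (ev true v)) (wy.map eh) uY
  lx : uX.length ≤ 128
  ly : uY.length ≤ 128
variable (h7 : ∀ v : M, 7 • v = 0) (h7' : ∀ v : V, 7 • v = 0) (hρ : ∀ l w, eh (l :: w) = ρ l (eh w))
  (hT : TInv ρ eh W T) (hW0 : W 0 0 = [[]])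
include h7 h7' hρ hT hW0
theorem tenR_ok (m q : ℕ) (cur : List (List LB)) (hW : ∀ q, W m q = gl cur q) (uX uY : List ℕ) (vs : List V)
    (hE : EH (eh := eh) ev (gl cur q) (gl ([] :: cur) q) uX uY vs) (l : Bool) (rw' : LB) (X : ℕ)
    (h : tenR T m q uX uY l rw' = some X) : Dn 6 vs X (ev l (eh rw'.reverse)) := by
  unfold tenR at h
  rw [Option.bind_eq_some_iff] at h
  obtain ⟨r, hr, h⟩ := h
  obtain ⟨hb1, h⟩ := cond_some h
  obtain ⟨hb2, h⟩ := cond_some h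
  rw [frc_eq] at h
  obtain rfl := Option.some.inj h
  have h0 : Dn 6 (vl eh W 0 0) (unit 0) (eh []) := by
    have := Dn.unit (vl eh W 0 0) 0 (by norm_num)
    have e : (vl eh W 0 0).getD 0 0 = eh [] := by unfold vl; rw [hW0]; rfl
    rwa [e] at this
  have h1 := appW_ok ρ eh h7 hT rw' 0 0 (unit 0) (eh []) r h0 hr
  rw [rs_eh hρ, List.append_nil, Nat.eq_of_beq_eq_true hb1] at h1
  have e2 := Nat.eq_of_beq_eq_true hb2
  unfold vl at h1
  rw [hW] at h1
  cases l
  · have e2' : r.2.1 = q := e2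
    rw [e2'] at h1
    exact (h1.mv (ev false) hE.x hE.lx).fold h7' (by norm_num)
  · have e2' : r.2.1 + 1 = q := e2
    have hy := hE.y
    rw [← e2', gl_cons_succ] at hy
    exact (h1.mv (ev true) hy hE.ly).fold h7' (by norm_num)
theorem cycRow_ok (hcyc : ∀ l l1 w, ev l (eh (l1 :: w)) = ev l1 (eh (w ++ [l])))
    (m q : ℕ) (cur : List (List LB)) (hW : ∀ q, W m q = gl cur q) (uX uY : List ℕ) (vs : List V)
    (hE : EH (eh := eh) ev (gl cur q) (gl ([] :: cur) q) uX uY vs) (w : LB) (u X : ℕ) (hu : Dn 6 vs u (evw eh ev w))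
    (h : cycRow T m q uX uY w u = some X) : Dn 6 vs X 0 := by
  cases w with
  | nil => exact absurd h (by simp [cycRow])
  | cons l w =>
    cases w with
    | nil => exact absurd h (by simp [cycRow])
    | cons l1 w =>
      have e : cycRow T m q uX uY (l :: l1 :: w) u = Option.bind (tenR T m q uX uY l1 (l :: rv w [])) fun X =>
        frc (fold (u + 6 * X)) fun X => some X := rfl
      rw [e, Option.bind_eq_some_iff] at h
      obtain ⟨Y, hY, h⟩ := h
      rw [frc_eq] at h
      obtain rfl := Option.some.inj h
      have h1 := tenR_ok h7 h7' hρ hT hW0 m q cur hW uX uY vs hE _ _ _ hY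
      rw [rv_eq] at h1
      simp only [List.append_nil, List.reverse_cons, List.reverse_reverse] at h1
      rw [← hcyc] at h1
      have h2 := (hu.add (h1.mul 6)).fold h7' (by norm_num)
      have e3 : evw eh ev (l :: l1 :: w) + 6 • ev l (eh (l1 :: w)) = 0 := by
        rw [← h7' (ev l (eh (l1 :: w)))]
        unfold evw
        rw [show (7:ℕ) = 1 + 6 from rfl, add_smul, one_smul]
      rw [e3] at h2
      exact h2
theorem cycRows_ok (hcyc : ∀ l l1 w, ev l (eh (l1 :: w)) = ev l1 (eh (w ++ [l])))
    (m q : ℕ) (cur : List (List LB)) (hW : ∀ q, W m q = gl cur q) (uX uY : List ℕ) (vs : List V)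
    (hE : EH (eh := eh) ev (gl cur q) (gl ([] :: cur) q) uX uY vs) (ws : List LB) (us : List ℕ)
    (hus : List.Forall₂ (fun v u => Dn 6 vs u v) (ws.map (evw eh ev)) us) (P P' : Piv) (hP : PInv vs P)
    (h : cycRows T m q uX uY ws us P = some P') : PInv vs P' := by
  induction ws generalizing us P with
  | nil => obtain rfl := Option.some.inj h; exact hP
  | cons w ws ih =>
    cases us with
    | nil => cases hus
    | cons u us =>
      cases hus with
      | cons h1 h2 =>
        have e : cycRows T m q uX uY (w :: ws) (u :: us) P = Option.bind (cycRow T m q uX uY w u) fun X =>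
          frcP (addP P X) fun P => cycRows T m q uX uY ws us P := rfl
        rw [e, Option.bind_eq_some_iff] at h
        obtain ⟨X, hX, h⟩ := h
        rw [frcP_eq] at h
        exact ih us h2 _ (addP_ok h7' vs P hP X (cycRow_ok h7 h7' hρ hT hW0 hcyc m q cur hW uX uY vs hE w u X h1 hX)) h
theorem extRows_ok (hcyc : ∀ l l1 w, ev l (eh (l1 :: w)) = ev l1 (eh (w ++ [l])))
    (m q : ℕ) (cur : List (List LB)) (hW : ∀ q, W m q = gl cur q) (uX uY : List ℕ) (vs : List V)
    (hE : EH (eh := eh) ev (gl cur q) (gl ([] :: cur) q) uX uY vs) (ws : List LB) (P P' : Piv) (hP : PInv vs P)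
    (h : extRows T m q uX uY ws P = some P') : PInv vs P' := by
  induction ws generalizing P with
  | nil => obtain rfl := Option.some.inj h; exact hP
  | cons w ws ih =>
    have e : extRows T m q uX uY (w :: ws) P = Option.bind (tenW T m q uX uY w) fun u =>
      Option.bind (cycRow T m q uX uY w u) fun X => frcP (addP P X) fun P => extRows T m q uX uY ws P := rfl
    rw [e, Option.bind_eq_some_iff] at h
    obtain ⟨u, hu, h⟩ := h
    rw [Option.bind_eq_some_iff] at h
    obtain ⟨X, hX, h⟩ := h
    rw [frcP_eq] at h
    have h1 : Dn 6 vs u (evw eh ev w) := by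
      cases w with
      | nil => exact absurd hu (by simp [tenW])
      | cons l w =>
        have e : tenW T m q uX uY (l :: w) = tenR T m q uX uY l (rv w []) := rfl
        rw [e, rv_eq] at hu
        have := tenR_ok h7 h7' hρ hT hW0 m q cur hW uX uY vs hE _ _ _ hu
        simp only [List.append_nil, List.reverse_reverse] at this
        exact this
    exact ih _ (addP_ok h7' vs P hP X (cycRow_ok h7 h7' hρ hT hW0 hcyc m q cur hW uX uY vs hE w u X h1 hX)) h
omit h7 h7' hρ hT hW0 in
theorem sameC_ok (ws : List LB) (cs : List ℕ) (h : sameC ws cs = true) : ∀ w ∈ ws, code w ∈ cs := by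
  induction ws generalizing cs with
  | nil => simp
  | cons w ws ih =>
    cases cs with
    | nil => exact absurd h (by simp [sameC])
    | cons c cs =>
      have e : sameC (w :: ws) (c :: cs) = cond (Nat.beq (code w) c) (sameC ws cs) false := rfl
      rw [e] at h
      cases hb : Nat.beq (code w) c
      · rw [hb] at h; simp at h
      · rw [hb] at h
        have := ih cs h
        intro v hv
        rcases List.mem_cons.1 hv with rfl | hv
        · rw [Nat.eq_of_beq_eq_true hb]; simp
        · simp [this v hv]
theorem doE_ok (hcyc : ∀ l l1 w, ev l (eh (l1 :: w)) = ev l1 (eh (w ++ [l])))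
    (m q : ℕ) (cur : List (List LB)) (hW : ∀ q, W m q = gl cur q) (ex : List ℕ × List ℕ)
    (h : doE T m q (gl cur q) (gl ([] :: cur) q) ex = true) (w : LB) (hw : w ∈ cw (gl cur q) (gl ([] :: cur) q)) :
    evw eh ev w ∈ AddSubmonoid.closure {v | ∃ b, code b ∈ ex.1 ∧ evw eh ev b = v} := by
  set wx := gl cur q with hwx
  set wy := gl ([] :: cur) q with hwy
  unfold doE at h
  cases hb1 : Nat.ble (llen wx) nX
  · rw [hb1] at h; simp at h
  cases hb2 : Nat.ble (llen wy) nX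
  · rw [hb1, hb2] at h; simp at h
  rw [hb1, hb2] at h
  simp only [cond_true] at h
  rw [frcWs_eq, frcL_eq, frcL_eq, frcL_eq, dcds_eq] at h
  have hx : wx.length ≤ 60 := by have := Nat.le_of_ble_eq_true hb1; rw [llen_eq] at this; exact this
  have hy : wy.length ≤ 60 := by have := Nat.le_of_ble_eq_true hb2; rw [llen_eq] at this; exact this
  generalize hP : (Option.bind (cycRows T m q (units wx nZ) (units wy (llen wx)) (cw wx wy) (units (cw wx wy) nZ) [])
    fun P => extRows T m q (units wx nZ) (units wy (llen wx)) (ex.2.map fun a => dcd nW a) P) = o at h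
  cases o with
  | none => simp at h
  | some P =>
    rw [Option.bind_eq_some_iff] at hP
    obtain ⟨P1, hP1, hP2⟩ := hP
    simp only at h
    rw [frcL_eq, frcL_eq, frcWs_eq] at h
    generalize hr : mkRows P (keepU P (units (cw wx wy) nZ)) (comp P (units (cw wx wy) nZ) nZ) (units (cw wx wy) nZ) = o at h
    cases o with
    | none => simp at h
    | some rows =>
      simp only at h
      set vs := (cw wx wy).map (evw eh ev) with hvs
      have hvse : vs = (wx.map fun w => ev false (eh w)) ++ (wy.map fun w => ev true (eh w)) := by
        rw [hvs, cw_eq, List.map_append, List.map_map, List.map_map]; rfl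
      have hl : (cw wx wy).length ≤ 128 := by rw [cw_eq]; simp; omega
      have hE : EH (eh := eh) ev wx wy (units wx nZ) (units wy (llen wx)) vs := by
        refine ⟨?_, ?_, ?_, ?_⟩
        · have := units_ok wx (fun w => ev false (eh w)) [] (wy.map fun w => ev true (eh w)) (by simp; omega)
          rw [List.nil_append, ← hvse, List.forall₂_map_left_iff] at this
          rw [List.forall₂_map_left_iff]; exact this
        · have := units_ok wy (fun w => ev true (eh w)) (wx.map fun w => ev false (eh w)) [] (by simp; omega)
          rw [List.append_nil, ← hvse, List.forall₂_map_left_iff, List.length_map] at this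
          rw [List.forall₂_map_left_iff, llen_eq]; exact this
        · rw [units_length]; omega
        · rw [units_length]; omega
      have hu := units_ok (cw wx wy) (evw eh ev) [] [] (by simpa using hl)
      simp only [List.nil_append, List.append_nil, List.length_nil] at hu
      have hPI1 : PInv vs P1 := cycRows_ok h7 h7' hρ hT hW0 hcyc m q cur hW _ _ vs hE _ _ hu [] P1 (fun p hp => by simp at hp) hP1
      have hPI : PInv vs P := extRows_ok h7 h7' hρ hT hW0 hcyc m q cur hW _ _ vs hE _ P1 P hPI1 hP2
      have hk := keep_ok h7' (evw eh ev) (cw wx wy) hl P hPI rows hr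
      have hs := sameC_ok _ _ h
      obtain ⟨n, hn, hun⟩ := List.mem_iff_getElem.1 hw
      have hle := hk.length_eq
      rw [List.length_map] at hle
      have := hk.get (i := n) (by simpa using hn) (by omega)
      simp only [List.get_eq_getElem, List.getElem_map, hun] at this
      refine AddSubmonoid.closure_mono ?_ this.mem
      intro v hv
      obtain ⟨b, hb, rfl⟩ := List.mem_map.1 hv
      exact ⟨b, hs b hb, rfl⟩
omit h7 h7' hρ hT hW0 in
theorem doEs_ok (m q0 : ℕ) (cur : List (List LB)) (wy : List LB) (exs : List (List ℕ × List ℕ))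
    (h : doEs T m cur q0 wy exs = true) (q : ℕ) (ex) (hq : exs[q]? = some ex) :
    doE T m (q0+q) (gl cur q) (gl (wy :: cur) q) ex = true := by
  induction cur generalizing q0 wy exs q with
  | nil =>
    cases exs with
    | nil => simp at hq
    | cons e exs => exact absurd h (by simp [doEs])
  | cons wx cur ih =>
    cases exs with
    | nil => simp at hq
    | cons e exs =>
      have e1 : doEs T m (wx :: cur) q0 wy (e :: exs) = cond (doE T m q0 wx wy e) (doEs T m cur (q0+1) wx exs) false := rfl
      rw [e1] at h
      cases hb : doE T m q0 wx wy e
      · rw [hb] at h; simp at h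
      rw [hb] at h
      cases q with
      | zero =>
        obtain rfl := Option.some.inj hq
        exact hb
      | succ q =>
        have := ih (q0+1) wx exs h q hq
        rw [show q0 + (q+1) = q0 + 1 + q by omega]
        exact this
end
section
variable {M V : Type*} [AddCommGroup M] [AddCommGroup V] {ρ : Bool → M →+ M} {eh : LB → M} {ev : Bool → M →+ V}
theorem allE_ok (ls : List (List LB)) (h : allE ls = true) (q : ℕ) : gl ls q = [] := by
  induction ls generalizing q with
  | nil => rfl
  | cons a ls ih =>
    cases a with
    | cons b a => exact absurd h (by simp [allE])
    | nil =>
      have e : allE ([] :: ls) = allE ls := rfl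
      rw [e] at h
      cases q with
      | zero => rfl
      | succ q => exact ih h q
theorem run_ok (h7 : ∀ v : M, 7 • v = 0) (h7' : ∀ v : V, 7 • v = 0) (hrel : HRel ρ eh)
    (hρ : ∀ l w, eh (l :: w) = ρ l (eh w))
    (hcyc : ∀ l l1 w, ev l (eh (l1 :: w)) = ev l1 (eh (w ++ [l])))
    (gs : List (List (List RelG) × List (List ℕ × List ℕ))) (m : ℕ) (T : Tab) (cur) (hI : Inv ρ eh m T cur)
    (h : run gs m T cur = true) :
    (∀ i g, gs[i]? = some g → ∀ q ex, g.2[q]? = some ex → q ≤ 7 → ∀ w : LB, w.length = m+i+1 → ct w = q →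
      evw eh ev w ∈ AddSubmonoid.closure {v | ∃ b, code b ∈ ex.1 ∧ evw eh ev b = v}) ∧
    (∀ w : LB, w.length = m + gs.length → ct w ≤ 7 → eh w = 0) := by
  induction gs generalizing m T cur with
  | nil =>
    refine ⟨by simp, ?_⟩
    intro w hw hc
    obtain ⟨W, hT, hTl, hW, hW0, hsp⟩ := hI
    have := hsp w (by simpa using hw) hc
    rw [allE_ok cur h] at this
    simpa using this
  | cons g gs ih =>
    have e : run (g :: gs) m T cur = cond (doEs T m cur nZ [] g.2)
      (frc (Nat.succ m) fun m' => doM T m' cur g.1 fun cur' T' => run gs m' T' cur') false := rfl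
    rw [e] at h
    cases hb : doEs T m cur nZ [] g.2
    · rw [hb] at h; simp at h
    rw [hb] at h
    simp only [cond_true] at h
    rw [frc_eq] at h
    obtain ⟨cur', T', hI', h'⟩ := doM_ok h7 hrel hρ m T cur hI g.1 _ h
    obtain ⟨i1, i2⟩ := ih (m+1) T' cur' hI' h'
    refine ⟨?_, ?_⟩
    · intro i g' hg q ex hex hq w hw hc
      cases i with
      | succ i => exact i1 i g' hg q ex hex hq w (by omega) hc
      | zero =>
        obtain rfl := Option.some.inj hg
        have hE := doEs_ok m 0 cur [] g.2 hb q ex hex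
        rw [zero_add] at hE
        obtain ⟨W, hT, hTl, hW, hW0, hsp⟩ := hI
        have hfin := doE_ok h7 h7' hρ hT hW0 hcyc m q cur hW ex hE
        cases w with
        | nil => simp at hw
        | cons l w =>
          have hcc : ct (l :: w) = ct w + if l = true then 1 else 0 := by
            unfold ct; rw [List.count_cons]; simp
          have hs := hsp w (by simpa using hw) (by omega)
          refine closure_map (ev l) _ _ ?_ hs
          intro a ha
          obtain ⟨u, hu, rfl⟩ := List.mem_map.1 ha
          apply hfin (l :: u)
          rw [cw_eq]
          cases l
          · simp only [Bool.false_eq_true, if_false, add_zero] at hcc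
            rw [← hcc, hc] at hu
            simp [hu]
          · simp only [if_true] at hcc
            rw [← hc, hcc, gl_cons_succ]
            simp [hu]
    · intro w hw hc
      exact i2 w (by simp only [List.length_cons] at hw; omega) hc
end
end PD
end
section
namespace PD
/-- duplicate a table of `2^l` fields `e` times -/
def mdup (e : ℕ) : ℕ → ℕ → ℕ :=
  Nat.rec (motive := fun _ => ℕ → ℕ → ℕ) (fun _ X => X)
    (fun _ ih l X => frc (Nat.add X (Nat.shiftLeft X (Nat.mul nH (Nat.pow nT l)))) fun Y => ih (Nat.succ l) Y) e
def mkE (d k : ℕ) : ℕ × ℕ × ℕ :=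
  frc (Nat.mul nH (Nat.pow nT k)) fun N =>
  frc (Nat.sub (Nat.pow nT N) nU) fun F =>
  frc (mdup (Nat.sub d (Nat.add k nT)) (Nat.add k nT) (Nat.add F (Nat.shiftLeft F (Nat.mul (nat_lit 3) N)))) fun m0 =>
  frc (mdup (Nat.sub d (Nat.add k nT)) (Nat.add k nT) (Nat.shiftLeft F N)) fun m1 => (N, m0, m1)
def frcE {α : Type} (e : ℕ × ℕ × ℕ) (f : ℕ × ℕ × ℕ → α) : α :=
  Prod.rec (fun a p => Prod.rec (fun b c => frc a fun a => frc b fun b => frc c fun c => f (a, b, c)) p) e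
/-- the list of `mkE d k` for `k = k0, …, k0 + n - 1` -/
def mkM {α : Type} (d n : ℕ) : ℕ → (List (ℕ × ℕ × ℕ) → α) → α :=
  Nat.rec (motive := fun _ => ℕ → (List (ℕ × ℕ × ℕ) → α) → α) (fun _ f => f [])
    (fun _ ih k f => frcE (mkE d k) fun e => frc (Nat.succ k) fun k => ih k fun l => f (e :: l)) n
def swE (e : ℕ × ℕ × ℕ) (X : ℕ) : ℕ :=
  Nat.add (Nat.add (Nat.land X e.2.1) (Nat.shiftLeft (Nat.land X e.2.2) e.1)) (Nat.land (Nat.shiftRight X e.1) e.2.2)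
def sw (ms : List (ℕ × ℕ × ℕ)) (k X : ℕ) : ℕ :=
  Option.rec (motive := fun _ => ℕ) nZ (fun e => swE e X) (nth ms k)
def mv1 (ms : List (ℕ × ℕ × ℕ)) (s : ℕ) : ℕ → ℕ → ℕ :=
  Nat.rec (motive := fun _ => ℕ → ℕ → ℕ) (fun _ X => X)
    (fun _ ih k X => frc (Nat.succ k) fun k' => frc (ih k' X) fun Y => sw ms k Y) s
def mvB (ms : List (ℕ × ℕ × ℕ)) (s k a : ℕ) : ℕ → ℕ :=
  Nat.rec (motive := fun _ => ℕ → ℕ) (fun X => X)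
    (fun a ih X => frc (ih X) fun Y => frc (Nat.add a k) fun k' => mv1 ms s k' Y) a
def lsum (l : List ℕ) : ℕ := LR ℕ nZ (fun a _ ih => Nat.add a ih) l
def lapp (l m : List ℕ) : List ℕ := LR (List ℕ) m (fun a _ ih => a :: ih) l
def pick (ms : List (ℕ × ℕ × ℕ)) (R : List ℕ → ℕ → ℕ) (X : ℕ) (post : List ℕ) : List ℕ → ℕ :=
  LR (List ℕ → ℕ) (fun _ => nZ)
    (fun b post ih pre =>
      Nat.add (frcL (lapp pre post) fun bs => frc (R bs X) fun Y => frc (lsum pre) fun s => frc (lsum post) fun k => mvB ms s k b Y)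
        (frcL (lapp pre (b :: [])) fun pre => ih pre)) post
def Rr (ms : List (ℕ × ℕ × ℕ)) (n : ℕ) : List ℕ → ℕ → ℕ :=
  Nat.rec (motive := fun _ => List ℕ → ℕ → ℕ) (fun _ X => X)
    (fun _ ih bs X => pick ms ih X bs []) n
/-- nonincreasing lists of `k` parts `1 ≤ a ≤ m` with sum `t` -/
def gen (k : ℕ) : ℕ → ℕ → List (List ℕ) :=
  Nat.rec (motive := fun _ => ℕ → ℕ → List (List ℕ)) (fun _ t => cond (Nat.beq t nZ) [[]] [])
    (fun _ ih m t => Nat.rec (motive := fun _ => List (List ℕ)) []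
      (fun a r => cond (Nat.ble (Nat.succ a) t) (((ih (Nat.succ a) (Nat.sub t (Nat.succ a))).map (List.cons (Nat.succ a))) ++ r) r) m) k
def chkS (ms : List (ℕ × ℕ × ℕ)) (X C : ℕ) (l : List (List ℕ)) : Bool :=
  LR Bool true
    (fun bs _ ih => cond (LR Bool true (fun _ t _ => frcL t fun t => Nat.beq (Rr ms (nat_lit 5) t X) C) bs) ih false) l
def chkT (ms : List (ℕ × ℕ × ℕ)) (d X : ℕ) (l : List (List ℕ)) : Bool :=
  cond (Nat.ble (Nat.succ X) (Nat.pow nT (Nat.mul nH (Nat.pow nT d))))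
  (cond (Nat.beq (Nat.land X (mdup d nZ (nat_lit 511))) X)
  (cond (Nat.beq (mv1 ms (Nat.pred d) nZ X) X)
  (frc (mdup d nZ (nat_lit 30720)) fun C => chkS ms X C l) false) false) false
def hor (fuel : ℕ) : ℕ → ℕ → ℕ → ℕ × ℕ :=
  Nat.rec (motive := fun _ => ℕ → ℕ → ℕ → ℕ × ℕ) (fun _ A C => (A, C))
    (fun _ ih n A C => cond (Nat.beq n nZ) (A, C)
      (frc (Nat.mod n (nat_lit 1159)) fun e => frc (Nat.mul nH (Nat.div e (nat_lit 19))) fun g =>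
       frc (Nat.shiftLeft (Nat.add A (Nat.mod e (nat_lit 19))) g) fun A => frc (Nat.shiftLeft (Nat.add C (nat_lit 9)) g) fun C =>
       frc (Nat.div n (nat_lit 1159)) fun n => ih n A C)) fuel
def rsum (ms : List (ℕ × ℕ × ℕ)) (d n : ℕ) : ℕ → ℕ → ℕ :=
  Nat.rec (motive := fun _ => ℕ → ℕ → ℕ) (fun _ r => r)
    (fun _ ih X r => frc (mv1 ms (Nat.pred d) nZ X) fun Y => frc (Nat.add X r) fun r => ih Y r) n
def bld (ms : List (ℕ × ℕ × ℕ)) (d n : ℕ) : ℕ :=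
  Prod.rec (motive := fun _ => ℕ) (fun A C => Nat.sub (rsum ms d d A (mdup d nZ (nat_lit 256))) (rsum ms d d C nZ))
    (hor (nat_lit 1000) n nZ nZ)
def getT (d X c : ℕ) : ℕ := Nat.mod (Nat.shiftRight X (Nat.mul nH (Nat.sub c (Nat.pow nT d)))) (nat_lit 65536)
/-- table `X` is dual to `c` in `cs` -/
def dualT (d X c : ℕ) (cs : List ℕ) : Bool :=
  LR Bool true (fun c' _ ih => cond (Nat.beq c c')
    (cond (Nat.beq (getT d X c') (nat_lit 256)) false ih) (cond (Nat.beq (getT d X c') (nat_lit 256)) ih false)) cs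
def anyT (d c : ℕ) (cs Xs : List ℕ) : Bool :=
  LR Bool false (fun X _ ih => cond (dualT d X c cs) true ih) Xs
def allC (d : ℕ) (Xs cs l : List ℕ) : Bool :=
  LR Bool true (fun c _ ih => cond (anyT d c cs Xs) ih false) l
def allQ (d : ℕ) (Xs : List ℕ) (ql : List (List ℕ)) : Bool :=
  LR Bool true (fun cs _ ih => cond (allC d Xs cs cs) ih false) ql
def blds {α : Type} (ms : List (ℕ × ℕ × ℕ)) (d : ℕ) (ns : List ℕ) : (List ℕ → α) → α :=
  LR ((List ℕ → α) → α) (fun k => k [])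
    (fun n _ ih k => frc (bld ms d n) fun X => ih fun t => k (X :: t)) ns
def allT (ms : List (ℕ × ℕ × ℕ)) (d : ℕ) (l : List (List ℕ)) (Xs : List ℕ) : Bool :=
  LR Bool true (fun X _ ih => cond (chkT ms d X l) ih false) Xs
def chkD (d : ℕ) (ns : List ℕ) (ql : List (List ℕ)) : Bool :=
  mkM d (Nat.pred d) nZ fun ms => blds ms d ns fun Xs =>
    cond (allT ms d (gen (nat_lit 6) d d) Xs) (allQ d Xs ql) false
def blist : List (List (List ℕ)) := [[2]] :: (edat.tail.map fun l => l.map Prod.fst)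
end PD
end
section
namespace PD
def ldat : List (List ℕ) := [
 [10],
 [11619],
 [11619],
 [13466469,105],
 [13466469,105],
 [104425375209,163583516733,254019],
 [189537195148794,297985,253981],
 [791937713044891912246223406270406,458284364624657779,771842841495454713,956375,956223],
 [771842841547247915,1614022210793057782538552523692558,1106991211641,1284680862473,1284476901731],
 [8269520339536522680011242899900594963817033981033888503,8736416991579284237114374550598233530385006087567174153,8746025577471077036238978282759427169036929238965222,6852555748943802192296384781593510476862165993185,2327963664056519375562168167958017273483430634,1702796715674630869798862954,1110880876,1583317242427],
 [23572696824807681282893051217448413418942047460191797467559377770848328089661993678374043100016102543055,56001773619343873412011921901197423978452218548745932791453868606539833818274379547976482931997067082051388,9916329048266881379349073490927670782626111011757622122894823537484764373,3127110275847765288988977851936753032020303782127904,7096327959046930508051135557862158092138043770775335325782673962,4078550592328463438187989686562288364911279,3311197771514836965628938114],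
 [472545843912861064614972961365741677435898076911317686602876006190377152540562876449054765639371563839747525101969708398712437243861842315502235067849643676386627637912741434636840909872075552976385376736499421344770316525983484158454023153971984155280156520762332650908369209680793356246304438534,217207114717382934872927559193978521568812300266614618120646127598866032113766031451670615263574811145520379161064120933673589073989309884999786740077040267521929054198576580271805567429780375850521102380979549368092294079071823847436680991271135337157610772752908510624401433030,44969680602021162690374214409301055556372832321216206067029377135493169069086725227886607950083724449634022242388432068538002436123969566073374411080162048525773430909617384947589567051691853888436256461067405818167128511900105777604066559,7564166623883718795806393258717637168224799166801557932260622215901862843042251229045107352162893093192091259586078560231941600372498375988461655433117053449059487196546274718889082702937278884235502,239003776567868921250669813545464501863272423742695566095329992647236744387179381464752601751542424457570824909121049,395450720276987187033560753870334901685506754481664894581727306445941311340758532607563449130076024948277831700447788623256210608372941054,26890757702392064440758026858672320729985424873864358235920528679048719553],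
 [92874211507059913740714510642749883435825809874793840840188422643740802898814920367184068695067325276863461306572071884502655144979055189517719350988072283983285039051626250361838116359393449846401507232015478330902981168724927764887961002366096895850492140855777456601010210649253818543985792833791339259124134956462846630561925328550354077155681263747913672292073212206341544075254911844313,336433549515260752534425118146595150629703539158270118581582015086116594314716099723145463890781913385351832964134095888502624622508717634246194996928707658397470833717300174279180737568511859904698859657664668526552707973976913336033920811265513207510488631109577802896691010827057513897661036029246115901555558099882189123027192049483526651572562779976159503282142933463673825398393793712930906525240250531408718265,44583908619890800382134580821059927941188453076559770340501125449733270728597910044382771350838787912048549751910569153797353208843002625435597693420075182491919002652605112830507530195405753089335788649927106563067333401381160823263102341205727719195696717876252393012374255333013793632192097459753275264776859597651006476752244882653124316230733969111372288863686547,3502324855996929336312081884493940484773647121863519651929395227357311225667964544470355087317607901939172940213086633216222287405319146751406922975316424461676936330097249268,29198919870649816120188515545005511800716755025969251490485230403438133104861352327887818482443904330165629729371561017968305961112247661377117865022570295095892300418062466410743192764338231218710941780611107007830809594137565341068379540552021603100698765945386053616732],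
 [2361615460076616253473870568719897878053154521433043371819027709449821710589904846308955228731529012775313434006302891035626268756175813390583489113087549576046904893223555628279813415097191690280423933638592913601055895004811785574833341612458513169041991034014144062550201611714476681338942515055806259732521117057464820718270782793656986910218702955678190235844420156340149350431758527614915798089832557106782591524790021424000530799662176637649192438904618505168063996551373419622107388961873531619809028555884914071255566070298637692243914435558795601816629116933105572659656221871303737878030000243719499886839074265191812675209363553956514708107856082304375324023090127176095193398811421319846437938143485103294763626232637729598713911716864129221726387430601057185968582324553765608448601312460059298651905927244720826789798873865474507036457226097897622616342327481675934200718344570893681160315471202429,1154272066391695708880937622133311863818591826635923146122469630729622755658178604191017328501197157908198849981661116762254606328372615869260568479554401357852574967486577322371809567506421685560875918118149243098823409621794823068728822610741141901728226070825278008482004206347367393611707273189646184688097527465560212348958574525832800230490146741412506216888411451049970331491260036901611574285297074546853978427597015876723941070220087464808336776057193473312133440947484127124968288222752396892091002322607749557617301135074306408868714991699807696654253743940018112503819818939749700796808406233087099162295601956971431446365866011870105837246585884389003186390762890524277461944190267266582844228856373983263234636600842878397717204343428458505248746926795911345289056866744406799864434859374524697622147670894933803470992602554442730568727394303817803583670,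132201081936938189650116956807472535250538670998062754470373775408064622582924481260957114389884264676056444495792057745140977937642494063050742943926602296150216888455287892854186999095378976484936425732750391194605094334859667464507056538805257753324078832003913277977565897492498064787768450769578574168299912840664420153962277608919416008219423533348414434159498475524610716463508530512770351773420714890518693462411507753708177195599921796396165296264564258782265915274775869309925020119702667871769832376392006172249543795203176557709112841092137],
 [6279911140904500083687683664178291420734850433181372643928119219893949298839716437569847387413961368860585433122288319206186752161673191771728284040205351446342969052818739251990430129460896427067825859192847735438477022754144975158774006850184903252061497830093302419732183414744128144414247713645028381872739213437493646316356637195163649074315785351865878960016478296420399480471975213448915906534008716552806900787761558410900503276825352625735404143219599747039099683239695822419445000431664748973170263646449192352944583005837340508988768753940786734332800257700895090270512815700251786872050241397076610846357229959404805923461038732935602795954558775712144969995706442438591095407925407652628863402270507355942576511177261076040415519717997947451475299979428242290654945234121154573099475606443643162186946361509000936862844150467034394167392841042913414100958398217866763947140102922582650844494814388730746119181185177562899403201061274495279487609331305026624742038112247980032169201016544337042632763877207695443593339007201002659553242094222809267850516694]]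
end PD
end
section
namespace PD
set_option maxRecDepth 100000
theorem chk0 : chkD nU (ldat.getD 0 []) (blist.getD 0 []) = true := by decide +kernel
theorem chk1 : chkD nT (ldat.getD 1 []) (blist.getD 1 []) = true := by decide +kernel
theorem chk2 : chkD (nat_lit 3) (ldat.getD 2 []) (blist.getD 2 []) = true := by decide +kernel
theorem chk3 : chkD (nat_lit 4) (ldat.getD 3 []) (blist.getD 3 []) = true := by decide +kernel
theorem chk4 : chkD (nat_lit 5) (ldat.getD 4 []) (blist.getD 4 []) = true := by decide +kernel
theorem chk5 : chkD (nat_lit 6) (ldat.getD 5 []) (blist.getD 5 []) = true := by decide +kernel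
theorem chk6 : chkD nS (ldat.getD 6 []) (blist.getD 6 []) = true := by decide +kernel
theorem chk7 : chkD nE (ldat.getD 7 []) (blist.getD 7 []) = true := by decide +kernel
theorem chk8 : chkD (nat_lit 9) (ldat.getD 8 []) (blist.getD 8 []) = true := by decide +kernel
theorem chk9 : chkD (nat_lit 10) (ldat.getD 9 []) (blist.getD 9 []) = true := by decide +kernel
theorem chk10 : chkD (nat_lit 11) (ldat.getD 10 []) (blist.getD 10 []) = true := by decide +kernel
theorem chk11 : chkD (nat_lit 12) (ldat.getD 11 []) (blist.getD 11 []) = true := by decide +kernel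
theorem chk12 : chkD (nat_lit 13) (ldat.getD 12 []) (blist.getD 12 []) = true := by decide +kernel
theorem chk13 : chkD (nat_lit 14) (ldat.getD 13 []) (blist.getD 13 []) = true := by decide +kernel
theorem chk14 : chkD (nat_lit 15) (ldat.getD 14 []) (blist.getD 14 []) = true := by decide +kernel
theorem chk_true (i : ℕ) (hi : i < 15) : chkD (i+1) (ldat.getD i []) (blist.getD i []) = true := by
  interval_cases i
  · exact chk0
  · exact chk1
  · exact chk2
  · exact chk3
  · exact chk4
  · exact chk5
  · exact chk6
  · exact chk7
  · exact chk8
  · exact chk9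
  · exact chk10
  · exact chk11
  · exact chk12
  · exact chk13
  · exact chk14
end PD
end
section
namespace PD
def pack : ℕ → (LB → ℕ) → ℕ
  | 0, f => f []
  | d+1, f => pack d (fun w => f (false :: w)) + 2^(16*2^d) * pack d (fun w => f (true :: w))
def idx : LB → ℕ
  | [] => 0
  | l :: w => (cond l 1 0) * 2^w.length + idx w
theorem pack_add (d : ℕ) (f g : LB → ℕ) : pack d (fun w => f w + g w) = pack d f + pack d g := by
  induction d generalizing f g with
  | zero => rfl
  | succ d ih => simp only [pack]; rw [ih, ih]; ring
theorem pack_congr (d : ℕ) (f g : LB → ℕ) (h : ∀ w, w.length = d → f w = g w) : pack d f = pack d g := by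
  induction d generalizing f g with
  | zero => exact h [] rfl
  | succ d ih =>
    simp only [pack]
    rw [ih _ (fun w => g (false :: w)) (fun w hw => h _ (by simp [hw])),
      ih _ (fun w => g (true :: w)) (fun w hw => h _ (by simp [hw]))]
theorem pw (d : ℕ) : 2^(16*2^(d+1)) = 2^(16*2^d) * 2^(16*2^d) := by rw [← pow_add]; congr 1; ring
theorem pack_lt (d : ℕ) (f : LB → ℕ) (h : ∀ w, f w < 2^16) : pack d f < 2^(16*2^d) := by
  induction d generalizing f with
  | zero => simpa [pack] using h []
  | succ d ih =>
    simp only [pack]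
    have h0 := ih (fun w => f (false :: w)) (fun w => h _)
    have h1 := ih (fun w => f (true :: w)) (fun w => h _)
    rw [pw]
    have : 2^(16*2^d) * (pack d (fun w => f (true :: w)) + 1) ≤ 2^(16*2^d) * 2^(16*2^d) := Nat.mul_le_mul_left _ h1
    rw [mul_add, mul_one] at this
    omega
theorem idx_lt (w : LB) : idx w < 2^w.length := by
  induction w with
  | nil => simp [idx]
  | cons l w ih =>
    simp only [idx, List.length_cons, pow_succ]
    cases l <;> simp <;> omega
theorem pack_get (d : ℕ) (f : LB → ℕ) (h : ∀ w, f w < 2^16) (w : LB) (hw : w.length = d) :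
    pack d f / 2^(16 * idx w) % 2^16 = f w := by
  induction d generalizing f w with
  | zero =>
    obtain rfl := List.length_eq_zero_iff.1 hw
    simp only [pack, idx, mul_zero, pow_zero, Nat.div_one]
    exact Nat.mod_eq_of_lt (h _)
  | succ d ih =>
    obtain ⟨l, w, rfl⟩ : ∃ l v, w = l :: v := List.exists_cons_of_length_eq_add_one hw
    have hw' : w.length = d := by simpa using hw
    simp only [pack, idx, hw']
    have hl := pack_lt d (fun w => f (false :: w)) (fun w => h _)
    have hi := idx_lt w
    rw [hw'] at hi
    cases l
    · simp only [cond_false, zero_mul, zero_add]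
      have e : 2^(16*2^d) = 2^(16 * idx w) * (2^16 * 2^(16 * (2^d - idx w - 1))) := by
        rw [← pow_add, ← pow_add]; congr 1; omega
      rw [e, mul_assoc, Nat.add_mul_div_left _ _ (by positivity), mul_assoc, Nat.add_mul_mod_self_left]
      exact ih (fun w => f (false :: w)) (fun w => h _) w hw'
    · simp only [cond_true, one_mul]
      rw [mul_add, pow_add, ← Nat.div_div_eq_div_mul, Nat.add_mul_div_left _ _ (by positivity), Nat.div_eq_of_lt hl, zero_add]
      exact ih (fun w => f (true :: w)) (fun w => h _) w hw'
theorem pack_inj (d : ℕ) (f g : LB → ℕ) (hf : ∀ w, f w < 2^16) (hg : ∀ w, g w < 2^16) (h : pack d f = pack d g)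
    (w : LB) (hw : w.length = d) : f w = g w := by
  rw [← pack_get d f hf w hw, h, pack_get d g hg w hw]
theorem unpack (d X : ℕ) (h : X < 2^(16*2^d)) : X = pack d (fun w => X / 2^(16 * idx w) % 2^16) := by
  induction d generalizing X with
  | zero => simp only [pack, idx, mul_zero, pow_zero, Nat.div_one]; rw [Nat.mod_eq_of_lt (by simpa using h)]
  | succ d ih =>
    rw [pw] at h
    set N := 2^(16*2^d) with hN
    have hNpos : 0 < N := by positivity
    have h1 : X % N < N := Nat.mod_lt _ hNpos
    have h2 : X / N < N := Nat.div_lt_of_lt_mul h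
    have e1 := ih _ h1
    have e2 := ih _ h2
    have e : X = X % N + N * (X / N) := (Nat.mod_add_div X N).symm
    conv_lhs => rw [e, e1, e2]
    simp only [pack]
    congr 1
    · apply pack_congr
      intro w hw
      simp only [idx, cond_false, zero_mul, zero_add]
      have hi := idx_lt w
      rw [hw] at hi
      have e : N = 2^(16 * idx w) * (2^16 * 2^(16 * (2^d - idx w - 1))) := by
        rw [hN, ← pow_add, ← pow_add]; congr 1; omega
      conv_rhs => rw [← Nat.mod_add_div X N]
      nth_rewrite 3 [e]
      rw [mul_assoc, Nat.add_mul_div_left _ _ (by positivity), mul_assoc, Nat.add_mul_mod_self_left]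
    · congr 1
      apply pack_congr
      intro w hw
      simp only [idx, cond_true, one_mul]
      rw [Nat.div_div_eq_div_mul, hN, ← pow_add, hw]
      congr 3; ring
theorem land_cat (n a b c e : ℕ) (ha : a < 2^n) (hc : c < 2^n) :
    (a + 2^n * b) &&& (c + 2^n * e) = (a &&& c) + 2^n * (b &&& e) := by
  have hac : a &&& c < 2^n := Nat.and_lt_two_pow _ hc
  have h1 : ((a + 2^n * b) &&& (c + 2^n * e)) % 2^n = a &&& c := by
    rw [Nat.and_mod_two_pow, Nat.add_mul_mod_self_left, Nat.add_mul_mod_self_left, Nat.mod_eq_of_lt ha, Nat.mod_eq_of_lt hc]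
  have h2 : ((a + 2^n * b) &&& (c + 2^n * e)) / 2^n = b &&& e := by
    rw [Nat.and_div_two_pow, Nat.add_mul_div_left _ _ (by positivity), Nat.add_mul_div_left _ _ (by positivity),
      Nat.div_eq_of_lt ha, Nat.div_eq_of_lt hc, zero_add, zero_add]
  rw [← Nat.mod_add_div ((a + 2^n * b) &&& (c + 2^n * e)) (2^n), h1, h2]
theorem pack_land (d : ℕ) (f g : LB → ℕ) (hf : ∀ w, f w < 2^16) (hg : ∀ w, g w < 2^16) :
    pack d f &&& pack d g = pack d (fun w => f w &&& g w) := by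
  induction d generalizing f g with
  | zero => rfl
  | succ d ih =>
    simp only [pack]
    rw [land_cat _ _ _ _ _ (pack_lt d _ fun w => hf _) (pack_lt d _ fun w => hg _), ih _ _ (fun w => hf _) (fun w => hg _),
      ih _ _ (fun w => hf _) (fun w => hg _)]
theorem mdup_ok (e l : ℕ) (f : LB → ℕ) : mdup e l (pack l f) = pack (l + e) (fun w => f (w.drop e)) := by
  induction e generalizing l f with
  | zero => rfl
  | succ e ih =>
    have : mdup (e+1) l (pack l f) = frc (Nat.add (pack l f) (Nat.shiftLeft (pack l f) (16 * 2^l))) fun Y => mdup e (l+1) Y := rfl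
    rw [this, frc_eq]
    have h2 : Nat.add (pack l f) (Nat.shiftLeft (pack l f) (16 * 2^l)) = pack (l+1) (fun w => f (w.drop 1)) := by
      change pack l f + (pack l f) <<< (16 * 2^l) = _
      rw [Nat.shiftLeft_eq, mul_comm]; rfl
    rw [h2, ih]
    have h3 : l + 1 + e = l + (e+1) := by ring
    rw [h3]
    apply pack_congr
    intro w _
    rw [List.drop_drop, add_comm]
theorem mdup_const (d c : ℕ) : mdup d 0 c = pack d (fun _ => c) := by
  have := mdup_ok d 0 (fun _ => c)
  rwa [zero_add] at this
def chi (f : Bool → Bool → ℕ) : LB → ℕ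
  | x :: y :: _ => f x y
  | _ => 0
def sw0 : LB → LB
  | x :: y :: v => y :: x :: v
  | w => w
def swp : ℕ → LB → LB
  | 0, w => sw0 w
  | e+1, l :: w => l :: swp e w
  | _+1, [] => []
def c01 (x y : Bool) : ℕ := cond (!x && y) 1 0
def c10 (x y : Bool) : ℕ := cond (x && !y) 1 0
def ceq (x y : Bool) : ℕ := cond (x == y) 1 0
theorem pack_zero (d : ℕ) : pack d (fun _ => 0) = 0 := by
  induction d with
  | zero => rfl
  | succ d ih => simp only [pack, ih]; rfl
theorem shiftl (e k : ℕ) (g : LB → ℕ) :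
    2^(16*2^k) * pack (k+2+e) (fun w => chi c01 (w.drop e) * g w) = pack (k+2+e) (fun w => chi c10 (w.drop e) * g (swp e w)) := by
  induction e generalizing g with
  | zero =>
    simp only [pack, List.drop_zero, chi, c01, c10, swp, sw0]
    simp [pack_zero, pw]
    ring
  | succ e ih =>
    have h1 : ∀ f, pack (k+2+(e+1)) f = pack (k+2+e) (fun w => f (false :: w)) + 2^(16*2^(k+2+e)) * pack (k+2+e) (fun w => f (true :: w)) := fun _ => rfl
    rw [h1, h1]
    simp only [List.drop_succ_cons, swp]
    rw [← ih (fun w => g (false :: w)), ← ih (fun w => g (true :: w))]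
    ring
theorem pack_const (k : ℕ) : pack k (fun _ => 65535) = 2^(16*2^k) - 1 := by
  induction k with
  | zero => rfl
  | succ k ih =>
    simp only [pack, ih]
    rw [pw]
    set N := 2^(16*2^k)
    have : 0 < N := by positivity
    obtain ⟨n, hn⟩ : ∃ n, N = n + 1 := ⟨N - 1, by omega⟩
    rw [hn]
    have : (n+1)*(n+1) - 1 = n + (n+1)*n := by
      have : (n+1)*(n+1) = n + (n+1)*n + 1 := by ring
      omega
    rw [this]; simp
theorem mkE_def (d k : ℕ) : mkE d k = (16*2^k, mdup (d-(k+2)) (k+2) ((2^(16*2^k)-1) + (2^(16*2^k)-1) <<< (3*(16*2^k))),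
    mdup (d-(k+2)) (k+2) ((2^(16*2^k)-1) <<< (16*2^k))) := by
  have : mkE d k = frc (16*2^k) fun N => frc (2^N-1) fun F =>
    frc (mdup (d-(k+2)) (k+2) (F + F <<< (3*N))) fun m0 => frc (mdup (d-(k+2)) (k+2) (F <<< N)) fun m1 => (N, m0, m1) := rfl
  rw [this, frc_eq, frc_eq, frc_eq, frc_eq]
theorem mkE_ok (k e : ℕ) : mkE (k+2+e) k = (16*2^k, pack (k+2+e) (fun w => 65535 * chi ceq (w.drop e)), pack (k+2+e) (fun w => 65535 * chi c01 (w.drop e))) := by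
  rw [mkE_def]
  have h : k+2+e-(k+2) = e := by omega
  rw [h, ← mdup_ok e (k+2) (fun w => 65535 * chi ceq w), ← mdup_ok e (k+2) (fun w => 65535 * chi c01 w)]
  congr 3
  · simp only [pack, chi, ceq]
    simp [pack_zero, pack_const, Nat.shiftLeft_eq, pow_mul']
    ring
  · simp only [pack, chi, c01]
    simp [pack_zero, pack_const, Nat.shiftLeft_eq]
    ring
theorem chi_le (f : Bool → Bool → ℕ) (hf : ∀ x y, f x y ≤ 1) (w : LB) : chi f w = 0 ∨ chi f w = 1 := by
  have h : ∀ x y, f x y = 0 ∨ f x y = 1 := fun x y => by have := hf x y; omega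
  match w with
  | [] => left; rfl
  | [_] => left; rfl
  | x :: y :: _ => exact h x y
theorem land_chi (a c : ℕ) (ha : a < 2^16) (hc : c = 0 ∨ c = 1) : a &&& (65535 * c) = c * a := by
  rcases hc with rfl | rfl
  · simp
  · have := Nat.and_two_pow_sub_one_eq_mod a 16
    norm_num at this ha ⊢
    rw [this, Nat.mod_eq_of_lt ha]
theorem swp_swp (e : ℕ) (w : LB) : swp e (swp e w) = w := by
  induction e generalizing w with
  | zero =>
    match w with
    | [] => rfl
    | [_] => rfl
    | x :: y :: _ => rfl
  | succ e ih =>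
    cases w with
    | nil => rfl
    | cons l w => simp [swp, ih]
theorem chi_sum (e k : ℕ) (w : LB) (hw : w.length = k+2+e) : chi ceq (w.drop e) + chi c01 (w.drop e) + chi c10 (w.drop e) = 1 := by
  have : (w.drop e).length = k + 2 := by rw [List.length_drop]; omega
  match h : w.drop e with
  | [] => simp [h] at this
  | [_] => simp [h] at this
  | x :: y :: _ => cases x <;> cases y <;> rfl
theorem chi_swp (e : ℕ) (w : LB) : chi c01 ((swp e w).drop e) = chi c10 (w.drop e) := by
  induction e generalizing w with
  | zero =>
    match w with
    | [] => rfl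
    | [_] => rfl
    | x :: y :: _ => cases x <;> cases y <;> rfl
  | succ e ih =>
    cases w with
    | nil => rfl
    | cons l w => simp [swp, ih]
theorem chi_swp_eq (e : ℕ) (w : LB) (f : LB → ℕ) : chi ceq (w.drop e) * f w = chi ceq (w.drop e) * f (swp e w) := by
  induction e generalizing w f with
  | zero =>
    match w with
    | [] => rfl
    | [_] => rfl
    | x :: y :: _ => cases x <;> cases y <;> simp [chi, ceq, swp, sw0]
  | succ e ih =>
    cases w with
    | nil => rfl
    | cons l w => simpa [swp] using ih w (fun w => f (l :: w))
theorem swE_ok (k e : ℕ) (f : LB → ℕ) (hf : ∀ w, f w < 2^16) :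
    swE (mkE (k+2+e) k) (pack (k+2+e) f) = pack (k+2+e) (fun w => f (swp e w)) := by
  rw [mkE_ok]
  set d := k+2+e with hd
  have b1 : ∀ x y, c01 x y ≤ 1 := by decide
  have b2 : ∀ x y, c10 x y ≤ 1 := by decide
  have b3 : ∀ x y, ceq x y ≤ 1 := by decide
  have mb : ∀ c : ℕ, (c = 0 ∨ c = 1) → 65535 * c < 2^16 := by rintro c (rfl | rfl) <;> norm_num
  have L : ∀ g : Bool → Bool → ℕ, (∀ x y, g x y ≤ 1) → pack d f &&& pack d (fun w => 65535 * chi g (w.drop e)) =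
      pack d (fun w => chi g (w.drop e) * f w) := by
    intro g hg
    rw [pack_land d _ _ hf (fun w => mb _ (chi_le g hg _))]
    apply pack_congr
    intro w _
    exact land_chi _ _ (hf _) (chi_le g hg _)
  have S : 2^(16*2^k) * pack d (fun w => 65535 * chi c01 (w.drop e)) = pack d (fun w => 65535 * chi c10 (w.drop e)) := by
    have := shiftl e k (fun _ => 65535)
    simpa only [mul_comm] using this
  change (pack d f &&& pack d (fun w => 65535 * chi ceq (w.drop e))) + (pack d f &&& pack d (fun w => 65535 * chi c01 (w.drop e))) <<< (16*2^k)
    + (pack d f >>> (16*2^k) &&& pack d (fun w => 65535 * chi c01 (w.drop e))) = _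
  have T : pack d f >>> (16*2^k) &&& pack d (fun w => 65535 * chi c01 (w.drop e)) = pack d (fun w => chi c01 (w.drop e) * f (swp e w)) := by
    have h1 : pack d (fun w => 65535 * chi c01 (w.drop e)) = pack d (fun w => 65535 * chi c10 (w.drop e)) >>> (16*2^k) := by
      rw [← S, Nat.shiftRight_eq_div_pow, Nat.mul_div_cancel_left _ (by positivity)]
    rw [h1, ← Nat.shiftRight_and_distrib, L c10 b2]
    have h2 := shiftl e k (fun w => f (swp e w))
    simp only [swp_swp] at h2
    rw [← hd] at h2
    rw [← h2, Nat.shiftRight_eq_div_pow, Nat.mul_div_cancel_left _ (by positivity)]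
  rw [T, L ceq b3, L c01 b1, Nat.shiftLeft_eq, mul_comm (pack d _), hd, shiftl e k f, ← pack_add, ← pack_add]
  apply pack_congr
  intro w hw
  have := chi_sum e k w hw
  rw [chi_swp_eq e w f, ← add_mul, ← add_mul]
  rw [show chi ceq (List.drop e w) + chi c10 (List.drop e w) + chi c01 (List.drop e w) = 1 by omega, one_mul]
end PD
end
section
namespace PD
theorem swp_app (u : LB) (x y : Bool) (v : LB) : swp u.length (u ++ x :: y :: v) = u ++ y :: x :: v := by
  induction u with
  | nil => rfl
  | cons l u ih => simp [swp, ih]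
def MS (d : ℕ) (ms : List (ℕ × ℕ × ℕ)) : Prop := ∀ k, k + 2 ≤ d → nth ms k = some (mkE d k)
variable {d : ℕ} {ms : List (ℕ × ℕ × ℕ)}
theorem sw_ok (hM : MS d ms) (k B : ℕ) (hk : k + 2 ≤ d) (hB : B < 2^16) (f : LB → ℕ) (hf : ∀ w, f w ≤ B) :
    ∃ f', sw ms k (pack d f) = pack d f' ∧ (∀ w, f' w ≤ B) ∧
      ∀ u x y v, v.length = k → u.length + 2 + k = d → f' (u ++ x :: y :: v) = f (u ++ y :: x :: v) := by
  obtain ⟨e, rfl⟩ : ∃ e, d = k + 2 + e := ⟨d - (k+2), by omega⟩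
  refine ⟨fun w => f (swp e w), ?_, fun w => hf _, ?_⟩
  · unfold sw
    rw [hM k hk]
    exact swE_ok k e f fun w => (hf w).trans_lt hB
  · intro u x y v hv hu
    have : e = u.length := by omega
    simp only [this, swp_app]
theorem mv1_ok (hM : MS d ms) (s k B : ℕ) (hk : k + s + 1 ≤ d) (hB : B < 2^16) (f : LB → ℕ) (hf : ∀ w, f w ≤ B) :
    ∃ f', mv1 ms s k (pack d f) = pack d f' ∧ (∀ w, f' w ≤ B) ∧
      ∀ p A x r, A.length = s → r.length = k → p.length + s + 1 + k = d → f' (p ++ A ++ x :: r) = f (p ++ x :: A ++ r) := by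
  induction s generalizing k with
  | zero =>
    refine ⟨f, rfl, hf, ?_⟩
    intro p A x r hA _ _
    obtain rfl := List.length_eq_zero_iff.1 hA
    simp
  | succ s ih =>
    obtain ⟨g, hg1, hg2, hg3⟩ := ih (k+1) (by omega)
    obtain ⟨f', h1, h2, h3⟩ := sw_ok hM k B (by omega) hB g hg2
    refine ⟨f', ?_, h2, ?_⟩
    · have : mv1 ms (s+1) k (pack d f) = frc (k+1) fun k' => frc (mv1 ms s k' (pack d f)) fun Y => sw ms k Y := rfl
      rw [this, frc_eq, frc_eq, hg1, h1]
    · intro p A x r hA hr hp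
      obtain ⟨A', y, rfl⟩ : ∃ A' y, A = A' ++ [y] := by
        have : A ≠ [] := by intro h; simp [h] at hA
        exact ⟨A.dropLast, A.getLast this, (List.dropLast_append_getLast this).symm⟩
      have hA' : A'.length = s := by simpa using hA
      have e1 := h3 (p ++ A') y x r hr (by simp; omega)
      have e2 := hg3 p A' x (y :: r) hA' (by simp [hr]) (by omega)
      simp only [List.append_assoc, List.cons_append, List.nil_append] at e1 e2 ⊢
      rw [e1, e2]
theorem mvB_ok (hM : MS d ms) (s k a B : ℕ) (hk : k + s + a ≤ d) (hB : B < 2^16) (f : LB → ℕ) (hf : ∀ w, f w ≤ B) :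
    ∃ f', mvB ms s k a (pack d f) = pack d f' ∧ (∀ w, f' w ≤ B) ∧
      ∀ p A C r, A.length = s → C.length = a → r.length = k → p.length + s + a + k = d → f' (p ++ A ++ C ++ r) = f (p ++ C ++ A ++ r) := by
  induction a with
  | zero =>
    refine ⟨f, rfl, hf, ?_⟩
    intro p A C r _ hC _ _
    obtain rfl := List.length_eq_zero_iff.1 hC
    simp
  | succ a ih =>
    obtain ⟨g, hg1, hg2, hg3⟩ := ih (by omega)
    obtain ⟨f', h1, h2, h3⟩ := mv1_ok hM s (a+k) B (by omega) hB g hg2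
    refine ⟨f', ?_, h2, ?_⟩
    · have : mvB ms s k (a+1) (pack d f) = frc (mvB ms s k a (pack d f)) fun Y => frc (a+k) fun k' => mv1 ms s k' Y := rfl
      rw [this, frc_eq, frc_eq, hg1, h1]
    · intro p A C r hA hC hr hp
      obtain ⟨x, C, rfl⟩ : ∃ l v, C = l :: v := List.exists_cons_of_length_eq_add_one hC
      have hC' : C.length = a := by simpa using hC
      have e1 := h3 p A x (C ++ r) hA (by simp [hC', hr]) (by omega)
      have e2 := hg3 (p ++ [x]) A C r hA hC' hr (by simp; omega)
      simp only [List.append_assoc, List.cons_append, List.nil_append] at e1 e2 ⊢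
      rw [e1, e2]
/-- left translations on functions -/
def tt (l : Bool) : (LB → ℤ) →+ (LB → ℤ) where
  toFun g u := g (l :: u)
  map_zero' := rfl
  map_add' _ _ := rfl
theorem rs_tt (w : LB) (g : LB → ℤ) : rs tt w g = fun u => g (w ++ u) := by
  induction w generalizing g with
  | nil => rfl
  | cons l w ih =>
    have : rs tt (l :: w) g = rs tt w (tt l g) := rfl
    rw [this, ih]; rfl
theorem lsum_eq (l : List ℕ) : lsum l = l.sum := by
  induction l with
  | nil => rfl
  | cons a l ih => have : lsum (a :: l) = a + lsum l := rfl
                   rw [this, ih, List.sum_cons]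
theorem lapp_eq (l m : List ℕ) : lapp l m = l ++ m := by
  induction l with
  | nil => rfl
  | cons a l ih => have : lapp (a :: l) m = a :: lapp l m := rfl
                   rw [this, ih]; rfl
theorem length_flatten_eq (as : List LB) (bs : List ℕ) (h : as.map List.length = bs) : as.flatten.length = bs.sum := by
  rw [List.length_flatten, h]
def RSpec (d n : ℕ) (f : LB → ℕ) (bs : List ℕ) (Bn Y : ℕ) : Prop :=
  ∃ f', Y = pack d f' ∧ (∀ w, f' w ≤ Bn) ∧ ∀ (p : LB) (as : List LB), as.map List.length = bs → p.length + bs.sum = d →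
    (f' (p ++ as.flatten) : ℤ) = Gs tt n (↑as) (fun u => (f (p ++ u) : ℤ)) []
theorem pick_ok (hM : MS d ms) (n : ℕ) (R : List ℕ → ℕ → ℕ) (f : LB → ℕ) (Bn : ℕ)
    (hR : ∀ bs : List ℕ, bs.length = n → bs.sum ≤ d → RSpec d n f bs Bn (R bs (pack d f)))
    (hB : Bn < 2^16) (post pre : List ℕ) (hl : pre.length + post.length = n + 1) (hs : pre.sum + post.sum ≤ d) :
    ∃ f', pick ms R (pack d f) post pre = pack d f' ∧ (∀ w, f' w ≤ post.length * Bn) ∧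
      ∀ (p : LB) (as1 as2 : List LB), as1.map List.length = pre → as2.map List.length = post →
        p.length + pre.sum + post.sum = d → (f' (p ++ as1.flatten ++ as2.flatten) : ℤ) =
        (as2.map fun a => Gs tt n ((↑(as1 ++ as2) : Multiset LB).erase a) (rs tt a (fun u => (f (p ++ u) : ℤ))) []).sum := by
  induction post generalizing pre with
  | nil =>
    refine ⟨fun _ => 0, (pack_zero d).symm, fun w => Nat.zero_le _, ?_⟩
    intro p as1 as2 _ h2 _
    obtain rfl := List.map_eq_nil_iff.1 h2
    simp
  | cons b post ih =>
    have hdef : pick ms R (pack d f) (b :: post) pre = Nat.add (frcL (lapp pre post) fun bs => frc (R bs (pack d f)) fun Y => frc (lsum pre) fun s => frc (lsum post) fun k => mvB ms s k b Y)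
        (frcL (lapp pre (b :: [])) fun pre => pick ms R (pack d f) post pre) := rfl
    rw [frcL_eq, frcL_eq, frc_eq, frc_eq, frc_eq, lapp_eq, lapp_eq, lsum_eq, lsum_eq] at hdef
    simp only [List.length_cons, List.sum_cons] at hl hs
    obtain ⟨g, hg1, hg2, hg3⟩ := hR (pre ++ post) (by simp; omega) (by simp; omega)
    obtain ⟨g', hg1', hg2', hg3'⟩ := mvB_ok hM pre.sum post.sum b Bn (by omega) hB g hg2
    obtain ⟨h, h1, h2, h3⟩ := ih (pre ++ [b]) (by simp; omega) (by simp; omega)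
    refine ⟨fun w => g' w + h w, ?_, ?_, ?_⟩
    · rw [hdef, hg1, hg1', h1, pack_add]; rfl
    · intro w
      have := hg2' w
      have := h2 w
      rw [List.length_cons, add_mul, one_mul]
      show g' w + h w ≤ _
      omega
    · intro p as1 as2 ha1 ha2 hp
      obtain ⟨a, as2, rfl⟩ : ∃ a t, as2 = a :: t := by
        cases as2 with
        | nil => simp at ha2
        | cons a t => exact ⟨a, t, rfl⟩
      simp only [List.map_cons, List.cons.injEq] at ha2
      obtain ⟨hab, ha2⟩ := ha2
      rw [List.sum_cons] at hp
      have l1 := length_flatten_eq as1 pre ha1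
      have l2 := length_flatten_eq as2 post ha2
      have e1 := hg3' p as1.flatten a as2.flatten l1 hab l2 (by omega)
      have e2 := hg3 (p ++ a) (as1 ++ as2) (by simp [ha1, ha2]) (by simp; omega)
      have e3 := h3 p (as1 ++ [a]) as2 (by simp [ha1, hab]) ha2 (by simp; omega)
      have er : ((↑(as1 ++ a :: as2) : Multiset LB).erase a) = ↑(as1 ++ as2) := by
        have : (↑(as1 ++ a :: as2) : Multiset LB) = a ::ₘ ↑(as1 ++ as2) := by
          rw [Multiset.cons_coe]; exact Multiset.coe_eq_coe.2 List.perm_middle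
        rw [this, Multiset.erase_cons_head]
      rw [List.map_cons, List.sum_cons, er]
      push_cast
      congr 1
      · rw [rs_tt]
        simp only [List.flatten_cons, List.flatten_append, List.append_assoc] at e1 e2 ⊢
        rw [e1, e2]
      · simpa [List.append_assoc] using e3
theorem lsum_app (l : List LB) (F : LB → LB → ℤ) (x : LB) :
    (l.map F).sum x = (l.map fun a => F a x).sum := by
  induction l with
  | nil => rfl
  | cons a l ih => simp only [List.map_cons, List.sum_cons, Pi.add_apply, ih]
theorem Rr_ok (hM : MS d ms) (n : ℕ) (f : LB → ℕ) (B : ℕ) (hf : ∀ w, f w ≤ B) (hB : n.factorial * B < 2^16)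
    (bs : List ℕ) (hl : bs.length = n) (hs : bs.sum ≤ d) : RSpec d n f bs (n.factorial * B) (Rr ms n bs (pack d f)) := by
  induction n generalizing bs with
  | zero =>
    refine ⟨f, rfl, fun w => by simpa using hf w, ?_⟩
    intro p as h _
    obtain rfl := List.length_eq_zero_iff.1 hl
    obtain rfl := List.map_eq_nil_iff.1 h
    simp [Gs]
  | succ n ih =>
    have hB' : n.factorial * B < 2^16 := lt_of_le_of_lt (Nat.mul_le_mul_right _ (Nat.factorial_le (Nat.le_succ n))) hB
    obtain ⟨f', h1, h2, h3⟩ := pick_ok hM n (Rr ms n) f (n.factorial * B) (fun bs h1 h2 => ih hB' bs h1 h2) hB' bs []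
      (by simpa using hl) (by simpa using hs)
    refine ⟨f', h1, fun w => ?_, ?_⟩
    · rw [Nat.factorial_succ, mul_assoc, ← hl]; exact h2 w
    · intro p as ha hp
      have := h3 p [] as rfl ha (by simpa using hp)
      rw [Gs_succ]
      simp only [List.flatten_nil, List.append_nil, List.nil_append] at this
      rw [this]
      rw [Multiset.map_coe, Multiset.sum_coe, lsum_app]
end PD
end
section
namespace PD
theorem rot_flat {V : Type*} (e : LB → V) (hc : ∀ u v, e (u ++ v) = e (v ++ u)) (n : ℕ) (b : Fin (n+1) → LB) :
    e (List.ofFn (b ∘ finRotate (n+1))).flatten = e (List.ofFn b).flatten := by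
  have h1 : List.ofFn (b ∘ finRotate (n+1)) = List.ofFn (fun i : Fin n => b i.succ) ++ [b 0] := by
    rw [List.ofFn_succ', List.concat_eq_append]
    congr 1
    · congr 1; funext i
      simp
    · simp
  rw [h1, List.ofFn_succ, List.flatten_append, hc]
  simp
section
variable {V : Type*} [AddCommMonoid V] (e : LB → V)
theorem sum_rot (hc : ∀ u v, e (u ++ v) = e (v ++ u)) (n : ℕ) (a : Fin (n+1) → LB) :
    ∑ σ : Sy (n+1), e (List.ofFn (a ∘ σ)).flatten =
      (n+1) • ∑ τ : Sy n, e (a 0 ++ (List.ofFn ((fun i : Fin n => a i.succ) ∘ τ)).flatten) := by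
  classical
  set F : Sy (n+1) → V := fun σ => e (List.ofFn (a ∘ σ)).flatten with hF
  have hrot : ∀ (k : ℕ) σ, F (σ * finRotate (n+1) ^ k) = F σ := by
    intro k
    induction k with
    | zero => intro σ; simp
    | succ k ih =>
      intro σ
      rw [pow_succ, ← mul_assoc]
      have := rot_flat e hc n (a ∘ (σ * finRotate (n+1)^k : Equiv.Perm _))
      rw [← ih σ]
      exact this
  have hpow : ∀ j : Fin (n+1), (finRotate (n+1) ^ (j : ℕ)) 0 = j := by
    intro j
    have : ∀ k : ℕ, (finRotate (n+1) ^ k) 0 = Fin.ofNat (n+1) k := by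
      intro k
      induction k with
      | zero => simp
      | succ k ih =>
        rw [pow_succ', Equiv.Perm.mul_apply, ih, finRotate_apply]
        apply Fin.ext
        simp [Fin.val_add, Fin.ofNat]
    rw [this]
    apply Fin.ext
    simp [Fin.ofNat, Nat.mod_eq_of_lt j.2]
  have h0 : ∑ σ, (if σ 0 = 0 then F σ else 0) = ∑ τ : Sy n, e (a 0 ++ (List.ofFn ((fun i : Fin n => a i.succ) ∘ τ)).flatten) := by
    rw [← Equiv.sum_comp Equiv.Perm.decomposeFin.symm, Fintype.sum_prod_type]
    simp only [Equiv.Perm.decomposeFin_symm_apply_zero]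
    rw [Finset.sum_eq_single 0]
    · apply Finset.sum_congr rfl
      intro τ _
      rw [if_pos rfl]
      simp only [hF]
      congr 1
      rw [List.ofFn_succ]
      simp [Function.comp_def]
    · intro b _ hb; simp [hb]
    · simp
  have hj : ∀ j, ∑ σ, (if σ j = 0 then F σ else 0) = ∑ σ, (if σ 0 = 0 then F σ else 0) := by
    intro j
    rw [← Equiv.sum_comp (Equiv.mulRight (finRotate (n+1) ^ (j : ℕ)))  (fun σ => if σ 0 = 0 then F σ else 0)]
    apply Finset.sum_congr rfl
    intro σ _
    simp only [Equiv.coe_mulRight, Equiv.Perm.mul_apply, hpow, hrot]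
  calc ∑ σ, F σ = ∑ σ : Sy (n+1), ∑ j, (if σ j = 0 then F σ else 0) := by
        apply Finset.sum_congr rfl
        intro σ _
        rw [Finset.sum_eq_single (σ.symm 0)]
        · simp
        · intro j _ hj; rw [if_neg]; intro h; exact hj (by rw [← h]; simp)
        · simp
    _ = ∑ j : Fin (n+1), ∑ σ, (if σ 0 = 0 then F σ else 0) := by
        rw [Finset.sum_comm]; exact Finset.sum_congr rfl fun j _ => hj j
    _ = _ := by rw [Finset.sum_const, h0]; simp
theorem sum_perm (n : ℕ) (a : Fin n → LB) (π : Sy n) :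
    ∑ σ : Sy n, e (List.ofFn ((a ∘ π) ∘ σ)).flatten = ∑ σ : Sy n, e (List.ofFn (a ∘ σ)).flatten := by
  rw [← Equiv.sum_comp (Equiv.mulLeft π) (fun σ : Sy n => e (List.ofFn (a ∘ σ)).flatten)]
  rfl
theorem sort_len (n : ℕ) (a : Fin n → LB) : ∃ π : Sy n, (List.ofFn fun i => (a (π i)).length).Pairwise (· ≥ ·) := by
  refine ⟨Tuple.sort (fun i => OrderDual.toDual (a i).length), ?_⟩
  have := Tuple.monotone_sort (fun i => OrderDual.toDual (a i).length)
  rw [List.pairwise_ofFn]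
  intro i j hij
  exact this hij.le
end
theorem gen_mem (bs : List ℕ) (m : ℕ) (h : bs.Pairwise (· ≥ ·)) (h1 : ∀ b ∈ bs, 1 ≤ b ∧ b ≤ m) : bs ∈ gen bs.length m bs.sum := by
  induction bs generalizing m with
  | nil => simp [gen]
  | cons b bs ih =>
    have key : ∀ m, b ≤ m → b :: bs ∈ gen (bs.length+1) m (b + bs.sum) := by
      intro m hm
      induction m with
      | zero => have := h1 b (by simp); omega
      | succ a iha =>
        have hd : gen (bs.length+1) (a+1) (b + bs.sum) = cond (Nat.ble (a+1) (b+bs.sum)) (((gen bs.length (a+1) (b+bs.sum - (a+1))).map (List.cons (a+1))) ++ gen (bs.length+1) a (b+bs.sum)) (gen (bs.length+1) a (b+bs.sum)) := rfl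
        rw [hd]
        rcases Nat.lt_or_ge a b with hab | hab
        · have : b = a+1 := by omega
          subst this
          have hb : Nat.ble (a+1) (a+1+bs.sum) = true := Nat.ble_eq ▸ (by omega)
          rw [hb, cond_true, List.mem_append]
          left
          rw [List.pairwise_cons] at h
          apply List.mem_map_of_mem
          rw [Nat.add_sub_cancel_left]
          exact ih (a+1) h.2 fun x hx => ⟨(h1 x (by simp [hx])).1, h.1 x hx⟩
        · have := iha hab
          cases Nat.ble (a+1) (b+bs.sum)
          · exact this
          · rw [cond_true, List.mem_append]; exact Or.inr this
    exact key m (h1 b (by simp)).2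
end PD
end
section
namespace PD
theorem frcE_eq {α : Type} (e : ℕ × ℕ × ℕ) (f : ℕ × ℕ × ℕ → α) : frcE e f = f e := by
  obtain ⟨a, b, c⟩ := e
  have : frcE (a, b, c) f = frc a fun a => frc b fun b => frc c fun c => f (a, b, c) := rfl
  rw [this, frc_eq, frc_eq, frc_eq]
theorem mkM_eq {α : Type} (d n k : ℕ) (f : List (ℕ × ℕ × ℕ) → α) : mkM d n k f = f ((List.range' k n).map (mkE d)) := by
  induction n generalizing k f with
  | zero => rfl
  | succ n ih =>
    have : mkM d (n+1) k f = frcE (mkE d k) fun e => frc (k+1) fun k => mkM d n k fun l => f (e :: l) := rfl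
    rw [this, frcE_eq, frc_eq, ih, List.range'_succ, List.map_cons]
theorem MS_mkM (d : ℕ) : MS d ((List.range' 0 (d-1)).map (mkE d)) := by
  intro k hk
  rw [nth_eq, List.getElem?_map, List.getElem?_range' (by omega)]
  simp
theorem cond_and {a b : Bool} (h : cond a b false = true) : a = true ∧ b = true := by
  cases a
  · cases h
  · exact ⟨rfl, h⟩
theorem blds_eq {α : Type} (ms : List (ℕ × ℕ × ℕ)) (d : ℕ) (ns : List ℕ) (k : List ℕ → α) : ∃ Xs, blds ms d ns k = k Xs := by
  induction ns generalizing k with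
  | nil => exact ⟨[], rfl⟩
  | cons n ns ih =>
    have : blds ms d (n :: ns) k = frc (bld ms d n) fun X => blds ms d ns fun t => k (X :: t) := rfl
    obtain ⟨t, ht⟩ := ih (fun t => k (bld ms d n :: t))
    exact ⟨_, by rw [this, frc_eq, ht]⟩
theorem allT_ok (ms : List (ℕ × ℕ × ℕ)) (d : ℕ) (l : List (List ℕ)) (Xs : List ℕ) (h : allT ms d l Xs = true) :
    ∀ X ∈ Xs, chkT ms d X l = true := by
  induction Xs with
  | nil => simp
  | cons X Xs ih =>
    have h' : cond (chkT ms d X l) (allT ms d l Xs) false = true := h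
    obtain ⟨h1, h2⟩ := cond_and h'
    intro Y hY
    rcases List.mem_cons.1 hY with rfl | hY
    · exact h1
    · exact ih h2 Y hY
theorem allQ_ok (d : ℕ) (Xs : List ℕ) (ql : List (List ℕ)) (h : allQ d Xs ql = true) : ∀ cs ∈ ql, allC d Xs cs cs = true := by
  induction ql with
  | nil => simp
  | cons X ql ih =>
    have h' : cond (allC d Xs X X) (allQ d Xs ql) false = true := h
    obtain ⟨h1, h2⟩ := cond_and h'
    intro Y hY
    rcases List.mem_cons.1 hY with rfl | hY
    · exact h1
    · exact ih h2 Y hY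
theorem allC_ok (d : ℕ) (Xs cs l : List ℕ) (h : allC d Xs cs l = true) : ∀ c ∈ l, anyT d c cs Xs = true := by
  induction l with
  | nil => simp
  | cons X l ih =>
    have h' : cond (anyT d X cs Xs) (allC d Xs cs l) false = true := h
    obtain ⟨h1, h2⟩ := cond_and h'
    intro Y hY
    rcases List.mem_cons.1 hY with rfl | hY
    · exact h1
    · exact ih h2 Y hY
theorem anyT_ok (d c : ℕ) (cs Xs : List ℕ) (h : anyT d c cs Xs = true) : ∃ X ∈ Xs, dualT d X c cs = true := by
  induction Xs with
  | nil => cases h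
  | cons X Xs ih =>
    have h' : cond (dualT d X c cs) true (anyT d c cs Xs) = true := h
    cases hh : dualT d X c cs
    · rw [hh] at h'
      obtain ⟨Y, hY, h⟩ := ih h'
      exact ⟨Y, by simp [hY], h⟩
    · exact ⟨X, by simp, hh⟩
theorem dualT_ok (d X c : ℕ) (cs : List ℕ) (h : dualT d X c cs = true) :
    ∀ c' ∈ cs, (c' = c → getT d X c' ≠ 256) ∧ (c' ≠ c → getT d X c' = 256) := by
  induction cs with
  | nil => simp
  | cons a cs ih =>
    have h' : cond (Nat.beq c a) (cond (Nat.beq (getT d X a) 256) false (dualT d X c cs)) (cond (Nat.beq (getT d X a) 256) (dualT d X c cs) false) = true := h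
    have : ((a = c → getT d X a ≠ 256) ∧ (a ≠ c → getT d X a = 256)) ∧ dualT d X c cs = true := by
      cases h1 : Nat.beq c a <;> cases h2 : Nat.beq (getT d X a) 256 <;> rw [h1, h2] at h'
      · cases h'
      · have h2' := Nat.eq_of_beq_eq_true h2
        have h1' := Nat.ne_of_beq_eq_false h1
        exact ⟨⟨fun h => absurd h.symm h1', fun _ => h2'⟩, h'⟩
      · have h2' := Nat.ne_of_beq_eq_false h2
        have h1' := Nat.eq_of_beq_eq_true h1
        exact ⟨⟨fun _ => h2', fun h => absurd h1'.symm h⟩, h'⟩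
      · cases h'
    intro Y hY
    rcases List.mem_cons.1 hY with rfl | hY
    · exact this.1
    · exact ih this.2 Y hY
theorem chkS_ok (ms : List (ℕ × ℕ × ℕ)) (X C : ℕ) (l : List (List ℕ)) (h : chkS ms X C l = true) :
    ∀ b t, b :: t ∈ l → Rr ms 5 t X = C := by
  induction l with
  | nil => simp
  | cons bs l ih =>
    have h' : cond (LR Bool true (fun _ t _ => frcL t fun t => Nat.beq (Rr ms 5 t X) C) bs) (chkS ms X C l) false = true := h
    obtain ⟨h1, h2⟩ := cond_and h'
    intro b t hY
    rcases List.mem_cons.1 hY with rfl | hY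
    · have h1' : (frcL t fun t => Nat.beq (Rr ms 5 t X) C) = true := h1
      rw [frcL_eq] at h1'
      exact Nat.eq_of_beq_eq_true h1'
    · exact ih h2 b t hY
theorem chkT_ok (d X : ℕ) (ms) (hM : MS d ms) (hd : 1 ≤ d) (h : chkT ms d X (gen 6 d d) = true) :
    (∀ A x, A.length + 1 = d → X / 2^(16 * idx (A ++ [x])) % 2^16 = X / 2^(16 * idx (x :: A)) % 2^16) ∧
    ∀ a : Fin 6 → LB, (∀ i, a i ≠ []) → ∑ i, (a i).length = d → (List.ofFn fun i => (a i).length).Pairwise (· ≥ ·) →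
      ∑ τ : Sy 5, (((X / 2^(16 * idx (a 0 ++ (List.ofFn ((fun i : Fin 5 => a i.succ) ∘ τ)).flatten)) % 2^16 : ℕ) : ℤ) - 256) = 0 := by
  obtain ⟨h1, h⟩ := cond_and h
  obtain ⟨h2, h⟩ := cond_and h
  obtain ⟨h3, h⟩ := cond_and h
  rw [frc_eq] at h
  have h1 : X < 2^(16*2^d) := Nat.le_of_ble_eq_true h1
  have h2 := Nat.eq_of_beq_eq_true h2
  have h3 := Nat.eq_of_beq_eq_true h3
  set f : LB → ℕ := fun w => X / 2^(16 * idx w) % 2^16 with hf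
  have hX : X = pack d f := unpack d X h1
  have hlt : ∀ w, f w < 2^16 := fun w => Nat.mod_lt _ (by norm_num)
  have h511 : ∀ w, w.length = d → f w ≤ 511 := by
    intro w hw
    have h2' : X &&& mdup d 0 511 = X := h2
    rw [mdup_const, hX, pack_land d _ _ hlt (fun _ => by norm_num)] at h2'
    have := pack_inj d _ _ (fun w => lt_of_le_of_lt Nat.and_le_left (hlt w)) hlt h2' w hw
    rw [← this]; exact Nat.and_le_right
  set g : LB → ℕ := fun w => if w.length = d then f w else 0 with hg
  have hXg : X = pack d g := by
    rw [hX]; apply pack_congr; intro w hw; rw [hg]; simp [hw]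
  have hg511 : ∀ w, g w ≤ 511 := by
    intro w; rw [hg]; dsimp only; split_ifs with hh
    · exact h511 w hh
    · omega
  have hfg : ∀ w, w.length = d → X / 2^(16 * idx w) % 2^16 = g w := fun w hw => by rw [hg]; simp [hw, hf]
  constructor
  · intro A x hA
    obtain ⟨f', e1, e2, e3⟩ := mv1_ok hM (d-1) 0 511 (by omega) (by norm_num) g hg511
    have h3' : mv1 ms (d-1) 0 X = X := h3
    rw [hXg, e1] at h3'
    have := e3 [] A x [] (by omega) rfl (by simp; omega)
    simp only [List.nil_append, List.append_nil] at this
    have h4 := pack_inj d _ _ (fun w => (e2 w).trans_lt (by norm_num)) (fun w => (hg511 w).trans_lt (by norm_num)) h3' (A ++ [x]) (by simp [hA])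
    rw [hfg _ (by simp [hA]), hfg _ (by simp [hA]), ← h4, this]
  · intro a ha hs hso
    have hmem : (List.ofFn fun i => (a i).length) ∈ gen 6 d d := by
      have := gen_mem (List.ofFn fun i => (a i).length) d hso (by
        intro b hb
        rw [List.mem_ofFn] at hb
        obtain ⟨i, rfl⟩ := hb
        refine ⟨List.length_pos_iff.2 (ha i), ?_⟩
        rw [← hs]
        exact Finset.single_le_sum (f := fun i => (a i).length) (fun _ _ => Nat.zero_le _) (Finset.mem_univ i))
      rw [List.length_ofFn, List.sum_ofFn, hs] at this
      exact this
    rw [List.ofFn_succ] at hmem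
    have hR := chkS_ok ms X _ _ h _ _ hmem
    rw [Fin.sum_univ_succ] at hs
    obtain ⟨f', e1, e2, e3⟩ := Rr_ok hM 5 g 511 hg511 (by decide) (List.ofFn fun i : Fin 5 => (a i.succ).length) (by simp)
      (by rw [List.sum_ofFn]; omega)
    have := e3 (a 0) (List.ofFn fun i : Fin 5 => a i.succ) (by rw [List.map_ofFn]; rfl) (by rw [List.sum_ofFn]; exact hs)
    rw [← hXg, hR] at e1
    have e1' : mdup d 0 30720 = pack d f' := e1
    rw [mdup_const] at e1'
    have h4 := pack_inj d _ _ (fun w => by norm_num) (fun w => (e2 w).trans_lt (by decide)) e1' (a 0 ++ (List.ofFn fun i : Fin 5 => a i.succ).flatten)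
      (by rw [List.length_append, List.length_flatten, List.map_ofFn, List.sum_ofFn]; exact hs)
    rw [← h4, Gs_perm, Finset.sum_apply] at this
    simp only [rs_tt, List.append_nil] at this
    rw [Finset.sum_sub_distrib]
    have h5 : ∀ τ : Sy 5, X / 2^(16 * idx (a 0 ++ (List.ofFn ((fun i : Fin 5 => a i.succ) ∘ τ)).flatten)) % 2^16 =
        g (a 0 ++ (List.ofFn ((fun i : Fin 5 => a i.succ) ∘ τ)).flatten) := by
      intro τ
      apply hfg
      rw [List.length_append, List.length_flatten, List.map_ofFn, List.sum_ofFn, ← hs]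
      congr 1
      exact Equiv.sum_comp τ (fun i : Fin 5 => (a i.succ).length)
    simp only [h5]
    rw [← this, Finset.sum_const, Finset.card_univ, Fintype.card_perm, Fintype.card_fin]
    norm_num [Nat.factorial]
theorem E_main (i : ℕ) (hi : i < 15) (cs : List ℕ) (hcs : cs ∈ blist.getD i []) (c : ℕ) (hc : c ∈ cs) :
    ∃ f : LB → ℤ, (∀ u v, f (u ++ v) = f (v ++ u)) ∧
      (∀ a : Fin 6 → LB, (∀ i, a i ≠ []) → ∑ j, (a j).length = i + 1 →
        ∑ σ : Sy 6, f (List.ofFn (a ∘ σ)).flatten = 0) ∧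
      ∀ w, w.length = i+1 → 2^(i+1) + idx w ∈ cs → (2^(i+1) + idx w = c → f w ≠ 0) ∧ (2^(i+1) + idx w ≠ c → f w = 0) := by
  have h := chk_true i hi
  unfold chkD at h
  rw [mkM_eq] at h
  obtain ⟨Xs, hXs⟩ := blds_eq ((List.range' 0 (i+1-1)).map (mkE (i+1))) (i+1) (ldat.getD i []) fun Xs =>
    cond (allT ((List.range' 0 (i+1-1)).map (mkE (i+1))) (i+1) (gen (nat_lit 6) (i+1) (i+1)) Xs) (allQ (i+1) Xs (blist.getD i [])) false
  obtain ⟨h1, h2⟩ := cond_and (hXs.symm.trans h)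
  obtain ⟨X, hX, hd⟩ := anyT_ok _ _ _ _ (allC_ok _ _ _ _ (allQ_ok _ _ _ h2 cs hcs) c hc)
  obtain ⟨k1, k2⟩ := chkT_ok (i+1) X _ (MS_mkM (i+1)) (by omega) (allT_ok _ _ _ _ h1 X hX)
  set f : LB → ℤ := fun w => if w.length = i+1 then ((X / 2^(16 * idx w) % 2^16 : ℕ) : ℤ) - 256 else 0 with hf
  have hf1 : ∀ A x, f (A ++ [x]) = f (x :: A) := by
    intro A x
    by_cases h : A.length + 1 = i+1
    · simp only [hf, List.length_append, List.length_cons, List.length_nil, zero_add, h, if_true, k1 A x h]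
    · simp only [hf, List.length_append, List.length_cons, List.length_nil, zero_add, h, if_false]
  have hcyc : ∀ u v, f (u ++ v) = f (v ++ u) := by
    intro u
    induction u with
    | nil => intro v; simp
    | cons x u ih =>
      intro v
      have := ih (v ++ [x])
      rw [← List.append_assoc, hf1] at this
      simpa using this
  refine ⟨f, hcyc, ?_, ?_⟩
  · intro a ha hs
    obtain ⟨π, hπ⟩ := sort_len 6 a
    rw [← sum_perm f 6 a π, sum_rot f hcyc 5 (a ∘ π)]
    have hs' : ∑ j, ((a ∘ π) j).length = i+1 := by rw [← hs]; exact Equiv.sum_comp π (fun j => (a j).length)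
    have := k2 (a ∘ π) (fun j => ha _) hs' hπ
    convert smul_zero _
    rw [← this]
    apply Finset.sum_congr rfl
    intro τ _
    simp only [hf]
    rw [if_pos]
    rw [List.length_append, List.length_flatten, List.map_ofFn, List.sum_ofFn, ← hs', Fin.sum_univ_succ]
    congr 1
    exact Equiv.sum_comp τ (fun i : Fin 5 => ((a ∘ π) i.succ).length)
  · intro w hw hm
    have := dualT_ok _ _ _ _ hd _ hm
    have hg : getT (i+1) X (2^(i+1) + idx w) = X / 2^(16 * idx w) % 2^16 := by
      have : getT (i+1) X (2^(i+1) + idx w) = (X >>> (16 * (2^(i+1) + idx w - 2^(i+1)))) % 65536 := rfl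
      rw [this, Nat.add_sub_cancel_left, Nat.shiftRight_eq_div_pow]; norm_num
    rw [hg] at this
    simp only [hf, hw, if_true]
    refine ⟨fun h hh => this.1 h ?_, fun h => ?_⟩
    · omega
    · rw [this.2 h]; norm_num
end PD
end
section
namespace PD
def wd (c : ℕ) : LB := (dcd 20 c).reverse
def lowW : List LB := blist.flatten.flatten.map wd
def BL : List LB := lowW ++ (lowW.filter (fun w => decide (2 * ct w < w.length))).map (List.map not)
def Bs : Finset LB := BL.toFinset
theorem Bs_card : Bs.card = 173 := by decide +kernel
theorem bl_len : blist.length = 15 := by decide +kernel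
def chkB : Bool := (List.range 15).all fun i => (List.range (blist.getD i []).length).all fun q =>
  ((blist.getD i []).getD q []).all fun c => decide ((wd c).length = i+1) && decide (ct (wd c) = q) && decide (2^(i+1) + idx (wd c) = c) && decide (2 * q ≤ i+1)
theorem chkB_true : chkB = true := by decide +kernel
theorem low_ex (b : LB) (hb : b ∈ lowW) : ∃ i q c, i < 15 ∧ ((blist.getD i []).getD q []) ∈ blist.getD i [] ∧ c ∈ (blist.getD i []).getD q [] ∧ b = wd c ∧ b.length = i+1 ∧
    ct b = q ∧ 2^(i+1) + idx b = c ∧ 2*q ≤ i+1 := by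
  unfold lowW at hb
  rw [List.mem_map] at hb
  obtain ⟨c, hc, rfl⟩ := hb
  rw [List.mem_flatten] at hc
  obtain ⟨cs, hcs, hc⟩ := hc
  rw [List.mem_flatten] at hcs
  obtain ⟨ql, hql, hcs⟩ := hcs
  obtain ⟨i, hi, hql⟩ := List.mem_iff_getElem.1 hql
  obtain ⟨q, hq, hcs'⟩ := List.mem_iff_getElem.1 hcs
  have e1 : blist.getD i [] = ql := by rw [List.getD_eq_getElem _ _ hi, hql]
  have e2 : ql.getD q [] = cs := by rw [List.getD_eq_getElem _ _ hq, hcs']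
  rw [bl_len] at hi
  have h := chkB_true
  unfold chkB at h
  rw [List.all_eq_true] at h
  have h := h i (List.mem_range.2 hi)
  rw [List.all_eq_true, e1] at h
  have h := h q (List.mem_range.2 hq)
  rw [List.all_eq_true, e2] at h
  have h := h c hc
  simp only [Bool.and_eq_true, decide_eq_true_eq] at h
  exact ⟨i, q, c, hi, by rw [e1, e2]; exact hcs, by rw [e1, e2]; exact hc, rfl, h.1.1.1, h.1.1.2, h.1.2, h.2⟩
theorem ct_flat (n : ℕ) (a : Fin n → LB) (σ : Sy n) : ct (List.ofFn (a ∘ σ)).flatten = ct (List.ofFn a).flatten := by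
  unfold ct
  exact (List.Perm.flatten (Equiv.Perm.ofFn_comp_perm σ a)).count_eq _
/-- `φ` is a functional in degree `d` -/
def Fnl (d : ℕ) (φ : LB → ℤ) : Prop := (∀ u v, φ (u ++ v) = φ (v ++ u)) ∧
  (∀ a : Fin 6 → LB, (∀ i, a i ≠ []) → ∑ j, (a j).length = d →
        ∑ σ : Sy 6, φ (List.ofFn (a ∘ σ)).flatten = 0)
theorem low_dual (b : LB) (hb : b ∈ lowW) : ∃ φ, Fnl b.length φ ∧ φ b ≠ 0 ∧ (∀ b' ∈ lowW, b' ≠ b → b'.length = b.length → φ b' = 0) ∧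
    ∀ w, ct w ≠ ct b → φ w = 0 := by
  obtain ⟨i, q, c, hi, hcs, hc, hbc, hl, hq, hx, hq2⟩ := low_ex b hb
  obtain ⟨f, f1, f2, f3⟩ := E_main i hi _ hcs c hc
  refine ⟨fun w => if ct w = q then f w else 0, ⟨?_, ?_⟩, ?_, ?_, ?_⟩
  · intro u v
    have : ct (u ++ v) = ct (v ++ u) := by simp [ct, add_comm]
    simp only [this, f1 u v]
  · intro a ha hs
    simp only [ct_flat]
    split_ifs
    · exact f2 a ha (by omega)
    · simp
  · simp only [hq, if_true]
    exact (f3 b hl (by rw [hx]; exact hc)).1 hx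
  · intro b' hb' hne hlen
    obtain ⟨i', q', c', hi', hcs', hc', hbc', hl', hq', hx', -⟩ := low_ex b' hb'
    have : i' = i := by omega
    subst this
    dsimp only
    split_ifs with h
    · have : q' = q := by omega
      subst this
      apply (f3 b' hl' (by rw [hx']; exact hc')).2
      intro h
      exact hne (by rw [hbc', hbc, ← hx', h])
    · rfl
  · intro w hw
    exact if_neg (by omega)
theorem ct_not (w : LB) : ct (w.map not) + ct w = w.length := by
  induction w with
  | nil => rfl
  | cons l w ih => cases l <;> simp [ct] at ih ⊢ <;> omega
theorem not_not (w : LB) : (w.map not).map not = w := by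
  induction w with
  | nil => rfl
  | cons l w ih => simp only [List.map_cons, ih, Bool.not_not]
theorem mem_Bs (b : LB) : b ∈ Bs ↔ b ∈ lowW ∨ (b.map not ∈ lowW ∧ b.length < 2 * ct b) := by
  unfold Bs BL
  rw [List.mem_toFinset, List.mem_append, List.mem_map]
  apply or_congr Iff.rfl
  constructor
  · rintro ⟨w, hw, rfl⟩
    rw [List.mem_filter, decide_eq_true_eq] at hw
    have := ct_not w
    rw [not_not, List.length_map]
    exact ⟨hw.1, by omega⟩
  · rintro ⟨h1, h2⟩
    refine ⟨b.map not, ?_, not_not b⟩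
    rw [List.mem_filter, decide_eq_true_eq, List.length_map]
    have := ct_not b
    exact ⟨h1, by omega⟩
theorem low_ct (b : LB) (hb : b ∈ lowW) : 2 * ct b ≤ b.length ∧ b ≠ [] := by
  obtain ⟨i, q, c, hi, hcs, hc, hbc, hl, hq, hx, hq2⟩ := low_ex b hb
  refine ⟨by omega, ?_⟩
  rintro rfl
  simp at hl
theorem Bs_ne (b : LB) (hb : b ∈ Bs) : b ≠ [] := by
  rcases (mem_Bs b).1 hb with h | h
  · exact (low_ct b h).2
  · intro hh; exact (low_ct _ h.1).2 (by simp [hh])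
theorem flat_not (n : ℕ) (a : Fin n → LB) : (List.ofFn a).flatten.map not = (List.ofFn fun i => (a i).map not).flatten := by
  rw [List.map_flatten, List.map_ofFn]; rfl
theorem B_dual (b : LB) (hb : b ∈ Bs) : ∃ φ, Fnl b.length φ ∧ φ b ≠ 0 ∧ ∀ b' ∈ Bs, b' ≠ b → b'.length = b.length → φ b' = 0 := by
  rcases (mem_Bs b).1 hb with h | ⟨h, hh⟩
  · obtain ⟨φ, h1, h2, h3, h4⟩ := low_dual b h
    refine ⟨φ, h1, h2, ?_⟩
    intro b' hb' hne hl
    rcases (mem_Bs b').1 hb' with h' | ⟨h', hh'⟩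
    · exact h3 b' h' hne hl
    · apply h4
      have := low_ct b h
      omega
  · obtain ⟨φ, h1, h2, h3, h4⟩ := low_dual _ h
    rw [List.length_map] at h1 h3
    refine ⟨fun w => φ (w.map not), ⟨?_, ?_⟩, h2, ?_⟩
    · intro u v
      simp only [List.map_append]; exact h1.1 _ _
    · intro a ha hs
      have := h1.2 (fun i => (a i).map not) (fun i => by simpa using ha i) (by simpa using hs)
      rw [← this]
      apply Finset.sum_congr rfl
      intro σ _
      show φ ((List.ofFn (a ∘ σ)).flatten.map not) = _
      rw [flat_not]; rfl
    · intro b' hb' hne hl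
      rcases (mem_Bs b').1 hb' with h' | ⟨h', hh'⟩
      · apply h4
        have := low_ct b' h'
        have := ct_not b
        have := ct_not b'
        omega
      · apply h3 _ h'
        · intro e; apply hne; rw [← not_not b', e, not_not]
        · simpa using hl
theorem Bs_li (K : Type*) [Field K] [CharZero K] : LinearIndepOn K (ee K 5) (Bs : Set LB) := by
  have key : ∀ b ∈ Bs, ∃ Λ : EE K 5 →ₗ[K] K, Λ (ee K 5 b) ≠ 0 ∧ ∀ b' ∈ Bs, b' ≠ b → Λ (ee K 5 b') = 0 := by
    intro b hb
    obtain ⟨φ, h1, h2, h3⟩ := B_dual b hb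
    have hne := List.length_pos_iff.2 (Bs_ne b hb)
    obtain ⟨Λ, l1, l2, l3⟩ := exists_functional (K := K) (n := 5) (fun w => (φ w : K)) (b.length - 1)
      (fun u v => by rw [h1.1]) (fun a ha hs => by
        have := h1.2 a ha (hs.trans (by omega))
        exact_mod_cast congrArg (Int.cast : ℤ → K) this)
    refine ⟨(Dec K 5).liftQ Λ (fun x hx => l1 x hx), ?_, ?_⟩
    · have : (Dec K 5).liftQ Λ (fun x hx => l1 x hx) (ee K 5 b) = Λ (trw K 5 b) := rfl
      rw [this, l2 b (by omega)]
      exact_mod_cast h2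
    · intro b' hb' hn
      have : (Dec K 5).liftQ Λ (fun x hx => l1 x hx) (ee K 5 b') = Λ (trw K 5 b') := rfl
      rw [this]
      by_cases hl : b'.length = b.length
      · rw [l2 b' (by omega), h3 b' hb' hn hl]; simp
      · exact l3 b' (by omega)
  rw [linearIndepOn_iff']
  intro t g ht hsum b hbt
  obtain ⟨Λ, l1, l2⟩ := key b (ht hbt)
  have := congrArg Λ hsum
  rw [map_sum, map_zero, Finset.sum_eq_single b] at this
  · rw [map_smul, smul_eq_mul] at this
    exact (mul_eq_zero.1 this).resolve_right l1
  · intro b' hb' hn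
    rw [map_smul, l2 b' (ht hb') hn, smul_zero]
  · intro h; exact absurd hbt h
end PD
end
section
namespace PD
/-- cyclic and symmetric relations -/
def CS {V : Type*} [AddCommGroup V] (e : LB → V) : Prop := (∀ u v, e (u ++ v) = e (v ++ u)) ∧
  ∀ a : Fin 6 → LB, (∀ i, a i ≠ []) → ∑ σ : Sy 6, e (List.ofFn (a ∘ σ)).flatten = 0
theorem CS_not {V : Type*} [AddCommGroup V] (e : LB → V) (h : CS e) : CS (fun w => e (w.map not)) := by
  constructor
  · intro u v; simp only [List.map_append]; exact h.1 _ _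
  · intro a ha
    have := h.2 (fun i => (a i).map not) (fun i => by simpa using ha i)
    rw [← this]
    apply Finset.sum_congr rfl
    intro σ _
    show e ((List.ofFn (a ∘ σ)).flatten.map not) = _
    rw [flat_not]; rfl
theorem s5 {V : Type*} [AddCommGroup V] (h7 : ∀ v : V, 7 • v = 0) (e : LB → V) (h : CS e) (c : LB) (hc : c ≠ [])
    (a : Fin 5 → LB) (ha : ∀ i, a i ≠ []) : ∑ τ : Sy 5, e (c ++ (List.ofFn (a ∘ τ)).flatten) = 0 := by
  have h1 := h.2 (Fin.cons c a : Fin 6 → LB) (fun i => by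
    refine Fin.cases ?_ (fun j => ?_) i
    · exact hc
    · exact ha j)
  rw [sum_rot e h.1 5] at h1
  simp only [Fin.cons_zero, Fin.cons_succ] at h1
  set S := ∑ τ : Sy 5, e (c ++ (List.ofFn (a ∘ τ)).flatten) with hS
  have h2 : (6:ℕ) • S = 0 := h1
  have h3 := h7 S
  have : (7:ℕ) • S = (6:ℕ) • S + S := succ_nsmul S 6
  rw [this, h2, zero_add] at h3
  exact h3
section
variable {V : Type*} [AddCommGroup V] (e : LB → V)
def ehh (w : LB) : Bool → LB → V := fun l v => e (w.reverse ++ l :: v)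
def rho (V : Type*) [AddCommGroup V] (l : Bool) : (Bool → LB → V) →+ (Bool → LB → V) where
  toFun g := fun l0 v => g l (l0 :: v)
  map_zero' := rfl
  map_add' _ _ := rfl
def evv (V : Type*) [AddCommGroup V] (l : Bool) : (Bool → LB → V) →+ V where
  toFun g := g l []
  map_zero' := rfl
  map_add' _ _ := rfl
theorem ehh_cons (l : Bool) (w : LB) : ehh e (l :: w) = rho V l (ehh e w) := by
  funext l0 v
  simp [ehh, rho]
theorem evw_eq (w : LB) (hw : w ≠ []) : evw (ehh e) (evv V) w = e w.reverse := by
  cases w with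
  | nil => exact absurd rfl hw
  | cons l w => simp [evw, evv, ehh]
theorem Inv0 : Inv (rho V) (ehh e) 0 [] ini := by
  refine ⟨fun _ q => gl ini q, ?_, rfl, fun q => rfl, rfl, ?_⟩
  · intro l m q rows h
    have : lookup [] l m q = none := rfl
    rw [this] at h; cases h
  · intro w hw _
    obtain rfl := List.length_eq_zero_iff.1 hw
    apply AddSubmonoid.subset_closure
    show ehh e [] ∈ (gl ini 0).map (ehh e)
    have : gl ini 0 = [[]] := rfl
    rw [this]; simp
theorem run_app (h7 : ∀ v : V, 7 • v = 0) (h : CS e) :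
    (∀ i g, (gdat.zip edat)[i]? = some g → ∀ q ex, g.2[q]? = some ex → q ≤ 7 → ∀ w, w.length = 0+i+1 → ct w = q →
      evw (ehh e) (evv V) w ∈ AddSubmonoid.closure {v | ∃ b, code b ∈ ex.1 ∧ evw (ehh e) (evv V) b = v}) ∧
    (∀ w, w.length = 0 + (gdat.zip edat).length → ct w ≤ 7 → ehh e w = 0) := by
  refine run_ok (ρ := rho V) (eh := ehh e) (ev := evv V) ?_ h7 ?_ (ehh_cons e) ?_ (gdat.zip edat) 0 [] ini (Inv0 e) run_true
  · intro v; funext l u; exact h7 _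
  · intro u a ha
    simp only [rs_eh (ehh_cons e)]
    funext l v
    rw [Finset.sum_apply, Finset.sum_apply]
    have := s5 h7 e h (l :: v ++ u.reverse) (by simp) a ha
    rw [Pi.zero_apply, Pi.zero_apply, ← this]
    apply Finset.sum_congr rfl
    intro τ _
    simp only [ehh, List.reverse_append, List.reverse_reverse]
    rw [h.1, List.append_assoc]
  · intro l l1 w
    simp only [evv, ehh, AddMonoidHom.coe_mk, ZeroHom.coe_mk, List.reverse_cons, List.reverse_append, List.reverse_nil, List.nil_append]
    rw [h.1]
    simp
theorem code_dcd (n : ℕ) (b : LB) (hb : b.length ≤ n) : dcd n (code b) = b := by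
  induction n generalizing b with
  | zero => rw [List.length_eq_zero_iff.1 (Nat.le_zero.1 hb)]; rfl
  | succ n ih =>
    cases b with
    | nil => rfl
    | cons l b =>
      have hp : ∀ b : LB, 1 ≤ code b := by
        intro b
        induction b with
        | nil => exact le_rfl
        | cons l b ih => have : code (l :: b) = 2 * code b + cond l 1 0 := rfl
                         omega
      have hc : code (l :: b) = 2 * code b + cond l 1 0 := rfl
      have hd : ∀ c, dcd (n+1) c = cond (Nat.ble c 1) [] (Nat.beq (c % 2) 1 :: dcd n (c / 2)) := fun _ => rfl
      have h1 : Nat.ble (code (l :: b)) 1 = false := by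
        cases hh : Nat.ble (code (l :: b)) 1
        · rfl
        · have := Nat.le_of_ble_eq_true hh
          have := hp b
          omega
      have h2 : code (l :: b) / 2 = code b := by rw [hc]; cases l <;> simp <;> omega
      have h3 : Nat.beq (code (l :: b) % 2) 1 = l := by
        have : code (l :: b) % 2 = cond l 1 0 := by rw [hc]; cases l <;> simp <;> omega
        rw [this]; cases l <;> rfl
      rw [hd, h1, h2, h3, cond_false, ih b (by simpa using hb)]
theorem code_lt (b : LB) : 2 ^ b.length ≤ code b := by
  induction b with
  | nil => exact le_rfl
  | cons l b ih => have : code (l :: b) = 2 * code b + cond l 1 0 := rfl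
                   rw [List.length_cons, pow_succ]; omega
def chkC : Bool := (List.range 15).all fun i => ((edat.getD i []).all fun p => p.1.all fun c => decide (c < 2^20)) &&
  (decide (i = 0) || (decide ((edat.getD i []).length = (i+1)/2 + 1) && decide (blist.getD i [] = (edat.getD i []).map Prod.fst)))
theorem chkC_true : chkC = true := by decide +kernel
theorem edat_len : edat.length = 15 := by decide +kernel
theorem gdat_len : gdat.length = 15 := by decide +kernel
theorem D_low (h7 : ∀ v : V, 7 • v = 0) (h : CS e) (w : LB) (h2 : 2 ≤ w.length) (h15 : w.length ≤ 15) (hct : 2 * ct w ≤ w.length) :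
    e w ∈ AddSubmonoid.closure (e '' {b | b ∈ lowW ∧ b.length = w.length ∧ ct b = ct w}) := by
  obtain ⟨i, hi⟩ : ∃ i, w.length = i + 1 := ⟨w.length - 1, by omega⟩
  have hi15 : i < 15 := by omega
  have hC := chkC_true
  unfold chkC at hC
  rw [List.all_eq_true] at hC
  have hC := hC i (List.mem_range.2 hi15)
  simp only [Bool.and_eq_true, Bool.or_eq_true, decide_eq_true_eq, List.all_eq_true] at hC
  obtain ⟨hC1, hC2⟩ := hC
  obtain ⟨hC2, hC3⟩ := hC2.resolve_left (by omega)
  have hie : i < edat.length := by rw [edat_len]; exact hi15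
  have hig : i < gdat.length := by rw [gdat_len]; exact hi15
  have e1 : edat.getD i [] = edat[i] := List.getD_eq_getElem _ _ hie
  have hz : (gdat.zip edat)[i]? = some (gdat[i], edat[i]) := by
    rw [List.getElem?_zip_eq_some]; exact ⟨List.getElem?_eq_getElem hig, List.getElem?_eq_getElem hie⟩
  rw [e1] at hC1 hC2 hC3
  have hq : ct w < edat[i].length := by omega
  have hr := (run_app e h7 h).1 i _ hz (ct w) edat[i][ct w] (List.getElem?_eq_getElem hq) (by omega) w.reverse (by simp; omega) (by simp [ct])
  have hw0 : w ≠ [] := by rintro rfl; simp at h2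
  rw [evw_eq e _ (by simpa using hw0), List.reverse_reverse] at hr
  refine AddSubmonoid.closure_le.2 ?_ hr
  rintro v ⟨b, hb, rfl⟩
  by_cases hb0 : b = []
  · subst hb0; exact AddSubmonoid.zero_mem _
  rw [evw_eq e _ hb0]
  apply AddSubmonoid.subset_closure
  have hlt := hC1 _ (List.getElem_mem hq) _ hb
  have hbl : b.length ≤ 20 := by
    have := (code_lt b).trans_lt hlt
    exact ((Nat.pow_lt_pow_iff_right (by norm_num)).1 this).le
  have hwd : wd (code b) = b.reverse := by unfold wd; rw [code_dcd 20 b hbl]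
  have hB := chkB_true
  unfold chkB at hB
  rw [List.all_eq_true] at hB
  have hB := hB i (List.mem_range.2 hi15)
  rw [List.all_eq_true, hC3] at hB
  have hB := hB (ct w) (List.mem_range.2 (by simpa using hq))
  have e2 : (edat[i].map Prod.fst).getD (ct w) [] = edat[i][ct w].1 := by
    rw [List.getD_eq_getElem _ _ (by simpa using hq), List.getElem_map]
  rw [List.all_eq_true, e2] at hB
  have hB := hB _ hb
  simp only [Bool.and_eq_true, decide_eq_true_eq, hwd] at hB
  refine ⟨b.reverse, ⟨?_, by omega, hB.1.1.2⟩, rfl⟩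
  unfold lowW
  rw [← hwd]
  apply List.mem_map_of_mem
  rw [List.mem_flatten]
  refine ⟨edat[i][ct w].1, ?_, hb⟩
  rw [List.mem_flatten]
  have hib : i < blist.length := by rw [bl_len]; exact hi15
  refine ⟨blist.getD i [], ?_, ?_⟩
  · rw [List.getD_eq_getElem _ _ hib]; exact List.getElem_mem hib
  · rw [hC3]; exact List.mem_map_of_mem (List.getElem_mem hq)
theorem D_main (h7 : ∀ v : V, 7 • v = 0) (h : CS e) (w : LB) (h2 : 2 ≤ w.length) (h15 : w.length ≤ 15) :
    e w ∈ AddSubmonoid.closure (e '' (Bs : Set LB)) := by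
  by_cases hct : 2 * ct w ≤ w.length
  · refine AddSubmonoid.closure_mono ?_ (D_low e h7 h w h2 h15 hct)
    apply Set.image_mono
    rintro b ⟨hb, -⟩
    exact (mem_Bs b).2 (Or.inl hb)
  · have hn := ct_not w
    have := D_low _ h7 (CS_not e h) (w.map not) (by simpa using h2) (by simpa using h15) (by rw [List.length_map]; omega)
    simp only [not_not] at this
    refine AddSubmonoid.closure_mono ?_ this
    rintro _ ⟨b, ⟨hb, hl, hc⟩, rfl⟩
    refine ⟨b.map not, (mem_Bs _).2 (Or.inr ⟨by rw [not_not]; exact hb, ?_⟩), rfl⟩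
    have := ct_not b
    rw [List.length_map] at *
    omega
theorem D_long (h7 : ∀ v : V, 7 • v = 0) (h : CS e) (w : LB) (h2 : 16 ≤ w.length) : e w = 0 := by
  have hz : (gdat.zip edat).length = 15 := by rw [List.length_zip, gdat_len, edat_len]; rfl
  have key : ∀ e : LB → V, CS e → ∀ p s, p.length = 15 → s ≠ [] → ct p ≤ 7 → e (p ++ s) = 0 := by
    intro e h p s hp hs hc
    have := (run_app e h7 h).2 p.reverse (by simp [hz, hp]) (by simpa [ct] using hc)
    obtain ⟨l, v, rfl⟩ := List.exists_cons_of_ne_nil hs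
    have := congrFun (congrFun this l) v
    simpa [ehh] using this
  have hw : w = w.take 15 ++ w.drop 15 := (List.take_append_drop 15 w).symm
  have hp : (w.take 15).length = 15 := by simp; omega
  have hs : w.drop 15 ≠ [] := by intro hh; have := congrArg List.length hh; simp at this; omega
  by_cases hc : ct (w.take 15) ≤ 7
  · rw [hw]; exact key e h _ _ hp hs hc
  · have hn := ct_not (w.take 15)
    have := key _ (CS_not e h) ((w.take 15).map not) ((w.drop 15).map not) (by simpa using hp) (by simpa using hs) (by omega)
    simp only [List.map_append, not_not] at this
    rw [hw]; exact this
end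
universe u in
theorem span7 {K : Type*} [Field K] [CharZero K] {E : Type u} [AddCommGroup E] [Module K E] (e : LB → E) (h : CS e) (d : ℕ)
    (S : Set LB)
    (H : ∀ (V : Type u) [AddCommGroup V] (_ : ∀ v : V, 7 • v = 0) (e' : LB → V) (_ : CS e') (w : LB), w.length = d →
      e' w ∈ AddSubmonoid.closure (e' '' S)) (w : LB) (hw : w.length = d) : e w ∈ Submodule.span K (e '' S) := by
  classical
  set L : Submodule ℤ E := Submodule.span ℤ (e '' {w | w.length = d}) with hL
  have hmem : ∀ w : LB, w.length = d → e w ∈ L := fun w hw => Submodule.subset_span ⟨w, hw, rfl⟩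
  set x : LB → L := fun w => if hw : w.length = d then ⟨e w, hmem w hw⟩ else 0 with hx
  have hxv : ∀ w : LB, w.length = d → ((x w : L) : E) = e w := fun w hw => by simp [hx, hw]
  have hx0 : ∀ w : LB, w.length ≠ d → x w = 0 := fun w hw => by simp [hx, hw]
  have hCS : CS x := by
    constructor
    · intro u v
      have hl : (u ++ v).length = (v ++ u).length := by simp [add_comm]
      by_cases hd : (u ++ v).length = d
      · apply Subtype.ext
        rw [hxv _ hd, hxv _ (hl ▸ hd), h.1]
      · rw [hx0 _ hd, hx0 _ (hl ▸ hd)]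
    · intro a ha
      have hl : ∀ σ : Sy 6, (List.ofFn (a ∘ σ)).flatten.length = (List.ofFn a).flatten.length := fun σ =>
        (List.Perm.flatten (Equiv.Perm.ofFn_comp_perm σ a)).length_eq
      by_cases hd : (List.ofFn a).flatten.length = d
      · apply Subtype.ext
        rw [AddSubmonoidClass.coe_finsetSum]
        refine (Finset.sum_congr rfl fun σ _ => hxv _ ((hl σ).trans hd)).trans ?_
        exact h.2 a ha
      · exact Finset.sum_eq_zero fun σ _ => hx0 _ (by rw [hl σ]; exact hd)
  set R : Submodule ℤ L := LinearMap.range (LinearMap.lsmul ℤ L 7) with hR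
  set S' : Submodule ℤ L := Submodule.span ℤ (x '' S) with hS'
  have htop : Submodule.span ℤ (x '' {w | w.length = d}) = ⊤ := by
    have : Function.Injective L.subtype := Subtype.val_injective
    apply Submodule.map_injective_of_injective this
    rw [Submodule.map_span, Submodule.map_top, Submodule.range_subtype, ← Set.image_comp]
    refine Eq.trans ?_ hL.symm
    congr 1
    apply Set.image_congr
    intro w hw
    exact hxv w hw
  have hle : (⊤ : Submodule ℤ L) ≤ S' ⊔ R := by
    rw [← htop, Submodule.span_le]
    rintro _ ⟨w, hw, rfl⟩
    have h1 := H (L ⧸ R) (by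
      intro v
      obtain ⟨y, rfl⟩ := R.mkQ_surjective v
      rw [← map_nsmul, Submodule.mkQ_apply, Submodule.Quotient.mk_eq_zero]
      refine ⟨y, ?_⟩
      show (7:ℤ) • y = 7 • y
      rw [← natCast_zsmul]; rfl) (fun w => R.mkQ (x w)) ⟨fun u v => congrArg R.mkQ (hCS.1 u v), fun a ha => by
        show ∑ σ : Sy 6, R.mkQ (x _) = 0
        rw [← map_sum, hCS.2 a ha, map_zero]⟩ w hw
    have h2 : (AddSubmonoid.closure ((fun w => R.mkQ (x w)) '' S)) ≤ (S'.map R.mkQ).toAddSubmonoid := by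
      rw [AddSubmonoid.closure_le]
      rintro _ ⟨b, hb, rfl⟩
      exact ⟨x b, Submodule.subset_span ⟨b, hb, rfl⟩, rfl⟩
    obtain ⟨y, hy, hyx⟩ := h2 h1
    have h3 : x w - y ∈ R := by
      rw [← Submodule.Quotient.mk_eq_zero, ← Submodule.mkQ_apply, map_sub, sub_eq_zero]; exact hyx.symm
    show x w ∈ S' ⊔ R
    rw [Submodule.mem_sup]
    exact ⟨y, hy, _, h3, by abel⟩
  have hfg : (⊤ : Submodule ℤ (L ⧸ S')).FG := by
    have h1 : (⊤ : Submodule ℤ L).FG := by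
      rw [← htop]
      refine Submodule.fg_span (Set.Finite.image _ ?_)
      exact List.finite_length_eq Bool d
    have := h1.map S'.mkQ
    rwa [Submodule.map_top, Submodule.range_mkQ] at this
  obtain ⟨r, hr1, hr2⟩ := Submodule.exists_sub_one_mem_and_smul_eq_zero_of_fg_of_le_smul (Ideal.span {(7:ℤ)}) (⊤ : Submodule ℤ (L ⧸ S')) hfg (by
    intro z _
    obtain ⟨y, rfl⟩ := S'.mkQ_surjective z
    obtain ⟨s, hs, t, ⟨t, rfl⟩, rfl⟩ := Submodule.mem_sup.1 (hle (Submodule.mem_top (x := y)))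
    have hs0 : S'.mkQ s = 0 := by rw [Submodule.mkQ_apply, Submodule.Quotient.mk_eq_zero]; exact hs
    rw [map_add, hs0, zero_add, LinearMap.lsmul_apply, map_smul]
    exact Submodule.smul_mem_smul (Ideal.mem_span_singleton_self _) Submodule.mem_top)
  have hr0 : r ≠ 0 := by
    rintro rfl
    rw [Ideal.mem_span_singleton] at hr1
    norm_num at hr1
  have h5 := hr2 (S'.mkQ (x w)) Submodule.mem_top
  rw [← map_smul, Submodule.mkQ_apply, Submodule.Quotient.mk_eq_zero] at h5
  have h6 : ∀ y ∈ S', ((y : L) : E) ∈ Submodule.span K (e '' S) := by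
    intro y hy
    have : S' ≤ ((Submodule.span K (e '' S)).restrictScalars ℤ).comap L.subtype := by
      rw [hS', Submodule.span_le]
      rintro _ ⟨b, hb, rfl⟩
      show ((x b : L) : E) ∈ Submodule.span K (e '' S)
      by_cases hd : b.length = d
      · rw [hxv b hd]; exact Submodule.subset_span ⟨b, hb, rfl⟩
      · rw [hx0 b hd]; exact Submodule.zero_mem _
    exact this hy
  have h7 := h6 _ h5
  rw [Submodule.coe_smul, hxv w hw, ← Int.cast_smul_eq_zsmul K] at h7
  have hrK : (r : K) ≠ 0 := by exact_mod_cast hr0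
  exact (Submodule.smul_mem_iff _ hrK).1 h7
theorem Bs_sp (K : Type*) [Field K] [CharZero K] (w : LB) (hw : w ≠ []) : ee K 5 w ∈ Submodule.span K (ee K 5 '' (Bs : Set LB)) := by
  have hCS : CS (ee K 5) := ⟨ee_cyc K 5, fun a ha => ee_rel K 5 5 (by norm_num) a ha⟩
  have hl := List.length_pos_iff.2 hw
  rcases Nat.lt_or_ge w.length 2 with h1 | h2
  · have : w = [false] ∨ w = [true] := by
      match w, hl, h1 with
      | [false], _, _ => exact Or.inl rfl
      | [true], _, _ => exact Or.inr rfl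
    apply Submodule.subset_span
    refine ⟨w, ?_, rfl⟩
    have m1 : [false] ∈ Bs := by decide +kernel
    have m2 : [true] ∈ Bs := by decide +kernel
    rcases this with rfl | rfl
    · exact m1
    · exact m2
  rcases Nat.lt_or_ge w.length 16 with h3 | h3
  · exact span7 (ee K 5) hCS w.length _ (fun V _ h7 e' h' w' hw' => D_main e' h7 h' w' (by omega) (by omega)) w rfl
  · have := span7 (K := K) (ee K 5) hCS w.length ∅ (fun V _ h7 e' h' w' hw' => by
      rw [D_long e' h7 h' w' (by omega)]; exact AddSubmonoid.zero_mem _) w rfl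
    exact Submodule.span_mono (Set.image_mono (Set.empty_subset _)) this
end PD
end
/-- Every minimal bihomogeneous generating set of `C_{5,2}` has cardinality 173; in
particular `C_{5,2}` has a minimal generating set consisting of 173 bihomogeneous
polynomials. -/
theorem minimal_generating_sets_C52 (K : Type*) [Field K] [CharZero K] :
    (∀ S : Set (MvPolynomial (MatVar 5) K),
      (∀ f ∈ S, ∃ p q : ℕ, f.IsWeightedHomogeneous (bideg 5) (p, q)) →
      Algebra.adjoin K S = pureAlg K 5 →
      (∀ T : Set (MvPolynomial (MatVar 5) K), T ⊂ S → Algebra.adjoin K T ≠ pureAlg K 5) →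
      S.ncard = 173) ∧
    ∃ S : Set (MvPolynomial (MatVar 5) K),
      (∀ f ∈ S, ∃ p q : ℕ, f.IsWeightedHomogeneous (bideg 5) (p, q)) ∧
      Algebra.adjoin K S = pureAlg K 5 ∧
      (∀ T : Set (MvPolynomial (MatVar 5) K), T ⊂ S → Algebra.adjoin K T ≠ pureAlg K 5) ∧
      S.ncard = 173 := by
  have h := final_red (K := K) (n := 5) PD.Bs PD.Bs_ne (PD.Bs_li K) (PD.Bs_sp K)
  rw [PD.Bs_card] at h
  exact h
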